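/- Let k be an algebraically closed field of prime characteristic p ≥ 3 and let Λ = Λ_k(p, 2p). Then there exist a positive integer t and a right Λ-module Y such that V^{⊗2p} ≅ k^t ⊕ Y as right Λ-modules, where k denotes the trivial module, and Y is a tilting Λ-module: Ext^i_Λ(Y, Y) = 0 for all i ≥ 1, Y has finite projective dimension over Λ, and there is an exact sequence 0 → Λ → Y_0 → ⋯ → Y_m → 0 of right Λ-modules with every Y_j in add Y. -/

import Mathlib

universe u

/-- `PDimLE A n M`: the `A`-module `M` has projective dimension at most `n`,
witnessed by a projective resolution of length at most `n`. -/
def PDimLE (A : Type u) [Ring A] : ℕ → (M : Type u) → [AddCommGroup M] → [Module A M] → Prop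
  | 0, M, _, _ => Module.Projective A M
  | n + 1, M, _, _ =>
      ∃ (P : Type u) (_ : AddCommGroup P) (_ : Module A P) (f : P →ₗ[A] M),
        Module.Projective A P ∧ Function.Surjective f ∧ PDimLE A n (LinearMap.ker f)

/-- `MemAdd A Q X` : the `A`-module `X` belongs to `add Q`, i.e. `X` is (isomorphic to)
a direct summand of a finite direct sum of copies of `Q`. -/
def MemAdd (A : Type u) [Ring A] (Q : Type u) [AddCommGroup Q] [Module A Q]
    (X : Type u) [AddCommGroup X] [Module A X] : Prop :=
  ∃ (m : ℕ) (Y : Type u) (_ : AddCommGroup Y) (_ : Module A Y),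
    Nonempty ((X × Y) ≃ₗ[A] (Fin m → Q))

/-- The representation of the symmetric group `S_d` on the `d`-th tensor power of `V = k^n`
by place permutations; the tensor power `V^{⊗ d}` is realised as the free `k`-module on the
set of multi-indices `Fin d → Fin n`, i.e. as the functions `(Fin d → Fin n) → k`. -/
def placePerm (k : Type u) [Field k] (n d : ℕ) :
    Representation k (Equiv.Perm (Fin d)) ((Fin d → Fin n) → k) where
  toFun σ :=
    { toFun := fun f v => f (v ∘ σ)
      map_add' := fun _ _ => rfl
      map_smul' := fun _ _ => rfl }
  map_one' := by ext f v; rfl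
  map_mul' := fun σ τ => by ext f v; rfl

/-- The group algebra of the symmetric group on `d` letters over `k`. -/
abbrev SymGroupAlgebra (k : Type u) [Field k] (d : ℕ) : Type u :=
  MonoidAlgebra k (Equiv.Perm (Fin d))

/-- The tensor space `V^{⊗ d}`, `V = k^n`, as a module over the group algebra of `S_d`
(the symmetric group acting by place permutations). -/
def TensorSpace (k : Type u) [Field k] (n d : ℕ) : Type u := (Fin d → Fin n) → k

instance (k : Type u) [Field k] (n d : ℕ) : AddCommGroup (TensorSpace k n d) :=
  inferInstanceAs (AddCommGroup ((Fin d → Fin n) → k))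

instance (k : Type u) [Field k] (n d : ℕ) : Module k (TensorSpace k n d) :=
  inferInstanceAs (Module k ((Fin d → Fin n) → k))

noncomputable instance (k : Type u) [Field k] (n d : ℕ) :
    Module (SymGroupAlgebra k d) (TensorSpace k n d) where
  smul r t := (placePerm k n d).asAlgebraHom r t
  one_smul t := by show (placePerm k n d).asAlgebraHom 1 t = t; rw [map_one]; rfl
  mul_smul r s t := by
    show (placePerm k n d).asAlgebraHom (r * s) t
      = (placePerm k n d).asAlgebraHom r ((placePerm k n d).asAlgebraHom s t)
    rw [map_mul]; rfl
  smul_zero r := map_zero ((placePerm k n d).asAlgebraHom r)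
  smul_add r t₁ t₂ := map_add ((placePerm k n d).asAlgebraHom r) t₁ t₂
  add_smul r s t := by
    show (placePerm k n d).asAlgebraHom (r + s) t
      = (placePerm k n d).asAlgebraHom r t + (placePerm k n d).asAlgebraHom s t
    rw [map_add]; rfl
  zero_smul t := by show (placePerm k n d).asAlgebraHom 0 t = 0; rw [map_zero]; rfl

lemma tensorSpace_smul_def (k : Type u) [Field k] {n d : ℕ} (r : SymGroupAlgebra k d)
    (t : TensorSpace k n d) : r • t = (placePerm k n d).asAlgebraHom r t := rfl

/-- The Schur algebra `S_k(n, d)`: the endomorphism algebra of the tensor space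
`(k^n)^{⊗ d}` as a module over the group algebra of the symmetric group `S_d`.
The tensor space is a left module over it by evaluation. -/
noncomputable abbrev SchurAlgebra (k : Type u) [Field k] (n d : ℕ) : Type u :=
  Module.End (SymGroupAlgebra k d) (TensorSpace k n d)

/-- The congruence relation on the group algebra `k S_d` corresponding to the two-sided
ideal `Ann_{k S_d}((k^n)^{⊗ d})`, the annihilator of the tensor space. -/
noncomputable def annihilatorCon (k : Type u) [Field k] (n d : ℕ) :
    RingCon (SymGroupAlgebra k d) where
  r a b := ∀ t : TensorSpace k n d, a • t = b • t
  iseqv :=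
    ⟨fun _ _ => rfl, fun h t => (h t).symm, fun h₁ h₂ t => (h₁ t).trans (h₂ t)⟩
  mul' := fun {a b c d'} h₁ h₂ t => by
    show (a * c) • t = (b * d') • t
    rw [mul_smul, mul_smul, h₂ t, h₁ (d' • t)]
  add' := fun {a b c d'} h₁ h₂ t => by
    show (a + c) • t = (b + d') • t
    rw [add_smul, add_smul, h₁ t, h₂ t]

/-- The algebra `Λ_k(n, d)`: the quotient of the group algebra of the symmetric group `S_d`
by the annihilator of the tensor space `(k^n)^{⊗ d}`. -/
noncomputable def LambdaAlgebra (k : Type u) [Field k] (n d : ℕ) : Type u :=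
  (annihilatorCon k n d).Quotient

noncomputable instance (k : Type u) [Field k] (n d : ℕ) : Ring (LambdaAlgebra k n d) :=
  inferInstanceAs (Ring (annihilatorCon k n d).Quotient)

/-- The tensor space is a module over `Λ_k(n, d)`. -/
noncomputable instance (k : Type u) [Field k] (n d : ℕ) :
    Module (LambdaAlgebra k n d) (TensorSpace k n d) where
  smul a t := Quotient.liftOn a (fun r => r • t) (fun _ _ h => h t)
  one_smul t := one_smul (SymGroupAlgebra k d) t
  mul_smul a b t := Quotient.inductionOn₂ a b (fun r s => mul_smul r s t)
  smul_zero a := Quotient.inductionOn a (fun r => smul_zero r)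
  smul_add a t₁ t₂ := Quotient.inductionOn a (fun r => smul_add r t₁ t₂)
  add_smul a b t := Quotient.inductionOn₂ a b (fun r s => add_smul r s t)
  zero_smul t := zero_smul (SymGroupAlgebra k d) t

/-- `Λ_k(n, d)` is a `k`-algebra. -/
noncomputable instance (k : Type u) [Field k] (n d : ℕ) : Algebra k (LambdaAlgebra k n d) :=
  RingHom.toAlgebra'
    ((RingCon.mk' (annihilatorCon k n d)).comp (algebraMap k (SymGroupAlgebra k d)))
    (fun c x => by
      refine Quotient.inductionOn x (fun r => ?_)
      show ((algebraMap k (SymGroupAlgebra k d) c * r : SymGroupAlgebra k d) :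
          (annihilatorCon k n d).Quotient)
        = ((r * algebraMap k (SymGroupAlgebra k d) c : SymGroupAlgebra k d) :
          (annihilatorCon k n d).Quotient)
      exact congrArg _ (Algebra.commutes c r))

/-- The augmentation map (sum of coefficients) on the group algebra of `S_d`. -/
noncomputable def augmentation (k : Type u) [Field k] (d : ℕ) : SymGroupAlgebra k d →ₐ[k] k :=
  MonoidAlgebra.lift k k (Equiv.Perm (Fin d)) 1

/-- The basis vector `e ⊗ ⋯ ⊗ e` of the tensor space, i.e. the delta function at the
constant multi-index `0`. -/
noncomputable def deltaConst (k : Type u) [Field k] (n d : ℕ) [NeZero n] : TensorSpace k n d :=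
  fun v => if v = (fun _ => (0 : Fin n)) then (1 : k) else 0

lemma smul_deltaConst_eval (k : Type u) [Field k] (n d : ℕ) [NeZero n]
    (a : SymGroupAlgebra k d) :
    (a • deltaConst k n d) (fun _ => (0 : Fin n)) = augmentation k d a := by
  induction a using MonoidAlgebra.induction_linear with
  | zero => rw [zero_smul, map_zero]; rfl
  | add f g hf hg => rw [add_smul, map_add, ← hf, ← hg]; rfl
  | single σ c =>
      rw [tensorSpace_smul_def, Representation.asAlgebraHom_single]
      show c • ((placePerm k n d σ) (deltaConst k n d) (fun _ => (0 : Fin n))) = _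
      have h1 : (placePerm k n d σ) (deltaConst k n d) (fun _ => (0 : Fin n))
          = deltaConst k n d (fun _ => (0 : Fin n)) := rfl
      have h2 : deltaConst k n d (fun _ => (0 : Fin n)) = 1 := if_pos rfl
      rw [h1, h2]
      show c * 1 = augmentation k d (MonoidAlgebra.single σ c)
      rw [mul_one]
      unfold augmentation
      rw [MonoidAlgebra.lift_single]
      simp

/-- The augmentation descends to `Λ_k(n, d)` (the trivial module embeds into the tensor
space as the span of `e ⊗ ⋯ ⊗ e`, so the annihilator of the tensor space acts by zero
on the trivial module). -/
noncomputable def augmentationLambda (k : Type u) [Field k] (n d : ℕ) [NeZero n] :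
    LambdaAlgebra k n d →+* k where
  toFun a := Quotient.liftOn a (fun r => augmentation k d r)
    (fun r s h => by
      show augmentation k d r = augmentation k d s
      rw [← smul_deltaConst_eval k n d r, ← smul_deltaConst_eval k n d s,
        h (deltaConst k n d)])
  map_one' := map_one (augmentation k d)
  map_mul' a b := Quotient.inductionOn₂ a b (fun r s => map_mul (augmentation k d) r s)
  map_zero' := map_zero (augmentation k d)
  map_add' a b := Quotient.inductionOn₂ a b (fun r s => map_add (augmentation k d) r s)

/-- The trivial module: the one-dimensional module `k` on which every element of the
symmetric group acts as the identity, viewed as a module over `Λ_k(n, d)`. -/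
def TrivialModule (k : Type u) [Field k] (n d : ℕ) : Type u := k

instance (k : Type u) [Field k] (n d : ℕ) : AddCommGroup (TrivialModule k n d) :=
  inferInstanceAs (AddCommGroup k)

noncomputable instance (k : Type u) [Field k] (n d : ℕ) [NeZero n] :
    Module (LambdaAlgebra k n d) (TrivialModule k n d) :=
  Module.compHom k (augmentationLambda k n d)

open CategoryTheory in
/-- `Ext^i_A(M, N) = 0`, where `A` is an algebra over the field `k` and `Ext` is computed
in the category of `A`-modules. -/
def ExtIsZero (k : Type u) [Field k] (A : Type u) [Ring A] [Algebra k A]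
    (M : Type u) [AddCommGroup M] [Module A M]
    (N : Type u) [AddCommGroup N] [Module A N] (i : ℕ) : Prop :=
  Subsingleton
    (((_root_.Ext k (ModuleCat.{u} A) i).obj (Opposite.op (ModuleCat.of A M))).obj
      (ModuleCat.of A N))

/-- There is an exact sequence `0 → M → X 0 → X 1 → ⋯ → X m → 0` with all `X i` in
`add Y`. -/
def HasFiniteCoresolutionByAdd (A : Type u) [Ring A] (Y : Type u) [AddCommGroup Y]
    [Module A Y] (M : Type u) [AddCommGroup M] [Module A M] : Prop :=
  ∃ (m : ℕ) (X : ℕ → Type u) (_ : ∀ i, AddCommGroup (X i)) (_ : ∀ i, Module A (X i))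
    (f : M →ₗ[A] X 0) (d : ∀ i, X i →ₗ[A] X (i + 1)),
    (∀ i, i ≤ m → MemAdd A Y (X i)) ∧
    Function.Injective f ∧
    (1 ≤ m → Function.Exact f (d 0)) ∧
    (∀ i, i + 2 ≤ m → Function.Exact (d i) (d (i + 1))) ∧
    (m = 0 → Function.Surjective f) ∧
    (∀ j, j + 1 = m → Function.Surjective (d j))

/-! ### Retracts and `add Y` -/

section RelativeHomologicalAlgebra

/-- `X` is a retract (a direct summand, up to isomorphism) of `X'`. -/
def IsRetract (A : Type*) [Ring A] (X X' : Type*) [AddCommGroup X] [Module A X]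
    [AddCommGroup X'] [Module A X'] : Prop :=
  ∃ (i : X →ₗ[A] X') (r : X' →ₗ[A] X), r ∘ₗ i = LinearMap.id

section Retract

variable {A : Type*} [Ring A] {X X' X'' Z Z' : Type*} [AddCommGroup X] [Module A X]
  [AddCommGroup X'] [Module A X'] [AddCommGroup X''] [Module A X'']
  [AddCommGroup Z] [Module A Z] [AddCommGroup Z'] [Module A Z']

lemma IsRetract.of_equiv (e : X ≃ₗ[A] X') : IsRetract A X X' :=
  ⟨e, e.symm, by ext; simp⟩

lemma IsRetract.trans (h : IsRetract A X X') (h' : IsRetract A X' X'') : IsRetract A X X'' := by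
  obtain ⟨i, r, h⟩ := h
  obtain ⟨i', r', h'⟩ := h'
  refine ⟨i' ∘ₗ i, r ∘ₗ r', ?_⟩
  ext x
  exact (congrArg r (LinearMap.congr_fun h' (i x))).trans (LinearMap.congr_fun h x)

lemma IsRetract.prodMap (h : IsRetract A X X') (h' : IsRetract A Z Z') :
    IsRetract A (X × Z) (X' × Z') := by
  obtain ⟨i, r, h⟩ := h
  obtain ⟨i', r', h'⟩ := h'
  refine ⟨i.prodMap i', r.prodMap r', ?_⟩
  rw [LinearMap.prodMap_comp, h, h', LinearMap.prodMap_id]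

lemma IsRetract.fst : IsRetract A X (X × Z) :=
  ⟨LinearMap.inl A X Z, LinearMap.fst A X Z, by ext; simp⟩

lemma IsRetract.of_subsingleton [Subsingleton X] : IsRetract A X X' :=
  ⟨0, 0, by ext x; exact Subsingleton.elim _ _⟩

lemma IsRetract.projective (h : IsRetract A X X') [Module.Projective A X'] :
    Module.Projective A X := by
  obtain ⟨i, r, h⟩ := h
  exact Module.Projective.of_split i r h

lemma exists_comp_eq_of_ker_le {g : X →ₗ[A] X'} (hg : Function.Surjective g)
    {l : X →ₗ[A] X''} (hl : ∀ x, g x = 0 → l x = 0) : ∃ m : X' →ₗ[A] X'', m ∘ₗ g = l := by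
  refine ⟨(LinearMap.ker g).liftQ l (fun x hx => hl x hx) ∘ₗ
    (g.quotKerEquivOfSurjective hg).symm.toLinearMap, ?_⟩
  ext x
  have : (g.quotKerEquivOfSurjective hg).symm (g x) = (LinearMap.ker g).mkQ x := by
    rw [LinearEquiv.symm_apply_eq]; rfl
  rw [LinearMap.comp_apply, LinearMap.comp_apply, LinearEquiv.coe_coe, this]
  rfl

end Retract

variable {A : Type u} [Ring A] {Y : Type u} [AddCommGroup Y] [Module A Y]

section MemAdd

variable {X X' : Type u} [AddCommGroup X] [Module A X] [AddCommGroup X'] [Module A X']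

lemma memAdd_iff : MemAdd A Y X ↔ ∃ m : ℕ, IsRetract A X (Fin m → Y) := by
  constructor
  · rintro ⟨m, Z, _, _, ⟨e⟩⟩
    exact ⟨m, IsRetract.fst.trans (.of_equiv e)⟩
  · rintro ⟨m, i, r, h⟩
    have h' : ∀ x, r (i x) = x := fun x => LinearMap.congr_fun h x
    refine ⟨m, LinearMap.ker r, inferInstance, inferInstance, ⟨LinearEquiv.ofBijective
      (i.coprod (LinearMap.ker r).subtype) ⟨?_, ?_⟩⟩⟩
    · rw [← LinearMap.ker_eq_bot, LinearMap.ker_eq_bot']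
      rintro ⟨x, z, hz⟩ h0
      replace h0 : i x + z = 0 := h0
      have hx : x = 0 := by simpa [h', LinearMap.mem_ker.1 hz] using congrArg r h0
      subst hx
      have : z = 0 := by simpa using h0
      ext1 <;> simp [this]
    · intro y
      refine ⟨(r y, ⟨y - i (r y), by simp [h']⟩), by simp⟩

lemma MemAdd.of_isRetract (h : MemAdd A Y X') (hX : IsRetract A X X') : MemAdd A Y X := by
  obtain ⟨m, h⟩ := memAdd_iff.1 h
  exact memAdd_iff.2 ⟨m, hX.trans h⟩

lemma MemAdd.prod (h : MemAdd A Y X) (h' : MemAdd A Y X') : MemAdd A Y (X × X') := by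
  obtain ⟨m, h⟩ := memAdd_iff.1 h
  obtain ⟨m', h'⟩ := memAdd_iff.1 h'
  exact memAdd_iff.2 ⟨m + m', (h.prodMap h').trans (.of_equiv
    ((LinearEquiv.sumArrowLequivProdArrow (Fin m) (Fin m') A Y).symm ≪≫ₗ
      LinearEquiv.funCongrLeft A Y finSumFinEquiv.symm))⟩

variable (A Y) in
lemma MemAdd.self : MemAdd A Y Y :=
  memAdd_iff.2 ⟨1, .of_equiv (LinearEquiv.funUnique (Fin 1) A Y).symm⟩

end MemAdd

/-! ### Exact sequences that stay exact under `Hom(-, Y)` -/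

section RelExact

variable {X X' X'' Z Z' Z'' : Type*} [AddCommGroup X] [Module A X]
  [AddCommGroup X'] [Module A X'] [AddCommGroup X''] [Module A X'']
  [AddCommGroup Z] [Module A Z] [AddCommGroup Z'] [Module A Z'] [AddCommGroup Z''] [Module A Z'']

/-- A short exact sequence `0 → X → X' → X'' → 0` that stays exact under `Hom(-, Y)`. -/
structure RelExact (Y : Type*) [AddCommGroup Y] [Module A Y]
    (f : X →ₗ[A] X') (g : X' →ₗ[A] X'') : Prop where
  inj : ∀ x, f x = 0 → x = 0
  comp : ∀ x, g (f x) = 0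
  exact : ∀ x, g x = 0 → ∃ y, f y = x
  surj : Function.Surjective g
  extend : ∀ h : X →ₗ[A] Y, ∃ h' : X' →ₗ[A] Y, h' ∘ₗ f = h

variable {f : X →ₗ[A] X'} {g : X' →ₗ[A] X''}

lemma RelExact.extend_memAdd {J : Type u} [AddCommGroup J] [Module A J] (E : RelExact Y f g)
    (hJ : MemAdd A Y J) (h : X →ₗ[A] J) : ∃ h' : X' →ₗ[A] J, ∀ x, h' (f x) = h x := by
  obtain ⟨m, i, r, hir⟩ := memAdd_iff.1 hJ
  choose l hl using fun j => E.extend (LinearMap.proj j ∘ₗ i ∘ₗ h)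
  refine ⟨r ∘ₗ LinearMap.pi l, fun x => ?_⟩
  have : (LinearMap.pi l) (f x) = i (h x) := by
    ext j; exact LinearMap.congr_fun (hl j) x
  rw [LinearMap.comp_apply, this]
  exact LinearMap.congr_fun hir (h x)

lemma RelExact.comp_equiv (E : RelExact Y f g) (e : Z ≃ₗ[A] X) :
    RelExact Y (f ∘ₗ e.toLinearMap) g where
  inj x hx := by simpa using E.inj _ hx
  comp x := E.comp _
  exact x hx := by
    obtain ⟨y, rfl⟩ := E.exact x hx
    exact ⟨e.symm y, by simp⟩
  surj := E.surj
  extend h := by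
    obtain ⟨h', hh⟩ := E.extend (h ∘ₗ e.symm.toLinearMap)
    exact ⟨h', by rw [← LinearMap.comp_assoc, hh]; ext; simp⟩

lemma RelExact.prodMap_id (E : RelExact Y f g) :
    RelExact Y (f.prodMap (LinearMap.id : Z →ₗ[A] Z)) (g ∘ₗ LinearMap.fst A X' Z) where
  inj := by
    rintro ⟨x, z⟩ h
    rw [Prod.ext_iff] at h
    exact Prod.ext (E.inj _ h.1) h.2
  comp x := E.comp _
  exact := by
    rintro ⟨x, z⟩ h
    obtain ⟨y, rfl⟩ := E.exact x h
    exact ⟨(y, z), rfl⟩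
  surj x := by
    obtain ⟨y, rfl⟩ := E.surj x
    exact ⟨(y, 0), rfl⟩
  extend h := by
    obtain ⟨h', hh⟩ := E.extend (h ∘ₗ LinearMap.inl A X Z)
    refine ⟨h'.coprod (h ∘ₗ LinearMap.inr A X Z), ?_⟩
    ext x
    · have h0 : h (0, 0) = 0 := map_zero h
      have h1 : h' (f x) = h (x, 0) := LinearMap.congr_fun hh x
      simp [h0, h1]
    · simp

lemma RelExact.prodMap_right (E : RelExact Y f g) :
    RelExact Y (LinearMap.inl A X' Z ∘ₗ f) (g.prodMap (LinearMap.id : Z →ₗ[A] Z)) where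
  inj x h := E.inj _ (Prod.ext_iff.1 h).1
  comp x := Prod.ext (E.comp _) rfl
  exact := by
    rintro ⟨x, z⟩ h
    rw [Prod.ext_iff] at h
    obtain ⟨y, rfl⟩ := E.exact x h.1
    exact ⟨y, Prod.ext rfl h.2.symm⟩
  surj := by
    rintro ⟨x, z⟩
    obtain ⟨y, rfl⟩ := E.surj x
    exact ⟨(y, z), rfl⟩
  extend h := by
    obtain ⟨h', hh⟩ := E.extend h
    exact ⟨h' ∘ₗ LinearMap.fst A X' Z, by ext x; simpa using LinearMap.congr_fun hh x⟩

lemma RelExact.equivProd (E : RelExact Y f g) (ρ : X' →ₗ[A] X) (hρ : ∀ x, ρ (f x) = x) :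
    Nonempty (X' ≃ₗ[A] X'' × X) := by
  refine ⟨LinearEquiv.ofBijective (g.prod ρ) ⟨?_, ?_⟩⟩
  · rw [← LinearMap.ker_eq_bot, LinearMap.ker_eq_bot']
    intro x hx
    rw [LinearMap.prod_apply, Prod.ext_iff] at hx
    obtain ⟨y, rfl⟩ := E.exact x hx.1
    have h2 : ρ (f y) = 0 := hx.2
    rw [← hρ y, h2, map_zero]
  · rintro ⟨c, a⟩
    obtain ⟨b, rfl⟩ := E.surj c
    refine ⟨b + f (a - ρ b), ?_⟩
    simp [LinearMap.prod_apply, hρ, E.comp]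

/-- Pushing out `0 → X → X' → X'' → 0` along an embedding of `X` into `J`. -/
lemma RelExact.pushout {J : Type*} [AddCommGroup J] [Module A J]
    (E : RelExact Y f g) {fA : X →ₗ[A] J} {gA : J →ₗ[A] Z} (EA : RelExact Y fA gA)
    (h : X' →ₗ[A] J) (hh : ∀ x, h (f x) = fA x) :
    ∃ (α : X' →ₗ[A] J × X'') (β : J × X'' →ₗ[A] Z), RelExact Y α β := by
  obtain ⟨θ, hθ⟩ := exists_comp_eq_of_ker_le E.surj (l := gA ∘ₗ h) (by
    intro x hx
    obtain ⟨y, rfl⟩ := E.exact x hx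
    simp [hh, EA.comp])
  have hθ' : ∀ x, θ (g x) = gA (h x) := fun x => LinearMap.congr_fun hθ x
  refine ⟨h.prod g, gA.coprod (-θ), ?_, ?_, ?_, ?_, ?_⟩
  · intro x hx
    rw [LinearMap.prod_apply, Prod.ext_iff] at hx
    obtain ⟨y, rfl⟩ := E.exact x hx.2
    have h1 : fA y = 0 := by rw [← hh]; exact hx.1
    rw [EA.inj y h1, map_zero]
  · intro x
    simp [LinearMap.prod_apply, hθ']
  · rintro ⟨j, c⟩ h0
    obtain ⟨b, rfl⟩ := E.surj c
    have h1 : gA (j - h b) = 0 := by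
      simpa [hθ', sub_eq_add_neg] using h0
    obtain ⟨a, ha⟩ := EA.exact _ h1
    refine ⟨b + f a, ?_⟩
    simp [LinearMap.prod_apply, hh, ha, E.comp]
  · intro z
    obtain ⟨j, rfl⟩ := EA.surj z
    exact ⟨(j, 0), by simp⟩
  · intro l
    obtain ⟨l₁, hl₁⟩ := EA.extend (l ∘ₗ f)
    obtain ⟨m, hm⟩ := exists_comp_eq_of_ker_le E.surj (l := l - l₁ ∘ₗ h) (by
      intro x hx
      obtain ⟨y, rfl⟩ := E.exact x hx
      have := LinearMap.congr_fun hl₁ y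
      simp only [LinearMap.comp_apply] at this
      simp [hh, this])
    refine ⟨l₁.coprod m, ?_⟩
    ext x
    have := LinearMap.congr_fun hm x
    simp only [LinearMap.comp_apply, LinearMap.sub_apply] at this
    simp [this]

/-- Pulling back `0 → X → X' → X'' → 0` along a surjection from `P` onto `X''`. -/
lemma RelExact.pullback {P K : Type*} [AddCommGroup P] [Module A P] [AddCommGroup K] [Module A K]
    (E : RelExact Y f g) {fP : K →ₗ[A] P} {gP : P →ₗ[A] X''} (EP : RelExact Y fP gP)
    (h : P →ₗ[A] X') (hh : ∀ x, g (h x) = gP x) :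
    ∃ (α : K →ₗ[A] P × X) (β : P × X →ₗ[A] X'), RelExact Y α β := by
  have hex : ∀ κ, ∃ x, f x = h (fP κ) := fun κ => E.exact _ (by rw [hh, EP.comp])
  choose θ hθ using hex
  have finj : ∀ x y, f x = f y → x = y := fun x y hxy =>
    sub_eq_zero.1 (E.inj _ (by rw [map_sub, hxy, sub_self]))
  let Θ : K →ₗ[A] X :=
    { toFun := θ
      map_add' := fun x y => finj _ _ (by rw [hθ, map_add, map_add, map_add, hθ, hθ])
      map_smul' := fun r x => finj _ _ (by
        rw [hθ, RingHom.id_apply, map_smul, map_smul, map_smul, hθ]) }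
  have hΘ : ∀ κ, f (Θ κ) = h (fP κ) := hθ
  refine ⟨fP.prod (-Θ), h.coprod f, ?_, ?_, ?_, ?_, ?_⟩
  · intro x hx
    rw [LinearMap.prod_apply, Prod.ext_iff] at hx
    exact EP.inj _ hx.1
  · intro x
    simp [LinearMap.prod_apply, hΘ]
  · rintro ⟨q, x⟩ h0
    replace h0 : h q + f x = 0 := h0
    have h1 : gP q = 0 := by
      rw [← hh, eq_neg_of_add_eq_zero_left h0, map_neg, E.comp, neg_zero]
    obtain ⟨κ, rfl⟩ := EP.exact q h1
    refine ⟨κ, Prod.ext rfl (finj _ _ ?_)⟩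
    simp [LinearMap.prod_apply, hΘ, eq_neg_of_add_eq_zero_left h0]
  · intro b
    obtain ⟨q, hq⟩ := EP.surj (g b)
    obtain ⟨x, hx⟩ := E.exact (b - h q) (by rw [map_sub, hh, hq, sub_self])
    exact ⟨(q, x), by simp [hx]⟩
  · intro l
    obtain ⟨l₁, hl₁⟩ := EP.extend l
    exact ⟨l₁ ∘ₗ LinearMap.fst A P X, by
      ext x; simpa [LinearMap.prod_apply] using LinearMap.congr_fun hl₁ x⟩

/-- The sequence `0 → X → J → D → 0` obtained from `X ⊆ X' ⊆ J`, with `D` an extension of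
`J / X'` by `X''`. -/
lemma RelExact.cokernel {J : Type*} {B : Type*} [AddCommGroup J] [Module A J] [AddCommGroup B]
    [Module A B] (E : RelExact Y f g) {f₁ : X' →ₗ[A] J} {g₁ : J →ₗ[A] B}
    (E₁ : RelExact Y f₁ g₁) :
    RelExact Y (f₁ ∘ₗ f) (LinearMap.range (f₁ ∘ₗ f)).mkQ ∧
    ∃ (α : X'' →ₗ[A] J ⧸ LinearMap.range (f₁ ∘ₗ f)) (β : J ⧸ LinearMap.range (f₁ ∘ₗ f) →ₗ[A] B),
      RelExact Y α β := by
  have finj : ∀ x y, f₁ x = f₁ y → x = y := fun x y hxy =>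
    sub_eq_zero.1 (E₁.inj _ (by rw [map_sub, hxy, sub_self]))
  set q := (LinearMap.range (f₁ ∘ₗ f)).mkQ with hq
  have qz : ∀ j, q j = 0 ↔ ∃ x, f₁ (f x) = j := fun j => by
    rw [hq, Submodule.mkQ_apply, Submodule.Quotient.mk_eq_zero]; rfl
  have qs : Function.Surjective q := Submodule.mkQ_surjective _
  refine ⟨⟨fun x hx => E.inj _ (E₁.inj _ hx), fun x => (qz _).2 ⟨x, rfl⟩,
    fun j hj => (qz j).1 hj, qs, ?_⟩, ?_⟩
  · intro l
    obtain ⟨l₁, rfl⟩ := E.extend l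
    obtain ⟨l₂, rfl⟩ := E₁.extend l₁
    exact ⟨l₂, rfl⟩
  obtain ⟨θ, hθ⟩ := exists_comp_eq_of_ker_le E.surj (l := q ∘ₗ f₁) (by
    intro x hx
    obtain ⟨y, rfl⟩ := E.exact x hx
    exact (qz _).2 ⟨y, rfl⟩)
  obtain ⟨τ, hτ⟩ := exists_comp_eq_of_ker_le qs (l := g₁) (by
    intro j hj
    obtain ⟨y, rfl⟩ := (qz j).1 hj
    exact E₁.comp _)
  have hθ' : ∀ x, θ (g x) = q (f₁ x) := fun x => LinearMap.congr_fun hθ x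
  have hτ' : ∀ x, τ (q x) = g₁ x := fun x => LinearMap.congr_fun hτ x
  refine ⟨θ, τ, ?_, ?_, ?_, ?_, ?_⟩
  · intro c hc
    obtain ⟨b, rfl⟩ := E.surj c
    rw [hθ', qz] at hc
    obtain ⟨a, ha⟩ := hc
    rw [← finj _ _ ha, E.comp]
  · intro c
    obtain ⟨b, rfl⟩ := E.surj c
    rw [hθ', hτ', E₁.comp]
  · intro d hd
    obtain ⟨j, rfl⟩ := qs d
    rw [hτ'] at hd
    obtain ⟨b, rfl⟩ := E₁.exact _ hd
    exact ⟨g b, hθ' b⟩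
  · intro b
    obtain ⟨j, rfl⟩ := E₁.surj b
    exact ⟨q j, hτ' j⟩
  · intro l
    obtain ⟨l₁, hl₁⟩ := E₁.extend (l ∘ₗ g)
    have hl₁' : ∀ x, l₁ (f₁ x) = l (g x) := fun x => LinearMap.congr_fun hl₁ x
    obtain ⟨m, hm⟩ := exists_comp_eq_of_ker_le qs (l := l₁) (by
      intro j hj
      obtain ⟨y, rfl⟩ := (qz j).1 hj
      rw [hl₁', E.comp, map_zero])
    refine ⟨m, ?_⟩
    ext c
    obtain ⟨b, rfl⟩ := E.surj c
    rw [LinearMap.comp_apply, hθ', ← hl₁']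
    exact LinearMap.congr_fun hm _

/-- The sequence `0 → D → P → X'' → 0` obtained from `P ↠ X' ↠ X''`, with `D` an extension of
`X` by the kernel of `P → X'`. -/
lemma RelExact.kernel {P K : Type*} [AddCommGroup P] [Module A P] [AddCommGroup K] [Module A K]
    (E : RelExact Y f g) {f₁ : K →ₗ[A] P} {g₁ : P →ₗ[A] X'} (E₁ : RelExact Y f₁ g₁) :
    RelExact Y (LinearMap.ker (g ∘ₗ g₁)).subtype (g ∘ₗ g₁) ∧
    ∃ (α : K →ₗ[A] LinearMap.ker (g ∘ₗ g₁)) (β : LinearMap.ker (g ∘ₗ g₁) →ₗ[A] X),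
      RelExact Y α β := by
  have finj : ∀ x y, f x = f y → x = y := fun x y hxy =>
    sub_eq_zero.1 (E.inj _ (by rw [map_sub, hxy, sub_self]))
  let α : K →ₗ[A] LinearMap.ker (g ∘ₗ g₁) := f₁.codRestrict _ (fun x => by
    simp [E₁.comp])
  have hex : ∀ d : LinearMap.ker (g ∘ₗ g₁), ∃ x, f x = g₁ d := fun d => E.exact _ d.2
  choose θ hθ using hex
  let β : LinearMap.ker (g ∘ₗ g₁) →ₗ[A] X :=
    { toFun := θ
      map_add' := fun x y => finj _ _ (by
        rw [hθ, map_add, hθ, hθ, Submodule.coe_add, map_add])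
      map_smul' := fun r x => finj _ _ (by
        rw [hθ, RingHom.id_apply, map_smul, hθ, Submodule.coe_smul, map_smul]) }
  have hβ : ∀ d, f (β d) = g₁ d := hθ
  have E' : RelExact Y α β := by
    refine ⟨?_, ?_, ?_, ?_, ?_⟩
    · intro x hx
      exact E₁.inj _ (congrArg Subtype.val hx)
    · intro x
      apply finj
      rw [hβ, map_zero]
      exact E₁.comp x
    · rintro d hd
      have : g₁ d = 0 := by rw [← hβ, hd, map_zero]
      obtain ⟨κ, hκ⟩ := E₁.exact _ this
      exact ⟨κ, Subtype.ext hκ⟩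
    · intro x
      obtain ⟨q, hq⟩ := E₁.surj (f x)
      refine ⟨⟨q, by simp [hq, E.comp]⟩, finj _ _ ?_⟩
      rw [hβ]; exact hq
    · intro l
      obtain ⟨l₁, hl₁⟩ := E₁.extend l
      exact ⟨l₁ ∘ₗ Submodule.subtype _, hl₁⟩
  refine ⟨⟨fun x hx => Subtype.ext hx, fun x => x.2, fun x hx => ⟨⟨x, hx⟩, rfl⟩,
    E.surj.comp E₁.surj, ?_⟩, α, β, E'⟩
  intro l
  obtain ⟨l₁, hl₁⟩ := E₁.extend (l ∘ₗ α)
  have hl₁' : ∀ x, l₁ (f₁ x) = l (α x) := fun x => LinearMap.congr_fun hl₁ x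
  obtain ⟨m, hm⟩ := exists_comp_eq_of_ker_le E'.surj
    (l := l - l₁ ∘ₗ Submodule.subtype _) (by
      intro x hx
      obtain ⟨y, rfl⟩ := E'.exact x hx
      rw [LinearMap.sub_apply, ← hl₁', LinearMap.comp_apply, Submodule.subtype_apply]
      exact sub_self _)
  have hm' : ∀ x, m (β x) = l x - l₁ x := fun x => LinearMap.congr_fun hm x
  obtain ⟨n, hn⟩ := E.extend m
  have hn' : ∀ x, n (f x) = m x := fun x => LinearMap.congr_fun hn x
  refine ⟨l₁ + n ∘ₗ g₁, ?_⟩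
  ext x
  simp [← hβ, hn', hm']

end RelExact

/-! ### Relative coresolutions by `add Y` -/

/-- `X` has a finite coresolution by modules in `add Y` that stays exact under `Hom(-, Y)`. -/
inductive RelCores (A : Type u) [Ring A] (Y : Type u) [AddCommGroup Y] [Module A Y] :
    ∀ (X : Type u) [AddCommGroup X] [Module A X], Prop
  | of_memAdd {X : Type u} [AddCommGroup X] [Module A X] : MemAdd A Y X → RelCores A Y X
  | step {X J C : Type u} [AddCommGroup X] [Module A X] [AddCommGroup J] [Module A J]
      [AddCommGroup C] [Module A C] {f : X →ₗ[A] J} {g : J →ₗ[A] C} :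
      RelExact Y f g → MemAdd A Y J → RelCores A Y C → RelCores A Y X

section RelCores

variable {X X' X'' J : Type u} [AddCommGroup X] [Module A X] [AddCommGroup X'] [Module A X']
  [AddCommGroup X''] [Module A X''] [AddCommGroup J] [Module A J]
  {f : X →ₗ[A] X'} {g : X' →ₗ[A] X''}

lemma RelCores.of_equiv (h : RelCores A Y X) (e : X' ≃ₗ[A] X) : RelCores A Y X' := by
  cases h with
  | of_memAdd h => exact .of_memAdd (h.of_isRetract (.of_equiv e))
  | step E hJ hC => exact .step (E.comp_equiv e) hJ hC

lemma RelCores.prod_memAdd (h : RelCores A Y X) (hJ : MemAdd A Y J) : RelCores A Y (X × J) := by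
  cases h with
  | of_memAdd h => exact .of_memAdd (h.prod hJ)
  | step E hJ' hC => exact .step E.prodMap_id (hJ'.prod hJ) hC

lemma RelCores.of_prod {P : Type u} [AddCommGroup P] [Module A P] (h : RelCores A Y P)
    (e : P ≃ₗ[A] X × J) (hJ : MemAdd A Y J) : RelCores A Y X := by
  cases h with
  | of_memAdd h => exact .of_memAdd (h.of_isRetract (IsRetract.fst.trans (.of_equiv e.symm)))
  | @step _ J₀ C _ _ _ _ _ _ f g E hJ' hC =>
    obtain ⟨ρ, hρ⟩ := E.extend_memAdd hJ (LinearMap.snd A X J ∘ₗ e.toLinearMap)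
    refine .step (f := f ∘ₗ e.symm.toLinearMap ∘ₗ LinearMap.inl A X J) (g := g.prod ρ)
      ⟨?_, ?_, ?_, ?_, ?_⟩ hJ' (hC.prod_memAdd hJ)
    · intro x hx
      have := E.inj _ hx
      simpa using this
    · intro x
      simp [LinearMap.prod_apply, hρ, E.comp]
    · intro j hj
      rw [LinearMap.prod_apply, Prod.ext_iff] at hj
      obtain ⟨x, rfl⟩ := E.exact j hj.1
      have h2 : (e x).2 = 0 := by
        have h3 : ρ (f x) = 0 := hj.2
        rw [hρ] at h3
        exact h3
      refine ⟨(e x).1, ?_⟩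
      have : ((e x).1, (0 : J)) = e x := Prod.ext rfl h2.symm
      simp [this]
    · rintro ⟨c, j⟩
      obtain ⟨j₀, rfl⟩ := E.surj c
      refine ⟨j₀ + f (e.symm (0, j - ρ j₀)), ?_⟩
      simp [LinearMap.prod_apply, hρ, E.comp]
    · intro h
      obtain ⟨h', hh⟩ := E.extend (h ∘ₗ LinearMap.fst A X J ∘ₗ e.toLinearMap)
      refine ⟨h', ?_⟩
      ext x
      simpa using LinearMap.congr_fun hh (e.symm (x, 0))

lemma RelCores.left_aux (E : RelExact Y f g) (hX' : RelCores A Y X')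
    (hX'' : RelCores A Y X'')
    (hb : ∀ {B D : Type u} [AddCommGroup B] [Module A B] [AddCommGroup D] [Module A D]
      {α : X'' →ₗ[A] D} {β : D →ₗ[A] B}, RelExact Y α β → RelCores A Y B → RelCores A Y D) :
    RelCores A Y X := by
  cases hX' with
  | of_memAdd h => exact .step E h hX''
  | step E₁ hJ hC =>
    obtain ⟨E', α, β, E''⟩ := E.cokernel E₁
    exact .step E' hJ (hb E'' hC)

lemma RelCores.middle (E : RelExact Y f g) (hX : RelCores A Y X) (hX'' : RelCores A Y X'') :
    RelCores A Y X' := by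
  induction hX generalizing X' X'' with
  | of_memAdd h =>
    obtain ⟨ρ, hρ⟩ := E.extend_memAdd h LinearMap.id
    obtain ⟨e⟩ := E.equivProd ρ hρ
    exact (hX''.prod_memAdd h).of_equiv e
  | step E₁ hJ hC ih =>
    obtain ⟨h, hh⟩ := E.extend_memAdd hJ _
    obtain ⟨α, β, E'⟩ := E.pushout E₁ h hh
    exact RelCores.left_aux E' ((hX''.prod_memAdd hJ).of_equiv (LinearEquiv.prodComm A _ _)) hC ih

lemma RelCores.left (E : RelExact Y f g) (hX' : RelCores A Y X') (hX'' : RelCores A Y X'') :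
    RelCores A Y X :=
  RelCores.left_aux E hX' hX'' (fun E' hB => RelCores.middle E' hX'' hB)

lemma RelCores.right (E : RelExact Y f g) (hX : RelCores A Y X) (hX' : RelCores A Y X') :
    RelCores A Y X'' := by
  cases hX with
  | of_memAdd h =>
    obtain ⟨ρ, hρ⟩ := E.extend_memAdd h LinearMap.id
    obtain ⟨e⟩ := E.equivProd ρ hρ
    exact hX'.of_prod e h
  | step E₁ hJ hC =>
    obtain ⟨h, hh⟩ := E.extend_memAdd hJ _
    obtain ⟨α, β, E'⟩ := E.pushout E₁ h hh
    exact (RelCores.middle E' hX' hC).of_prod (LinearEquiv.prodComm A _ _) hJ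

lemma RelCores.hasFiniteCoresolutionByAdd (h : RelCores A Y X) :
    HasFiniteCoresolutionByAdd A Y X := by
  induction h with
  | @of_memAdd X _ _ h =>
    exact ⟨0, fun _ => X, inferInstance, inferInstance, LinearMap.id, fun _ => 0,
      fun _ _ => h, Function.injective_id, by simp, by simp, fun _ => Function.surjective_id,
      by simp⟩
  | @step X J C _ _ _ _ _ _ f g E hJ hC ih =>
    obtain ⟨m, X', i₁, i₂, f', d', h₁, h₂, h₃, h₄, h₅, h₆⟩ := ih
    let X'' : ℕ → Type u := fun n => Nat.casesOn n J X'
    let j₁ : ∀ n, AddCommGroup (X'' n) := fun n =>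
      match n with
      | 0 => (inferInstance : AddCommGroup J)
      | n + 1 => i₁ n
    let j₂ : ∀ n, @Module A (X'' n) _ (j₁ n).toAddCommMonoid := fun n =>
      match n with
      | 0 => (inferInstance : Module A J)
      | n + 1 => i₂ n
    let d'' : ∀ n, @LinearMap A A _ _ (RingHom.id A) (X'' n) (X'' (n + 1)) (j₁ n).toAddCommMonoid
        (j₁ (n + 1)).toAddCommMonoid (j₂ n) (j₂ (n + 1)) := fun n =>
      match n with
      | 0 => (f' ∘ₗ g : J →ₗ[A] X' 0)
      | n + 1 => d' n
    have hfg : Function.Exact f g := fun x => ⟨E.exact x, by rintro ⟨y, rfl⟩; exact E.comp y⟩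
    refine ⟨m + 1, X'', j₁, j₂, f, d'', ?_, ?_, ?_, ?_, ?_, ?_⟩
    · rintro (_ | i) hi
      · exact hJ
      · exact h₁ i (by omega)
    · exact (injective_iff_map_eq_zero f).2 E.inj
    · intro _ x
      show f' (g x) = 0 ↔ _
      rw [← hfg x, ← map_zero f', h₂.eq_iff]
    · rintro (_ | i) hi
      · intro x
        have := h₃ (by omega) x
        show d' 0 x = 0 ↔ x ∈ Set.range (fun y => f' (g y))
        rw [this]
        constructor
        · rintro ⟨y, rfl⟩
          obtain ⟨z, rfl⟩ := E.surj y
          exact ⟨z, rfl⟩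
        · rintro ⟨z, rfl⟩
          exact ⟨g z, rfl⟩
      · exact h₄ i (by omega)
    · omega
    · rintro (_ | j) hj
      · exact (h₅ (by omega)).comp E.surj
      · exact h₆ j (by omega)

end RelCores

/-! ### Relative projective resolutions -/

/-- `X` has a finite projective resolution that stays exact under `Hom(-, Y)`. -/
inductive RelRes (A : Type u) [Ring A] (Y : Type u) [AddCommGroup Y] [Module A Y] :
    ∀ (X : Type u) [AddCommGroup X] [Module A X], Prop
  | of_projective {X : Type u} [AddCommGroup X] [Module A X] :
      Module.Projective A X → RelRes A Y X
  | step {K P X : Type u} [AddCommGroup K] [Module A K] [AddCommGroup P] [Module A P]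
      [AddCommGroup X] [Module A X] {f : K →ₗ[A] P} {g : P →ₗ[A] X} :
      RelExact Y f g → Module.Projective A P → RelRes A Y K → RelRes A Y X

section RelRes

variable {X X' X'' : Type u} [AddCommGroup X] [Module A X] [AddCommGroup X'] [Module A X']
  [AddCommGroup X''] [Module A X''] {f : X →ₗ[A] X'} {g : X' →ₗ[A] X''}

lemma isRetract_syzygy {K P X K₁ P₁ X₁ : Type*} [AddCommGroup K] [Module A K] [AddCommGroup P]
    [Module A P] [AddCommGroup X] [Module A X] [AddCommGroup K₁] [Module A K₁] [AddCommGroup P₁]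
    [Module A P₁] [AddCommGroup X₁] [Module A X₁] {f : K →ₗ[A] P} {g : P →ₗ[A] X}
    (E : RelExact Y f g) [Module.Projective A P] [Module.Projective A P₁]
    (hX : IsRetract A X₁ X) {f₁ : K₁ →ₗ[A] P₁} {g₁ : P₁ →ₗ[A] X₁}
    (inj : ∀ x, f₁ x = 0 → x = 0) (comp : ∀ x, g₁ (f₁ x) = 0)
    (exact : ∀ x, g₁ x = 0 → ∃ y, f₁ y = x) (surj : Function.Surjective g₁) :
    IsRetract A K₁ (K × P₁) ∧ RelExact Y f₁ g₁ := by
  obtain ⟨i, r, hir⟩ := hX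
  have hir' : ∀ x, r (i x) = x := fun x => LinearMap.congr_fun hir x
  obtain ⟨ψ, hψ⟩ := Module.projective_lifting_property g (i ∘ₗ g₁) E.surj
  obtain ⟨φ, hφ⟩ := Module.projective_lifting_property g₁ (r ∘ₗ g) surj
  have hψ' : ∀ x, g (ψ x) = i (g₁ x) := fun x => LinearMap.congr_fun hψ x
  have hφ' : ∀ x, g₁ (φ x) = r (g x) := fun x => LinearMap.congr_fun hφ x
  have finj : ∀ x y, f x = f y → x = y := fun x y hxy =>
    sub_eq_zero.1 (E.inj _ (by rw [map_sub, hxy, sub_self]))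
  have f₁inj : ∀ x y, f₁ x = f₁ y → x = y := fun x y hxy =>
    sub_eq_zero.1 (inj _ (by rw [map_sub, hxy, sub_self]))
  have hex : ∀ κ, ∃ x, f x = ψ (f₁ κ) := fun κ => E.exact _ (by rw [hψ', comp, map_zero])
  choose θ hθ using hex
  let Θ : K₁ →ₗ[A] K :=
    { toFun := θ
      map_add' := fun x y => finj _ _ (by rw [hθ, map_add, map_add, map_add, hθ, hθ])
      map_smul' := fun s x => finj _ _ (by
        rw [hθ, RingHom.id_apply, map_smul, map_smul, map_smul, hθ]) }
  have hΘ : ∀ κ, f (Θ κ) = ψ (f₁ κ) := hθ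
  have hex' : ∀ z : K × P₁, ∃ x, f₁ x = φ (f z.1) + z.2 - φ (ψ z.2) := fun z => exact _ (by
    rw [map_sub, map_add, hφ', hφ', E.comp, hψ', hir', map_zero, zero_add, sub_self])
  choose τ hτ using hex'
  let R : K × P₁ →ₗ[A] K₁ :=
    { toFun := τ
      map_add' := fun x y => f₁inj _ _ (by
        simp only [hτ, map_add, Prod.fst_add, Prod.snd_add]; abel)
      map_smul' := fun s x => f₁inj _ _ (by
        simp only [hτ, map_smul, Prod.smul_fst, Prod.smul_snd, RingHom.id_apply, smul_sub,
          smul_add]) }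
  have hR : ∀ z, f₁ (R z) = φ (f z.1) + z.2 - φ (ψ z.2) := hτ
  have hRΘ : ∀ x, R (Θ x, f₁ x) = x := fun x => f₁inj _ _ (by rw [hR]; simp [hΘ])
  refine ⟨⟨Θ.prod f₁, R, LinearMap.ext hRΘ⟩, inj, comp, exact, surj, fun l => ?_⟩
  obtain ⟨h, hh⟩ := E.extend (l ∘ₗ R ∘ₗ LinearMap.inl A K P₁)
  refine ⟨l ∘ₗ R ∘ₗ LinearMap.inr A K P₁ + h ∘ₗ ψ, ?_⟩
  ext x
  have h1 := LinearMap.congr_fun hh (Θ x)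
  simp only [LinearMap.comp_apply, LinearMap.inl_apply] at h1
  simp only [LinearMap.comp_apply, LinearMap.add_apply, LinearMap.inr_apply, ← hΘ, h1]
  rw [← map_add, ← map_add, Prod.mk_add_mk, zero_add, add_zero, hRΘ]

lemma RelRes.syzygy (h : RelRes A Y X) {P₀ X₁ P₁ K₁ : Type u} [AddCommGroup P₀] [Module A P₀]
    [AddCommGroup X₁] [Module A X₁] [AddCommGroup P₁] [Module A P₁] [AddCommGroup K₁] [Module A K₁]
    (hP₀ : Module.Projective A P₀) (hP₁ : Module.Projective A P₁)
    (hX : IsRetract A X₁ (X × P₀)) {f₁ : K₁ →ₗ[A] P₁} {g₁ : P₁ →ₗ[A] X₁}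
    (inj : ∀ x, f₁ x = 0 → x = 0) (comp : ∀ x, g₁ (f₁ x) = 0)
    (exact : ∀ x, g₁ x = 0 → ∃ y, f₁ y = x) (surj : Function.Surjective g₁) :
    RelRes A Y K₁ ∧ RelExact Y f₁ g₁ := by
  induction h generalizing P₀ X₁ P₁ K₁ with
  | @of_projective X _ _ hp =>
    have E : RelExact Y (0 : PUnit.{u + 1} →ₗ[A] X × P₀) (LinearMap.id : X × P₀ →ₗ[A] X × P₀) :=
      ⟨fun x _ => Subsingleton.elim _ _, fun x => rfl, fun x hx => ⟨0, hx.symm⟩,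
        Function.surjective_id, fun h => ⟨0, Subsingleton.elim _ _⟩⟩
    obtain ⟨h₁, h₂⟩ := isRetract_syzygy E hX inj comp exact surj
    exact ⟨.of_projective h₁.projective, h₂⟩
  | @step K P X _ _ _ _ _ _ f g E hP hK ih =>
    obtain ⟨h₁, h₂⟩ := isRetract_syzygy (E.prodMap_right (Z := P₀)) hX inj comp exact surj
    refine ⟨?_, h₂⟩
    let π : (K₁ →₀ A) →ₗ[A] K₁ := Finsupp.linearCombination A id
    have hπ : Function.Surjective π := fun x => ⟨Finsupp.single x 1, by simp [π]⟩
    obtain ⟨h₃, h₄⟩ := ih hP₁ inferInstance h₁ (P₁ := K₁ →₀ A) (K₁ := LinearMap.ker π)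
      (f₁ := (LinearMap.ker π).subtype) (g₁ := π)
      (fun x hx => Subtype.ext hx) (fun x => LinearMap.mem_ker.1 x.2)
      (fun x hx => ⟨⟨x, hx⟩, rfl⟩) hπ
    exact .step h₄ inferInstance h₃

lemma RelRes.of_isRetract_prod (h : RelRes A Y X) {P₀ : Type u} [AddCommGroup P₀] [Module A P₀]
    [Module.Projective A P₀] (hX : IsRetract A X' (X × P₀)) : RelRes A Y X' := by
  let π : (X' →₀ A) →ₗ[A] X' := Finsupp.linearCombination A id
  have hπ : Function.Surjective π := fun x => ⟨Finsupp.single x 1, by simp [π]⟩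
  obtain ⟨h₃, h₄⟩ := h.syzygy (P₁ := X' →₀ A) (K₁ := LinearMap.ker π) inferInstance inferInstance hX
    (f₁ := (LinearMap.ker π).subtype) (g₁ := π)
    (fun x hx => Subtype.ext hx) (fun x => LinearMap.mem_ker.1 x.2)
      (fun x hx => ⟨⟨x, hx⟩, rfl⟩) hπ
  exact .step h₄ inferInstance h₃

lemma RelRes.of_isRetract (h : RelRes A Y X) (hX : IsRetract A X' X) : RelRes A Y X' :=
  h.of_isRetract_prod (P₀ := PUnit) (hX.trans .fst)

lemma RelRes.pdimLE (h : RelRes A Y X) : ∃ n, PDimLE A n X := by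
  have key : ∀ n, ∀ {X X' : Type u} [AddCommGroup X] [Module A X] [AddCommGroup X'] [Module A X'],
      (X ≃ₗ[A] X') → PDimLE A n X → PDimLE A n X' := by
    intro n X X' _ _ _ _ e h
    cases n with
    | zero =>
      have : Module.Projective A X := h
      exact Module.Projective.of_equiv e
    | succ n =>
      obtain ⟨P, _, _, f, hP, hf, hk⟩ := h
      refine ⟨P, _, _, e.toLinearMap ∘ₗ f, hP, e.surjective.comp hf, ?_⟩
      rw [LinearEquiv.ker_comp]
      exact hk
  induction h with
  | of_projective h => exact ⟨0, h⟩
  | @step K P X _ _ _ _ _ _ f g E hP hK ih =>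
    obtain ⟨n, hn⟩ := ih
    refine ⟨n + 1, P, _, _, g, hP, E.surj, key n ?_ hn⟩
    refine LinearEquiv.ofBijective (f.codRestrict (LinearMap.ker g) E.comp) ⟨?_, ?_⟩
    · rw [injective_iff_map_eq_zero]
      exact fun x hx => E.inj _ (congrArg Subtype.val hx)
    · rintro ⟨x, hx⟩
      obtain ⟨y, rfl⟩ := E.exact x hx
      exact ⟨y, rfl⟩

lemma RelRes.right_aux (E : RelExact Y f g) (hX : RelRes A Y X) (hX' : RelRes A Y X')
    (hb : ∀ {B D : Type u} [AddCommGroup B] [Module A B] [AddCommGroup D] [Module A D]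
      {α : B →ₗ[A] D} {β : D →ₗ[A] X}, RelExact Y α β → RelRes A Y B → RelRes A Y D) :
    RelRes A Y X'' := by
  cases hX' with
  | of_projective h => exact .step E h hX
  | step E₁ hP hK =>
    obtain ⟨E', α, β, E''⟩ := E.kernel E₁
    exact .step E' hP (hb E'' hK)

lemma RelRes.middle (E : RelExact Y f g) (hX : RelRes A Y X) (hX'' : RelRes A Y X'') :
    RelRes A Y X' := by
  induction hX'' generalizing X X' with
  | of_projective h =>
    obtain ⟨s, hs⟩ := Module.projective_lifting_property g LinearMap.id E.surj
    have hs' : ∀ x, g (s x) = x := fun x => LinearMap.congr_fun hs x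
    refine hX.of_isRetract_prod (.of_equiv (LinearEquiv.ofBijective (f.coprod s) ⟨?_, ?_⟩).symm)
    · rw [← LinearMap.ker_eq_bot, LinearMap.ker_eq_bot']
      rintro ⟨x, z⟩ h0
      replace h0 : f x + s z = 0 := h0
      have hz : z = 0 := by simpa [E.comp, hs'] using congrArg g h0
      subst hz
      have : x = 0 := E.inj _ (by simpa using h0)
      rw [this]; rfl
    · intro b
      obtain ⟨x, hx⟩ := E.exact (b - s (g b)) (by rw [map_sub, hs', sub_self])
      exact ⟨(x, g b), by simp [hx]⟩
  | @step K P X'' _ _ _ _ _ _ f₁ g₁ E₁ hP hK ih =>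
    obtain ⟨h, hh⟩ := Module.projective_lifting_property g g₁ E.surj
    obtain ⟨α, β, E'⟩ := E.pullback E₁ h (fun x => LinearMap.congr_fun hh x)
    exact RelRes.right_aux E' hK
      (hX.of_isRetract_prod (.of_equiv (LinearEquiv.prodComm A _ _))) ih

lemma RelRes.right (E : RelExact Y f g) (hX : RelRes A Y X) (hX' : RelRes A Y X') :
    RelRes A Y X'' :=
  RelRes.right_aux E hX hX' (fun E' hB => RelRes.middle E' hB hX)

lemma RelRes.prod (hX : RelRes A Y X) (hX' : RelRes A Y X') : RelRes A Y (X × X') := by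
  refine RelRes.middle (f := LinearMap.inl A X X') (g := LinearMap.snd A X X')
    ⟨?_, ?_, ?_, ?_, ?_⟩ hX hX'
  · intro x hx
    simpa using hx
  · intro x; rfl
  · rintro ⟨x, z⟩ h
    exact ⟨x, Prod.ext rfl (Eq.symm h)⟩
  · exact Prod.snd_surjective
  · exact fun h => ⟨h ∘ₗ LinearMap.fst A X X', rfl⟩

lemma RelRes.pi (n : ℕ) (F : Fin n → Type u) [∀ i, AddCommGroup (F i)] [∀ i, Module A (F i)]
    (h : ∀ i, RelRes A Y (F i)) : RelRes A Y (∀ i, F i) := by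
  induction n with
  | zero => exact .of_projective inferInstance
  | succ n ih =>
    refine ((h 0).prod (ih (fun i => F i.succ) fun i => h i.succ)).of_isRetract
      (.of_equiv (LinearEquiv.symm ?_))
    exact Fin.consLinearEquiv A F

end RelRes

end RelativeHomologicalAlgebra

/-! ### Bounded exact complexes that stay exact under `Hom(-, Y)` -/

section HomExact

variable {A : Type u} [Ring A]

/-- The complex `⋯ → X 2 → X 1 → X 0 → 0` is bounded, exact, and stays exact under
`Hom(-, Y)`. -/
structure HomExact (Y : Type u) [AddCommGroup Y] [Module A Y] (X : ℕ → Type u)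
    [∀ t, AddCommGroup (X t)] [∀ t, Module A (X t)] (d : ∀ t, X (t + 1) →ₗ[A] X t) : Prop where
  surj : Function.Surjective (d 0)
  comp : ∀ t x, d t (d (t + 1) x) = 0
  exact : ∀ t x, d t x = 0 → ∃ y, d (t + 1) y = x
  hom : ∀ t (g : X (t + 1) →ₗ[A] Y), g ∘ₗ d (t + 1) = 0 → ∃ k : X t →ₗ[A] Y, k ∘ₗ d t = g
  bounded : ∃ N, ∀ t, N ≤ t → Subsingleton (X t)

variable {Y Y' : Type u} [AddCommGroup Y] [Module A Y] [AddCommGroup Y'] [Module A Y']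
  {X : ℕ → Type u} [∀ t, AddCommGroup (X t)] [∀ t, Module A (X t)]
  {d : ∀ t, X (t + 1) →ₗ[A] X t}

lemma HomExact.of_isRetract (H : HomExact Y X d) (hY : IsRetract A Y' Y) : HomExact Y' X d where
  surj := H.surj
  comp := H.comp
  exact := H.exact
  bounded := H.bounded
  hom t g hg := by
    obtain ⟨i, r, hir⟩ := hY
    obtain ⟨k, hk⟩ := H.hom t (i ∘ₗ g) (by rw [LinearMap.comp_assoc, hg, LinearMap.comp_zero])
    exact ⟨r ∘ₗ k, by rw [LinearMap.comp_assoc, hk, ← LinearMap.comp_assoc, hir, LinearMap.id_comp]⟩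

lemma HomExact.extend (H : HomExact Y X d) (t : ℕ) (h : LinearMap.ker (d t) →ₗ[A] Y) :
    ∃ h' : X (t + 1) →ₗ[A] Y, h' ∘ₗ (LinearMap.ker (d t)).subtype = h := by
  let δ : X (t + 2) →ₗ[A] LinearMap.ker (d t) := (d (t + 1)).codRestrict _ (fun x => H.comp t x)
  obtain ⟨k, hk⟩ := H.hom (t + 1) (h ∘ₗ δ) (by
    ext x
    have : δ (d (t + 2) x) = 0 := Subtype.ext (H.comp (t + 1) x)
    simp [this])
  refine ⟨k, ?_⟩
  ext ⟨x, hx⟩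
  obtain ⟨y, rfl⟩ := H.exact t x hx
  exact LinearMap.congr_fun hk y

lemma HomExact.relExact_zero (H : HomExact Y X d) :
    RelExact Y (LinearMap.ker (d 0)).subtype (d 0) :=
  ⟨fun _ hx => Subtype.ext hx, fun x => x.2, fun x hx => ⟨⟨x, hx⟩, rfl⟩, H.surj, H.extend 0⟩

lemma HomExact.relExact_succ (H : HomExact Y X d) (t : ℕ) :
    RelExact Y (LinearMap.ker (d (t + 1))).subtype
      ((d (t + 1)).codRestrict (LinearMap.ker (d t)) (H.comp t)) := by
  refine ⟨fun _ hx => Subtype.ext hx, fun x => Subtype.ext x.2,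
    fun x hx => ⟨⟨x, congrArg Subtype.val hx⟩, rfl⟩, ?_, H.extend _⟩
  rintro ⟨x, hx⟩
  obtain ⟨y, rfl⟩ := H.exact t x hx
  exact ⟨y, rfl⟩

lemma HomExact.relRes (H : HomExact Y X d) (h : ∀ t, RelRes A Y (X (t + 1))) :
    RelRes A Y (X 0) := by
  obtain ⟨N, hN⟩ := H.bounded
  have key : ∀ n t, t + n = N → RelRes A Y (LinearMap.ker (d t)) := by
    intro n
    induction n with
    | zero =>
      intro t ht
      have := hN (t + 1) (by omega)
      exact .of_projective inferInstance
    | succ n ih =>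
      intro t ht
      exact .right (H.relExact_succ t) (ih (t + 1) (by omega)) (h _)
  exact .right H.relExact_zero (key N 0 (by omega)) (h 0)

lemma HomExact.relCores (H : HomExact Y X d) (m : ℕ) (h : ∀ t, t ≠ m → RelCores A Y (X t)) :
    RelCores A Y (X m) := by
  obtain ⟨N, hN⟩ := H.bounded
  have top : ∀ n t, t + n = N + m → m ≤ t + 1 → RelCores A Y (LinearMap.ker (d t)) := by
    intro n
    induction n with
    | zero =>
      intro t ht hm
      have := hN (t + 1) (by omega)
      exact .of_memAdd ((MemAdd.self A Y).of_isRetract .of_subsingleton)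
    | succ n ih =>
      intro t ht hm
      exact .right (H.relExact_succ t) (ih (t + 1) (by omega) (by omega)) (h _ (by omega))
  have bot : ∀ t, t + 1 < m → RelCores A Y (LinearMap.ker (d t)) := by
    intro t
    induction t with
    | zero => exact fun hm => .left H.relExact_zero (h _ (by omega)) (h _ (by omega))
    | succ t ih =>
      exact fun hm => .left (H.relExact_succ t) (h _ (by omega)) (ih (by omega))
  match m, h, top, bot with
  | 0, h, top, _ =>
    exact .right H.relExact_zero (top N 0 (by omega) (by omega)) (h _ (by omega))
  | 1, h, top, _ =>
    exact .middle H.relExact_zero (top (N + 1) 0 (by omega) (by omega)) (h _ (by omega))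
  | m + 2, h, top, bot =>
    exact .middle (H.relExact_succ m) (top (N + 1) (m + 1) (by omega) (by omega))
      (bot m (by omega))

section Kernel

variable {X' : ℕ → Type u} [∀ t, AddCommGroup (X' t)] [∀ t, Module A (X' t)]
  {d' : ∀ t, X' (t + 1) →ₗ[A] X' t} {φ : ∀ t, X t →ₗ[A] X' t}

/-- The differential induced on the kernel of a chain map. -/
def kerDifferential (hφ : ∀ t x, φ t (d t x) = d' t (φ (t + 1) x)) (t : ℕ) :
    LinearMap.ker (φ (t + 1)) →ₗ[A] LinearMap.ker (φ t) :=
  (d t).restrict (fun x hx => by rw [LinearMap.mem_ker] at *; rw [hφ, hx, map_zero])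

/-- The kernel of a degreewise split surjective chain map. -/
lemma HomExact.ker (H : HomExact Y X d) (H' : HomExact Y X' d')
    (hφ : ∀ t x, φ t (d t x) = d' t (φ (t + 1) x))
    (ψ : ∀ t, X' t →ₗ[A] X t) (hψ : ∀ t x, φ t (ψ t x) = x) :
    HomExact Y (fun t => LinearMap.ker (φ t)) (kerDifferential hφ) where
  surj := by
    rintro ⟨x, hx⟩
    rw [LinearMap.mem_ker] at hx
    obtain ⟨y, rfl⟩ := H.surj x
    rw [hφ] at hx
    obtain ⟨z, hz⟩ := H'.exact _ _ hx
    exact ⟨⟨y - d 1 (ψ 2 z), by rw [LinearMap.mem_ker, map_sub, hφ, hψ, hz, sub_self]⟩,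
      Subtype.ext (by simp [kerDifferential, H.comp])⟩
  comp t x := Subtype.ext (H.comp t _)
  exact t := by
    rintro ⟨x, hx⟩ h0
    rw [LinearMap.mem_ker] at hx
    obtain ⟨y, rfl⟩ := H.exact t x (congrArg Subtype.val h0)
    rw [hφ] at hx
    obtain ⟨z, hz⟩ := H'.exact _ _ hx
    exact ⟨⟨y - d _ (ψ _ z), by rw [LinearMap.mem_ker, map_sub, hφ, hψ, hz, sub_self]⟩,
      Subtype.ext (by simp [kerDifferential, H.comp])⟩
  hom t g hg := by
    let π : X (t + 1) →ₗ[A] LinearMap.ker (φ (t + 1)) :=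
      (LinearMap.id - ψ (t + 1) ∘ₗ φ (t + 1)).codRestrict _ (fun x => by simp [hψ])
    have hπ : ∀ x (hx : x ∈ LinearMap.ker (φ (t + 1))), π x = ⟨x, hx⟩ := fun x hx =>
      Subtype.ext (by simp [π, LinearMap.mem_ker.1 hx])
    have hgπ : ∀ x ∈ LinearMap.ker (φ (t + 2)), g (π (d (t + 1) x)) = 0 := by
      intro x hx
      rw [hπ _ (by rw [LinearMap.mem_ker] at *; rw [hφ, hx, map_zero])]
      exact LinearMap.congr_fun hg ⟨x, hx⟩
    let h : X' (t + 2) →ₗ[A] Y := g ∘ₗ π ∘ₗ d (t + 1) ∘ₗ ψ (t + 2)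
    have hh : ∀ x, h (φ _ x) = g (π (d (t + 1) x)) := by
      intro x
      have := hgπ (x - ψ _ (φ _ x)) (by simp [hψ])
      rw [map_sub, map_sub, map_sub, sub_eq_zero] at this
      exact this.symm
    obtain ⟨h', hh'⟩ := H'.hom (t + 1) h (by
      ext x
      have := hh (d _ (ψ _ x))
      rw [hφ, hψ, H.comp, map_zero, map_zero] at this
      exact this)
    have hh'' : ∀ x, h' (d' (t + 1) x) = h x := fun x => LinearMap.congr_fun hh' x
    obtain ⟨k, hk⟩ := H.hom t (g ∘ₗ π - h' ∘ₗ φ (t + 1)) (by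
      ext x
      simp [hφ, hh'', hh])
    refine ⟨k ∘ₗ Submodule.subtype _, ?_⟩
    ext ⟨x, hx⟩
    have := LinearMap.congr_fun hk x
    simp only [LinearMap.comp_apply, LinearMap.sub_apply, hπ x hx, LinearMap.mem_ker.1 hx,
      map_zero, sub_zero] at this
    exact this
  bounded := by
    obtain ⟨N, hN⟩ := H.bounded
    exact ⟨N, fun t ht => have := hN t ht; inferInstance⟩

end Kernel

end HomExact

/-! ### Vanishing of `Ext` -/

section ExtVanishing

open CategoryTheory

variable {k : Type u} [Field k] {A : Type u} [Ring A] [Algebra k A]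
  {Y X : Type u} [AddCommGroup Y] [Module A Y] [AddCommGroup X] [Module A X]

lemma RelRes.extIsZero (h : RelRes A Y X) (i : ℕ) (hi : 1 ≤ i) : ExtIsZero k A X Y i := by
  obtain ⟨n, rfl⟩ : ∃ n, i = n + 1 := ⟨i - 1, by omega⟩
  let P : ProjectiveResolution (ModuleCat.of A X) := Classical.choice
    (HasProjectiveResolution.out)
  let d : ∀ n, P.complex.X (n + 1) →ₗ[A] P.complex.X n := fun n => (P.complex.d (n + 1) n).hom
  have comp : ∀ n x, d n (d (n + 1) x) = 0 := by
    intro n x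
    have := P.complex.d_comp_d (n + 2) (n + 1) n
    exact LinearMap.congr_fun (congrArg ModuleCat.Hom.hom this) x
  have exact : ∀ n x, d n x = 0 → ∃ y, d (n + 1) y = x := by
    intro n x hx
    have := P.exact_succ n
    rw [ShortComplex.moduleCat_exact_iff] at this
    exact this x hx
  have hP : ∀ n, Module.Projective A (P.complex.X n) := fun n =>
    (IsProjective.iff_projective _).2 (P.projective n)
  let π : P.complex.X 0 →ₗ[A] X := (P.π.f 0).hom
  have hπ : Function.Surjective π := (ModuleCat.epi_iff_surjective _).1 inferInstance
  have exact₀ : ∀ x, π x = 0 → ∃ y, d 0 y = x := by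
    have := P.exact₀
    rw [ShortComplex.moduleCat_exact_iff] at this
    exact this
  have comp₀ : ∀ x, π (d 0 x) = 0 := by
    intro x
    have := P.complex_d_comp_π_f_zero
    exact LinearMap.congr_fun (congrArg ModuleCat.Hom.hom this) x
  have key : ∀ n, RelRes A Y (LinearMap.range (d n)) ∧
      ∀ l : LinearMap.range (d n) →ₗ[A] Y, ∃ l' : P.complex.X n →ₗ[A] Y,
        ∀ x, l' (d n x) = l ⟨d n x, x, rfl⟩ := by
    intro n
    induction n with
    | zero =>
      obtain ⟨h₁, h₂⟩ := h.syzygy (P₀ := PUnit) (P₁ := P.complex.X 0)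
        (K₁ := LinearMap.range (d 0)) inferInstance (hP 0) IsRetract.fst
        (f₁ := Submodule.subtype _) (g₁ := π) (fun x hx => Subtype.ext hx)
        (by rintro ⟨_, x, rfl⟩; exact comp₀ x)
        (fun x hx => by obtain ⟨y, rfl⟩ := exact₀ x hx; exact ⟨⟨_, y, rfl⟩, rfl⟩) hπ
      refine ⟨h₁, fun l => ?_⟩
      obtain ⟨l', rfl⟩ := h₂.extend l
      exact ⟨l', fun _ => rfl⟩
    | succ n ih =>
      obtain ⟨h₁, h₂⟩ := ih.1.syzygy (P₀ := PUnit) (P₁ := P.complex.X (n + 1))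
        (K₁ := LinearMap.range (d (n + 1))) inferInstance (hP _) IsRetract.fst
        (f₁ := Submodule.subtype _) (g₁ := (d n).rangeRestrict) (fun x hx => Subtype.ext hx)
        (by rintro ⟨_, x, rfl⟩; exact Subtype.ext (comp n x))
        (fun x hx => by
          obtain ⟨y, rfl⟩ := exact n x (congrArg Subtype.val hx); exact ⟨⟨_, y, rfl⟩, rfl⟩)
        (LinearMap.surjective_rangeRestrict _)
      refine ⟨h₁, fun l => ?_⟩
      obtain ⟨l', rfl⟩ := h₂.extend l
      exact ⟨l', fun _ => rfl⟩
  rw [ExtIsZero, ← ModuleCat.isZero_iff_subsingleton]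
  refine Limits.IsZero.of_iso ?_ (P.isoExt (R := k) (n + 1) (ModuleCat.of A Y))
  rw [← HomologicalComplex.exactAt_iff_isZero_homology,
    HomologicalComplex.exactAt_iff' _ n (n + 1) (n + 2) (by simp) (by simp),
    ShortComplex.moduleCat_exact_iff]
  intro (x : P.complex.X (n + 1) ⟶ ModuleCat.of A Y) hx
  have hx' : P.complex.d (n + 2) (n + 1) ≫ x = 0 := hx
  have hx'' : ∀ y, x.hom (d (n + 1) y) = 0 := fun y =>
    LinearMap.congr_fun (congrArg ModuleCat.Hom.hom hx') y
  obtain ⟨l, hl⟩ := exists_comp_eq_of_ker_le (LinearMap.surjective_rangeRestrict (d n))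
    (l := x.hom) (by
      intro y hy
      obtain ⟨z, rfl⟩ := exact n y (congrArg Subtype.val hy)
      exact hx'' z)
  obtain ⟨l', hl'⟩ := (key n).2 l
  refine ⟨(ModuleCat.ofHom l' : P.complex.X n ⟶ ModuleCat.of A Y), ?_⟩
  show P.complex.d (n + 1) n ≫ ModuleCat.ofHom l' = x
  ext y
  exact (hl' y).trans (LinearMap.congr_fun hl y)

end ExtVanishing

/-! ### Word spaces -/

/-- The functions on the words of length `d` in the alphabet `α`, on which the symmetric group
acts by place permutations. -/
def WordSpace (k : Type u) [Field k] (d : ℕ) (α : Type) : Type u := (Fin d → α) → k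

section WordSpace

variable {k : Type u} [Field k] {d : ℕ} {α β : Type}

instance : AddCommGroup (WordSpace k d α) := inferInstanceAs (AddCommGroup ((Fin d → α) → k))

instance : Module k (WordSpace k d α) := inferInstanceAs (Module k ((Fin d → α) → k))

variable (k d α) in
/-- The action of the symmetric group on a word space by place permutations. -/
def wordPerm : Representation k (Equiv.Perm (Fin d)) (WordSpace k d α) where
  toFun σ :=
    { toFun := fun f v => f (v ∘ σ)
      map_add' := fun _ _ => rfl
      map_smul' := fun _ _ => rfl }
  map_one' := by ext f; rfl
  map_mul' := fun σ τ => by ext f; rfl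

noncomputable instance : Module (SymGroupAlgebra k d) (WordSpace k d α) where
  smul r t := (wordPerm k d α).asAlgebraHom r t
  one_smul t := by show (wordPerm k d α).asAlgebraHom 1 t = t; rw [map_one]; rfl
  mul_smul r s t := by
    show (wordPerm k d α).asAlgebraHom (r * s) t
      = (wordPerm k d α).asAlgebraHom r ((wordPerm k d α).asAlgebraHom s t)
    rw [map_mul]; rfl
  smul_zero r := map_zero ((wordPerm k d α).asAlgebraHom r)
  smul_add r t₁ t₂ := map_add ((wordPerm k d α).asAlgebraHom r) t₁ t₂
  add_smul r s t := by
    show (wordPerm k d α).asAlgebraHom (r + s) t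
      = (wordPerm k d α).asAlgebraHom r t + (wordPerm k d α).asAlgebraHom s t
    rw [map_add]; rfl
  zero_smul t := by show (wordPerm k d α).asAlgebraHom 0 t = 0; rw [map_zero]; rfl

lemma WordSpace.single_smul (σ : Equiv.Perm (Fin d)) (a : k) (c : WordSpace k d α) :
    (MonoidAlgebra.single σ a : SymGroupAlgebra k d) • c = fun u => a * c (u ∘ σ) := by
  show (wordPerm k d α).asAlgebraHom _ c = _
  rw [Representation.asAlgebraHom_single]
  rfl

lemma TensorSpace.single_smul {p : ℕ} (σ : Equiv.Perm (Fin d)) (a : k) (c : TensorSpace k p d) :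
    (MonoidAlgebra.single σ a : SymGroupAlgebra k d) • c = fun u => a * c (u ∘ σ) := by
  rw [tensorSpace_smul_def, Representation.asAlgebraHom_single]
  rfl

/-- Tensor space is a word space. -/
def tensorEquiv (k : Type u) [Field k] (p d : ℕ) :
    TensorSpace k p d ≃ₗ[SymGroupAlgebra k d] WordSpace k d (Fin p) where
  toFun c := c
  invFun c := c
  left_inv _ := rfl
  right_inv _ := rfl
  map_add' _ _ := rfl
  map_smul' _ _ := rfl

@[simp] lemma WordSpace.add_apply (c c' : WordSpace k d α) (u : Fin d → α) :
    (c + c') u = c u + c' u := rfl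

@[simp] lemma WordSpace.sub_apply (c c' : WordSpace k d α) (u : Fin d → α) :
    (c - c') u = c u - c' u := rfl

@[simp] lemma WordSpace.zero_apply (u : Fin d → α) : (0 : WordSpace k d α) u = 0 := rfl

lemma WordSpace.sum_apply {ι : Type*} (s : Finset ι) (c : ι → WordSpace k d α) (u : Fin d → α) :
    (∑ i ∈ s, c i) u = ∑ i ∈ s, c i u := Finset.sum_apply u s c

lemma TensorSpace.sum_apply {p : ℕ} {ι : Type*} (s : Finset ι) (c : ι → TensorSpace k p d)
    (u : Fin d → Fin p) : (∑ i ∈ s, c i) u = ∑ i ∈ s, c i u := Finset.sum_apply u s c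

section Hom

variable {V V' : Type*} [AddCommGroup V] [Module (SymGroupAlgebra k d) V]
  [AddCommGroup V'] [Module (SymGroupAlgebra k d) V']

/-- An additive map commuting with the monomials of the group algebra is linear. -/
noncomputable def homOfSingle (f : V →+ V')
    (h : ∀ (σ : Equiv.Perm (Fin d)) (a : k) (x : V),
      f ((MonoidAlgebra.single σ a : SymGroupAlgebra k d) • x) =
        (MonoidAlgebra.single σ a : SymGroupAlgebra k d) • f x) :
    V →ₗ[SymGroupAlgebra k d] V' where
  toFun := f
  map_add' := f.map_add
  map_smul' r x := by
    rw [RingHom.id_apply]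
    induction r using MonoidAlgebra.induction_linear with
    | zero => rw [zero_smul, zero_smul, map_zero]
    | add r s hr hs => rw [add_smul, add_smul, map_add, hr, hs]
    | single σ a => exact h σ a x

end Hom

/-- The linear map with an invariant kernel `K`. -/
noncomputable def kernelHom [Fintype α] (K : (Fin d → α) → (Fin d → β) → k)
    (hK : ∀ (σ : Equiv.Perm (Fin d)) u v, K (u ∘ σ) (v ∘ σ) = K u v) :
    WordSpace k d α →ₗ[SymGroupAlgebra k d] WordSpace k d β :=
  homOfSingle
    { toFun := fun c v => ∑ u, K u v * c u
      map_zero' := by funext v; simp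
      map_add' := fun c c' => by
        funext v; simp only [WordSpace.add_apply, mul_add, Finset.sum_add_distrib]; rfl }
    (fun σ a c => by
      rw [WordSpace.single_smul, WordSpace.single_smul]
      funext v
      show ∑ u, K u v * (a * c (u ∘ σ)) = a * ∑ u, K u (v ∘ σ) * c u
      rw [Finset.mul_sum, ← (Equiv.arrowCongr σ (Equiv.refl α)).sum_comp]
      refine Finset.sum_congr rfl fun u _ => ?_
      have h1 : (Equiv.arrowCongr σ (Equiv.refl α)) u ∘ σ = u := by
        ext x; simp
      rw [h1, ← hK σ, h1]
      ring)

lemma kernelHom_apply [Fintype α] (K : (Fin d → α) → (Fin d → β) → k) (hK)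
    (c : WordSpace k d α) (v : Fin d → β) : kernelHom K hK c v = ∑ u, K u v * c u := rfl

/-- A submodule of a word space, given by conditions stable under place permutations. -/
def wordSubmodule (P : WordSpace k d α → Prop) (h0 : P 0) (hadd : ∀ c c', P c → P c' → P (c + c'))
    (hsingle : ∀ (σ : Equiv.Perm (Fin d)) (a : k) (c : WordSpace k d α), P c →
      P (fun u => a * c (u ∘ σ))) :
    Submodule (SymGroupAlgebra k d) (WordSpace k d α) where
  carrier := {c | P c}
  zero_mem' := h0
  add_mem' := fun {c c'} h h' => hadd c c' h h'
  smul_mem' r c hc := by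
    show P (r • c)
    induction r using MonoidAlgebra.induction_linear with
    | zero => rwa [zero_smul]
    | add r s hr hs => rw [add_smul]; exact hadd _ _ hr hs
    | single σ a => rw [WordSpace.single_smul]; exact hsingle σ a c hc

end WordSpace

/-! ### From modules over the group algebra to modules over `Λ` -/

section Lambda

variable {k : Type u} [Field k] {p d : ℕ}

variable (k p d) in
/-- The projection of the group algebra onto `Λ`. -/
noncomputable def toLambda : SymGroupAlgebra k d →+* LambdaAlgebra k p d :=
  RingCon.mk' (annihilatorCon k p d)

lemma toLambda_surjective : Function.Surjective (toLambda k p d) := RingCon.mk'_surjective _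

lemma toLambda_smul (r : SymGroupAlgebra k d) (t : TensorSpace k p d) :
    toLambda k p d r • t = r • t := rfl

section

variable (p) (V : Type u) [AddCommGroup V] [Module (SymGroupAlgebra k d) V]

/-- The largest quotient of `V` that embeds into a power of tensor space, as a `Λ`-module. -/
def LQuot : Submodule (LambdaAlgebra k p d)
    ((V →ₗ[SymGroupAlgebra k d] TensorSpace k p d) → TensorSpace k p d) where
  carrier := {F | ∃ x : V, ∀ φ, F φ = φ x}
  zero_mem' := ⟨0, fun φ => (map_zero φ).symm⟩
  add_mem' := by
    rintro F F' ⟨x, hx⟩ ⟨y, hy⟩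
    exact ⟨x + y, fun φ => by rw [map_add, ← hx, ← hy]; rfl⟩
  smul_mem' := by
    rintro r F ⟨x, hx⟩
    obtain ⟨r, rfl⟩ := toLambda_surjective r
    exact ⟨r • x, fun φ => by rw [map_smul, ← hx]; rfl⟩

end

namespace LQuot

variable {V V' V'' : Type u} [AddCommGroup V] [Module (SymGroupAlgebra k d) V]
  [AddCommGroup V'] [Module (SymGroupAlgebra k d) V']
  [AddCommGroup V''] [Module (SymGroupAlgebra k d) V'']

variable (p) in
/-- The class of an element of `V`. -/
noncomputable def mk (x : V) : LQuot (k := k) (d := d) p V := ⟨fun φ => φ x, x, fun _ => rfl⟩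

lemma mk_surjective : Function.Surjective (mk (k := k) (d := d) p (V := V)) := by
  rintro ⟨F, x, hx⟩
  exact ⟨x, Subtype.ext (funext fun φ => (hx φ).symm)⟩

lemma mk_eq_iff {x y : V} : mk (k := k) (d := d) p x = mk p y ↔
    ∀ φ : V →ₗ[SymGroupAlgebra k d] TensorSpace k p d, φ x = φ y :=
  ⟨fun h φ => congrFun (congrArg Subtype.val h) φ, fun h => Subtype.ext (funext h)⟩

lemma mk_add (x y : V) : mk (k := k) (d := d) p (x + y) = mk p x + mk p y :=
  Subtype.ext (funext fun φ => map_add φ x y)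

lemma mk_zero : mk (k := k) (d := d) p (0 : V) = 0 :=
  Subtype.ext (funext fun φ => map_zero φ)

lemma mk_smul (r : SymGroupAlgebra k d) (x : V) : 
    mk (k := k) (d := d) p (r • x) = toLambda k p d r • mk p x :=
  Subtype.ext (funext fun φ => map_smul φ r x)

/-- Functoriality. -/
noncomputable def map (f : V →ₗ[SymGroupAlgebra k d] V') :
    LQuot (k := k) (d := d) p V →ₗ[LambdaAlgebra k p d]
    LQuot (k := k) (d := d) p V' where
  toFun F := ⟨fun φ => F.1 (φ ∘ₗ f), by
    obtain ⟨x, hx⟩ := F.2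
    exact ⟨f x, fun φ => hx _⟩⟩
  map_add' _ _ := rfl
  map_smul' _ _ := rfl

lemma map_mk (f : V →ₗ[SymGroupAlgebra k d] V') (x : V) :
    map (p := p) f (mk p x) = mk p (f x) := rfl

/-- Evaluation at a homomorphism to tensor space. -/
noncomputable def eval (φ : V →ₗ[SymGroupAlgebra k d] TensorSpace k p d) :
    LQuot (k := k) (d := d) p V →ₗ[LambdaAlgebra k p d] TensorSpace k p d where
  toFun F := F.1 φ
  map_add' _ _ := rfl
  map_smul' _ _ := rfl

/-- The homomorphism corresponding to a homomorphism on the quotient. -/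
noncomputable def coeval
    (g : LQuot (k := k) (d := d) p V →ₗ[LambdaAlgebra k p d] TensorSpace k p d) :
    V →ₗ[SymGroupAlgebra k d] TensorSpace k p d where
  toFun x := g (mk p x)
  map_add' x y := by rw [mk_add, map_add]
  map_smul' r x := by rw [mk_smul, map_smul]; rfl

/-- A homomorphism out of tensor space. -/
noncomputable def ofTensor (f : TensorSpace k p d →ₗ[SymGroupAlgebra k d] V) :
    TensorSpace k p d →ₗ[LambdaAlgebra k p d] LQuot (k := k) (d := d) p V where
  toFun t := mk p (f t)
  map_add' x y := by rw [map_add, mk_add]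
  map_smul' r x := by
    obtain ⟨r, rfl⟩ := toLambda_surjective r
    rw [toLambda_smul, map_smul, mk_smul]; rfl

lemma isRetract_of_comp (f : V →ₗ[SymGroupAlgebra k d] V') (g : V' →ₗ[SymGroupAlgebra k d] V)
    (h : ∀ (φ : V →ₗ[SymGroupAlgebra k d] TensorSpace k p d) x, φ (g (f x)) = φ x) :
    IsRetract (LambdaAlgebra k p d) (LQuot (k := k) (d := d) p V)
      (LQuot (k := k) (d := d) p V') := by
  refine ⟨map f, map g, ?_⟩
  ext1 F
  obtain ⟨x, rfl⟩ := mk_surjective F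
  exact mk_eq_iff.2 fun φ => h φ x

lemma isRetract (h : IsRetract (SymGroupAlgebra k d) V V') :
    IsRetract (LambdaAlgebra k p d) (LQuot (k := k) (d := d) p V)
      (LQuot (k := k) (d := d) p V') := by
  obtain ⟨f, g, h⟩ := h
  exact isRetract_of_comp f g fun φ x => congrArg φ (LinearMap.congr_fun h x)

/-- An isomorphism induces an isomorphism. -/
noncomputable def congr (e : V ≃ₗ[SymGroupAlgebra k d] V') :
    LQuot (k := k) (d := d) p V ≃ₗ[LambdaAlgebra k p d] LQuot (k := k) (d := d) p V' :=
  LinearEquiv.ofLinearMap (map e.toLinearMap) (map e.symm.toLinearMap)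
    (by
      ext1 F
      obtain ⟨x, rfl⟩ := mk_surjective F
      simp [map_mk])
    (by
      ext1 F
      obtain ⟨x, rfl⟩ := mk_surjective F
      simp [map_mk])

lemma subsingleton (h : ∀ (φ : V →ₗ[SymGroupAlgebra k d] TensorSpace k p d) x, φ x = 0) :
    Subsingleton (LQuot (k := k) (d := d) p V) := by
  refine ⟨fun F F' => ?_⟩
  obtain ⟨x, rfl⟩ := mk_surjective F
  obtain ⟨y, rfl⟩ := mk_surjective F'
  exact mk_eq_iff.2 fun φ => by rw [h, h]

/-- The quotient of the group algebra itself is `Λ`. -/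
noncomputable def selfEquiv : LambdaAlgebra k p d ≃ₗ[LambdaAlgebra k p d]
    LQuot (k := k) (d := d) p (SymGroupAlgebra k d) := by
  refine LinearEquiv.ofBijective
    (LinearMap.toSpanSingleton _ _ (mk p (1 : SymGroupAlgebra k d))) ⟨?_, ?_⟩
  · rw [injective_iff_map_eq_zero]
    intro r hr
    obtain ⟨r, rfl⟩ := toLambda_surjective r
    rw [LinearMap.toSpanSingleton_apply, ← mk_smul, ← mk_zero, mk_eq_iff] at hr
    rw [← map_zero (toLambda k p d)]
    refine Quotient.sound (fun t => ?_)
    have := hr (LinearMap.toSpanSingleton _ _ t)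
    simpa using this
  · intro F
    obtain ⟨x, rfl⟩ := mk_surjective F
    exact ⟨toLambda k p d x, by
      rw [LinearMap.toSpanSingleton_apply, ← mk_smul, smul_eq_mul, mul_one]⟩

end LQuot

end Lambda

/-! ### Contents -/

section Content

variable {d : ℕ} {α β : Type} [DecidableEq α] [DecidableEq β]

/-- The number of occurrences of the letter `a` in the word `u`. -/
def wcount (u : Fin d → α) (a : α) : ℕ := (Finset.univ.filter fun x => u x = a).card

/-- The word `u` contains each letter `a` exactly `κ a` times. -/
def HasContent (κ : α → ℕ) (u : Fin d → α) : Prop := ∀ a, wcount u a = κ a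

instance [Fintype α] (κ : α → ℕ) (u : Fin d → α) : Decidable (HasContent κ u) :=
  inferInstanceAs (Decidable (∀ a, wcount u a = κ a))

lemma wcount_comp_perm (u : Fin d → α) (σ : Equiv.Perm (Fin d)) (a : α) :
    wcount (u ∘ σ) a = wcount u a := by
  unfold wcount
  refine Finset.card_bij (fun x _ => σ x) (by simp) (fun _ _ _ _ h => σ.injective h) ?_
  intro y hy
  exact ⟨σ.symm y, by simpa using hy, by simp⟩

lemma hasContent_comp_perm {κ : α → ℕ} {u : Fin d → α} (σ : Equiv.Perm (Fin d)) :
    HasContent κ (u ∘ σ) ↔ HasContent κ u := by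
  simp only [HasContent, wcount_comp_perm]

lemma wcount_comp_left [Fintype α] (g : α → β) (u : Fin d → α) (b : β) :
    wcount (g ∘ u) b = ∑ a with g a = b, wcount u a := by
  unfold wcount
  rw [Finset.card_eq_sum_card_fiberwise (f := u) (t := Finset.univ.filter fun a => g a = b)]
  · refine Finset.sum_congr rfl fun a ha => ?_
    congr 1
    ext x
    simp only [Finset.mem_filter, Finset.mem_univ, true_and, Function.comp] at ha ⊢
    constructor
    · exact fun h => h.2
    · rintro rfl; exact ⟨ha, rfl⟩
  · intro x hx
    simpa using hx

lemma sum_wcount [Fintype α] (u : Fin d → α) : ∑ a, wcount u a = d := by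
  unfold wcount
  rw [← Finset.card_eq_sum_card_fiberwise (fun _ _ => Finset.mem_coe.2 (Finset.mem_univ _))]
  simp

lemma wcount_injective_comp {g : α → β} (hg : Function.Injective g) (u : Fin d → α) (a : α) :
    wcount (g ∘ u) (g a) = wcount u a := by
  simp [wcount, hg.eq_iff]

lemma exists_perm_of_wcount_eq {u v : Fin d → α} (h : ∀ a, wcount u a = wcount v a) :
    ∃ σ : Equiv.Perm (Fin d), u ∘ σ = v := by
  have h1 : ∀ a, Nonempty ({x // v x = a} ≃ {x // u x = a}) := fun a => by
    refine ⟨Fintype.equivOfCardEq ?_⟩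
    rw [Fintype.card_subtype, Fintype.card_subtype]
    exact (h a).symm
  let e := fun a => (h1 a).some
  refine ⟨(Equiv.sigmaFiberEquiv v).symm.trans ((Equiv.sigmaCongrRight e).trans
    (Equiv.sigmaFiberEquiv u)), ?_⟩
  ext x
  exact ((e (v x)) ⟨x, rfl⟩).2

end Content

section Sign

/-- The sign character with values in `k`. -/
noncomputable def sgn (k : Type u) [Field k] {ι : Type} [Fintype ι] [DecidableEq ι] :
    Equiv.Perm ι →* k :=
  ((Int.castRingHom k : ℤ →* k).comp (Units.coeHom ℤ)).comp Equiv.Perm.sign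

variable {k : Type u} [Field k] {ι : Type} [Fintype ι] [DecidableEq ι]

lemma sgn_apply (π : Equiv.Perm ι) : sgn k π = ((Equiv.Perm.sign π : ℤ) : k) := rfl

lemma sgn_mul_self (π : Equiv.Perm ι) : sgn k π * sgn k π = 1 := by
  rw [← map_mul, sgn_apply]; simp

lemma sgn_swap {x y : ι} (h : x ≠ y) : sgn k (Equiv.swap x y) = -1 := by
  simp [sgn_apply, Equiv.Perm.sign_swap h]

lemma sgn_inv (π : Equiv.Perm ι) : sgn k π⁻¹ = sgn k π := by
  simp [sgn_apply]

end Sign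

/-! ### Alternating functions on words with labels -/

section Alt

open Sum

variable {k : Type u} [Field k] {d : ℕ} {L : Type} [DecidableEq L] {m : ℕ}

/-- The content with multiplicities `ν` and each of the `m` labels occurring once. -/
def labelled (ν : L → ℕ) (m : ℕ) : L ⊕ Fin m → ℕ := Sum.elim ν fun _ => 1

/-- Relabelling. -/
def relabel (π : Equiv.Perm (Fin m)) (u : Fin d → L ⊕ Fin m) : Fin d → L ⊕ Fin m :=
  fun x => Sum.map id π (u x)

lemma relabel_mul (π ρ : Equiv.Perm (Fin m)) (u : Fin d → L ⊕ Fin m) :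
    relabel (π * ρ) u = relabel π (relabel ρ u) := by
  funext x; rcases h : u x <;> simp [relabel, h]

lemma relabel_one (u : Fin d → L ⊕ Fin m) : relabel 1 u = u := by
  funext x; rcases h : u x <;> simp [relabel, h]

lemma relabel_inv_relabel (π : Equiv.Perm (Fin m)) (u : Fin d → L ⊕ Fin m) :
    relabel π⁻¹ (relabel π u) = u := by
  rw [← relabel_mul, inv_mul_cancel, relabel_one]

lemma relabel_relabel_inv (π : Equiv.Perm (Fin m)) (u : Fin d → L ⊕ Fin m) :
    relabel π (relabel π⁻¹ u) = u := by
  rw [← relabel_mul, mul_inv_cancel, relabel_one]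

lemma relabel_comp (π : Equiv.Perm (Fin m)) (u : Fin d → L ⊕ Fin m) (σ : Equiv.Perm (Fin d)) :
    relabel π (u ∘ σ) = relabel π u ∘ σ := rfl

lemma relabel_eq_inl {π : Equiv.Perm (Fin m)} {u : Fin d → L ⊕ Fin m} {x : Fin d} {l : L} :
    relabel π u x = inl l ↔ u x = inl l := by
  rcases h : u x <;> simp [relabel, h]

lemma relabel_eq_inr {π : Equiv.Perm (Fin m)} {u : Fin d → L ⊕ Fin m} {x : Fin d} {s : Fin m} :
    relabel π u x = inr s ↔ u x = inr (π⁻¹ s) := by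
  rcases h : u x <;> simp [relabel, h, Equiv.eq_symm_apply]

lemma hasContent_relabel {ν : L → ℕ} {π : Equiv.Perm (Fin m)} {u : Fin d → L ⊕ Fin m} :
    HasContent (labelled ν m) (relabel π u) ↔ HasContent (labelled ν m) u := by
  have h1 : ∀ (π : Equiv.Perm (Fin m)) (u : Fin d → L ⊕ Fin m),
      HasContent (labelled ν m) u → HasContent (labelled ν m) (relabel π u) := by
    intro π u h a
    rcases a with l | s
    · rw [← h (inl l)]; simp only [wcount, relabel_eq_inl]
    · rw [show labelled ν m (inr s) = 1 from rfl, ← show labelled ν m (inr (π⁻¹ s)) = 1 from rfl,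
        ← h (inr (π⁻¹ s))]
      simp only [wcount, relabel_eq_inr]
  exact ⟨fun h => by simpa [relabel_inv_relabel] using h1 π⁻¹ _ h, h1 π u⟩

variable (k d) in
/-- The functions supported on the words of content `κ`. -/
def contentSpace {α : Type} [DecidableEq α] (κ : α → ℕ) :
    Submodule (SymGroupAlgebra k d) (WordSpace k d α) :=
  wordSubmodule (fun c => ∀ u, c u ≠ 0 → HasContent κ u)
    (fun _ h => absurd rfl h)
    (fun c c' hc hc' u hu => by
      by_contra hcon
      refine hu ?_
      rw [WordSpace.add_apply, not_not.1 (mt (hc u) hcon), not_not.1 (mt (hc' u) hcon), add_zero])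
    (fun σ a c hc u hu => (hasContent_comp_perm σ).1 (hc _ (right_ne_zero_of_mul hu)))

variable (k d) in
/-- The functions supported on the words of content `ν` in the letters, containing each label once,
that are alternating in the labels. -/
def Alt (ν : L → ℕ) (m : ℕ) : Submodule (SymGroupAlgebra k d) (WordSpace k d (L ⊕ Fin m)) :=
  wordSubmodule (fun c => (∀ u, c u ≠ 0 → HasContent (labelled ν m) u) ∧
      ∀ π u, c (relabel π u) = sgn k π * c u)
    ⟨fun _ h => absurd rfl h, fun _ _ => by simp⟩
    (fun c c' hc hc' => ⟨(contentSpace k d (labelled ν m)).add_mem hc.1 hc'.1, fun π u => by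
      rw [WordSpace.add_apply, WordSpace.add_apply, hc.2, hc'.2, mul_add]⟩)
    (fun σ a c hc => ⟨fun u hu => (hasContent_comp_perm σ).1 (hc.1 _ (right_ne_zero_of_mul hu)),
      fun π u => by
        show a * c (relabel π u ∘ σ) = _ * (a * c (u ∘ σ))
        rw [← relabel_comp, hc.2]; ring⟩)

lemma mem_contentSpace {α : Type} [DecidableEq α] {κ : α → ℕ} {c : WordSpace k d α} :
    c ∈ contentSpace k d κ ↔ ∀ u, c u ≠ 0 → HasContent κ u := Iff.rfl

lemma mem_alt {ν : L → ℕ} {c : WordSpace k d (L ⊕ Fin m)} : c ∈ Alt k d ν m ↔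
    (∀ u, c u ≠ 0 → HasContent (labelled ν m) u) ∧ ∀ π u, c (relabel π u) = sgn k π * c u := Iff.rfl

/-- The content of the words in the `t`-th term of the complex of `μ` at the letter `i`. -/
structure IsStage (μ : L → ℕ) (i : L) (t : ℕ) (u : Fin d → L ⊕ Fin t) : Prop where
  other : ∀ l, l ≠ i → wcount u (inl l) = μ l
  same : wcount u (inl i) + t = μ i
  label : ∀ s, wcount u (inr s) = 1

lemma hasContent_iff_isStage [Fintype L] {μ : L → ℕ} (hμ : ∑ l, μ l = d) {i : L} {t : ℕ}
    {u : Fin d → L ⊕ Fin t} :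
    HasContent (labelled (μ - Pi.single i t) t) u ↔ IsStage μ i t u := by
  constructor
  · intro h
    have h1 : ∀ l, wcount u (inl l) = μ l - (Pi.single i t : L → ℕ) l := fun l => h (inl l)
    have h2 : ∀ s, wcount u (inr s) = 1 := fun s => h (inr s)
    have h3 := sum_wcount u
    rw [Fintype.sum_sum_type, Fintype.sum_congr _ _ h2, ← Finset.add_sum_erase _ _
      (Finset.mem_univ i)] at h3
    have hμ' : μ i + ∑ l ∈ Finset.univ.erase i, μ l = d :=
      (Finset.add_sum_erase _ _ (Finset.mem_univ i)).trans hμ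
    have h4 : ∀ l, l ≠ i → wcount u (inl l) = μ l := fun l hl => by
      rw [h1, Pi.single_eq_of_ne hl, Nat.sub_zero]
    have h6 : ∑ l ∈ Finset.univ.erase i, wcount u (inl l) = ∑ l ∈ Finset.univ.erase i, μ l :=
      Finset.sum_congr rfl fun l hl => h4 l (Finset.ne_of_mem_erase hl)
    rw [h6] at h3
    have h5 := h1 i
    rw [Pi.single_eq_same] at h5
    simp only [Finset.sum_const, Finset.card_univ, Fintype.card_fin, smul_eq_mul, mul_one] at h3
    exact ⟨h4, by omega, h2⟩
  · rintro ⟨h1, h2, h3⟩ (l | s)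
    · rcases eq_or_ne l i with rfl | hl
      · simp only [labelled, elim_inl, Pi.sub_apply, Pi.single_eq_same]; omega
      · simp [labelled, h1 l hl, hl]
    · exact h3 s

lemma mem_alt_stage [Fintype L] {μ : L → ℕ} (hμ : ∑ l, μ l = d) {i : L} {t : ℕ}
    {c : WordSpace k d (L ⊕ Fin t)} : c ∈ Alt k d (μ - Pi.single i t) t ↔
    (∀ u, c u ≠ 0 → IsStage μ i t u) ∧ ∀ π u, c (relabel π u) = sgn k π * c u := by
  rw [mem_alt]; simp only [hasContent_iff_isStage hμ]

lemma IsStage.exists_pos {μ : L → ℕ} {i : L} {t : ℕ} {u : Fin d → L ⊕ Fin t}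
    (h : IsStage μ i t u) : ∃ q : Fin t → Fin d, ∀ x s, u x = inr s ↔ x = q s := by
  have h1 : ∀ s, ∃ y, ∀ x, u x = inr s ↔ x = y := fun s => by
    obtain ⟨y, hy⟩ := Finset.card_eq_one.1 (h.label s)
    exact ⟨y, fun x => by simpa using Finset.ext_iff.1 hy x⟩
  choose q hq using h1
  exact ⟨q, fun x s => hq s x⟩

/-- Insert the first label at the position `x`. -/
def ins (x : Fin d) (u : Fin d → L ⊕ Fin m) : Fin d → L ⊕ Fin (m + 1) :=
  fun y => if y = x then inr 0 else Sum.map id Fin.succ (u y)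

/-- Replace the label `s` by the letter `i`. -/
def low (i : L) (s : Fin (m + 1)) (u : Fin d → L ⊕ Fin (m + 1)) : Fin d → L ⊕ Fin m :=
  fun x => Sum.elim inl (fun r => Fin.cases (inl i) inr (Equiv.swap 0 s r)) (u x)

/-- The positions of the letter `i` and of the labels. -/
def block (i : L) (u : Fin d → L ⊕ Fin m) : Finset (Fin d) :=
  Finset.univ.filter fun x => Sum.elim id (fun _ => i) (u x) = i

lemma mem_block' {i : L} {u : Fin d → L ⊕ Fin m} {x : Fin d} :
    x ∈ block i u ↔ Sum.elim id (fun _ => i) (u x) = i := by simp [block]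

lemma mem_block {i : L} {u : Fin d → L ⊕ Fin m} {x : Fin d} :
    x ∈ block i u ↔ u x = inl i ∨ ∃ s, u x = inr s := by
  rcases h : u x <;> simp [block, h]

lemma card_block [Fintype L] {μ : L → ℕ} {i : L} {t : ℕ} {u : Fin d → L ⊕ Fin t}
    (h : IsStage μ i t u) : (block i u).card = μ i := by
  have h1 := wcount_comp_left (Sum.elim id (fun _ => i)) u i
  rw [show wcount (Sum.elim id (fun _ => i) ∘ u) i = (block i u).card from rfl] at h1
  rw [h1, Finset.sum_filter, Fintype.sum_sum_type, ← h.same]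
  simp only [elim_inl, id, elim_inr, if_true, h.label, Finset.sum_const, Finset.card_univ,
    Fintype.card_fin, smul_eq_mul, mul_one]
  rw [Finset.sum_eq_single i (fun b _ hb => by simp [hb]) (by simp)]
  exact congrArg (· + t) (if_pos rfl)

lemma block_relabel (i : L) (π : Equiv.Perm (Fin m)) (u : Fin d → L ⊕ Fin m) :
    block i (relabel π u) = block i u := by
  ext x; rcases h : u x <;> simp [mem_block', h, relabel]

lemma block_ins {i : L} {u : Fin d → L ⊕ Fin m} {x : Fin d} (hx : u x = inl i) :
    block i (ins x u) = block i u := by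
  ext y
  by_cases hy : y = x
  · subst hy; simp [mem_block', ins, hx]
  · rcases h : u y <;> simp [mem_block', h, ins, hy]

lemma ins_comp_perm (x : Fin d) (u : Fin d → L ⊕ Fin m) (σ : Equiv.Perm (Fin d)) :
    ins (σ x) u ∘ σ = ins x (u ∘ σ) := by
  funext y; simp [ins]

lemma low_comp_perm (i : L) (s : Fin (m + 1)) (u : Fin d → L ⊕ Fin (m + 1))
    (σ : Equiv.Perm (Fin d)) : low i s (u ∘ σ) = low i s u ∘ σ := rfl

lemma low_zero_ins {i : L} {u : Fin d → L ⊕ Fin m} {x : Fin d} (hx : u x = inl i) :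
    low i 0 (ins x u) = u := by
  funext y
  by_cases hy : y = x
  · subst hy; simp [low, ins, hx]
  · rcases h : u y <;> simp [low, ins, hy, h]

lemma ins_eq_inl {u : Fin d → L ⊕ Fin m} {x y : Fin d} {l : L} :
    ins x u y = inl l ↔ y ≠ x ∧ u y = inl l := by
  by_cases hy : y = x
  · simp [ins, hy]
  · rcases h : u y <;> simp [ins, hy, h]

lemma ins_eq_zero {u : Fin d → L ⊕ Fin m} {x y : Fin d} :
    ins x u y = inr 0 ↔ y = x := by
  by_cases hy : y = x
  · simp [ins, hy]
  · rcases h : u y <;> simp [ins, hy, h, Fin.succ_ne_zero]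

lemma ins_eq_succ {u : Fin d → L ⊕ Fin m} {x y : Fin d} {s : Fin m} :
    ins x u y = inr s.succ ↔ y ≠ x ∧ u y = inr s := by
  by_cases hy : y = x
  · simp [ins, hy, (Fin.succ_ne_zero s).symm]
  · rcases h : u y <;> simp [ins, hy, h]

lemma isStage_ins {μ : L → ℕ} {i : L} {t : ℕ} {u : Fin d → L ⊕ Fin t} {x : Fin d}
    (hx : u x = inl i) : IsStage μ i (t + 1) (ins x u) ↔ IsStage μ i t u := by
  have h1 : ∀ l, l ≠ i → wcount (ins x u) (inl l) = wcount u (inl l) := fun l hl => by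
    unfold wcount
    congr 1; ext y
    simp only [Finset.mem_filter, Finset.mem_univ, true_and, ins_eq_inl, and_iff_right_iff_imp]
    rintro h rfl
    rw [h] at hx; exact hl (Sum.inl_injective hx)
  have h2 : wcount (ins x u) (inl i) + 1 = wcount u (inl i) := by
    unfold wcount
    rw [← Finset.card_erase_add_one (a := x) (s := Finset.univ.filter fun y => u y = inl i)
      (by simpa using hx)]
    congr 2; ext y
    simp [ins_eq_inl]
  have h3 : wcount (ins x u) (inr 0) = 1 := by
    simp only [wcount, ins_eq_zero, Finset.filter_eq', Finset.mem_univ, if_true,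
      Finset.card_singleton]
  have h4 : ∀ s : Fin t, wcount (ins x u) (inr s.succ) = wcount u (inr s) := fun s => by
    unfold wcount
    congr 1; ext y
    simp only [Finset.mem_filter, Finset.mem_univ, true_and, ins_eq_succ, and_iff_right_iff_imp]
    rintro h rfl
    rw [h] at hx; cases hx
  constructor
  · rintro ⟨a, b, c⟩
    exact ⟨fun l hl => by rw [← h1 l hl, a l hl], by omega, fun s => by rw [← h4, c]⟩
  · rintro ⟨a, b, c⟩
    exact ⟨fun l hl => by rw [h1 l hl, a l hl], by omega,
      Fin.cases h3 fun s => by rw [h4, c]⟩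

lemma low_eq_inl_of_ne {i l : L} (hl : l ≠ i) {s : Fin (m + 1)} {u : Fin d → L ⊕ Fin (m + 1)}
    {x : Fin d} : low i s u x = inl l ↔ u x = inl l := by
  rcases h : u x with a | r
  · simp [low, h]
  · simp only [low, h, elim_inr, reduceCtorEq, iff_false]
    induction Equiv.swap 0 s r using Fin.cases <;> simp [hl.symm]

lemma low_eq_inl {i : L} {s : Fin (m + 1)} {u : Fin d → L ⊕ Fin (m + 1)} {x : Fin d} :
    low i s u x = inl i ↔ u x = inl i ∨ u x = inr s := by
  rcases h : u x with a | r
  · simp [low, h]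
  · have h1 : r = s ↔ Equiv.swap 0 s r = 0 := by
      rw [Equiv.swap_apply_eq_iff, Equiv.swap_apply_left]
    simp only [low, h, elim_inr, reduceCtorEq, false_or, Sum.inr.injEq, h1]
    induction Equiv.swap 0 s r using Fin.cases <;> simp [Fin.succ_ne_zero]

lemma low_eq_inr {i : L} {s : Fin (m + 1)} {u : Fin d → L ⊕ Fin (m + 1)} {x : Fin d} {r : Fin m} :
    low i s u x = inr r ↔ u x = inr (Equiv.swap 0 s r.succ) := by
  rcases h : u x with a | q
  · simp [low, h]
  · have h1 : q = Equiv.swap 0 s r.succ ↔ Equiv.swap 0 s q = r.succ := by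
      rw [Equiv.swap_apply_eq_iff]
    simp only [low, h, elim_inr, Sum.inr.injEq, h1]
    induction Equiv.swap 0 s q using Fin.cases <;> simp [(Fin.succ_ne_zero _).symm]

lemma isStage_low {μ : L → ℕ} {i : L} {t : ℕ} {u : Fin d → L ⊕ Fin (t + 1)} (s : Fin (t + 1))
    (h : IsStage μ i (t + 1) u) : IsStage μ i t (low i s u) := by
  refine ⟨fun l hl => ?_, ?_, fun r => ?_⟩
  · rw [← h.other l hl]; simp only [wcount, low_eq_inl_of_ne hl]
  · suffices h1 : wcount (low i s u) (inl i) = wcount u (inl i) + wcount u (inr s) by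
      have h2 := h.same
      rw [h.label s] at h1; omega
    unfold wcount
    rw [← Finset.card_union_of_disjoint]
    · congr 1; ext x; simp [low_eq_inl]
    · rw [Finset.disjoint_filter]
      intro x _ h1 h2; rw [h1] at h2; cases h2
  · rw [← h.label (Equiv.swap 0 s r.succ)]; simp only [wcount, low_eq_inr]

lemma ins_low_self {i : L} {s : Fin (m + 1)} {u : Fin d → L ⊕ Fin (m + 1)} {x : Fin d}
    (hx : ∀ y, u y = inr s ↔ y = x) : ins x (low i s u) = relabel (Equiv.swap 0 s) u := by
  funext y
  by_cases hy : y = x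
  · rw [relabel, (hx y).2 hy]; simp [ins, hy]
  · have h1 : u y ≠ inr s := fun h => hy ((hx y).1 h)
    rcases h : u y with a | q
    · simp [ins, hy, low, relabel, h]
    · have h2 : Equiv.swap 0 s q ≠ 0 := by
        rw [Ne, Equiv.swap_apply_eq_iff, Equiv.swap_apply_left]
        rintro rfl; exact h1 h
      obtain ⟨r, hr⟩ := Fin.exists_succ_eq.2 h2
      simp [ins, hy, low, relabel, h, ← hr]

lemma ins_low {i : L} {s : Fin (m + 1)} {u : Fin d → L ⊕ Fin (m + 1)} {x : Fin d}
    (hx : u x = inl i) :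
    ins x (low i s u) = relabel (Equiv.swap 0 s) (low i s.succ (ins x u)) := by
  funext y
  by_cases hy : y = x
  · subst hy
    simp [ins, low, relabel, Equiv.swap_apply_left]
  · rcases h : u y with a | q
    · simp [ins, hy, low, relabel, h]
    · rcases eq_or_ne q s with rfl | hq
      · simp [ins, hy, low, relabel, h, Equiv.swap_apply_right]
      · have h2 : Equiv.swap 0 s q ≠ 0 := by
          rw [Ne, Equiv.swap_apply_eq_iff, Equiv.swap_apply_left]; exact hq
        obtain ⟨r, hr⟩ := Fin.exists_succ_eq.2 h2
        simp [ins, hy, low, relabel, h, ← hr,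
          Equiv.swap_apply_of_ne_of_ne (Fin.succ_ne_zero q) (fun e => hq (Fin.succ_injective _ e))]

end Alt

/-! ### Merging a label with a letter -/

section Merge

open Sum

variable {k : Type u} [Field k] {d : ℕ} {L : Type} [DecidableEq L] {m : ℕ}

/-- The extension of a permutation of the labels to a permutation fixing a new first label. -/
def liftPerm (π : Equiv.Perm (Fin m)) : Equiv.Perm (Fin (m + 1)) :=
  Equiv.Perm.decomposeFin.symm (0, π)

lemma liftPerm_zero (π : Equiv.Perm (Fin m)) : liftPerm π 0 = 0 :=
  Equiv.Perm.decomposeFin_symm_apply_zero _ _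

lemma liftPerm_succ (π : Equiv.Perm (Fin m)) (s : Fin m) : liftPerm π s.succ = (π s).succ := by
  rw [liftPerm, Equiv.Perm.decomposeFin_symm_apply_succ, Equiv.swap_self]; rfl

lemma sgn_liftPerm (π : Equiv.Perm (Fin m)) : sgn k (liftPerm π) = sgn k π := by
  rw [sgn_apply, liftPerm, Equiv.Perm.decomposeFin.symm_sign, if_pos rfl, one_mul, sgn_apply]

lemma exists_liftPerm {ρ : Equiv.Perm (Fin (m + 1))} (h : ρ 0 = 0) : ∃ π, ρ = liftPerm π := by
  obtain ⟨⟨q, π⟩, rfl⟩ := Equiv.Perm.decomposeFin.symm.surjective ρ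
  rw [Equiv.Perm.decomposeFin_symm_apply_zero] at h
  exact ⟨π, by rw [h]; rfl⟩

lemma ins_relabel (x : Fin d) (π : Equiv.Perm (Fin m)) (u : Fin d → L ⊕ Fin m) :
    ins x (relabel π u) = relabel (liftPerm π) (ins x u) := by
  funext y
  by_cases hy : y = x
  · simp [ins, hy, relabel, liftPerm_zero]
  · rcases h : u y <;> simp [ins, hy, relabel, h, liftPerm_succ]

lemma exists_low_relabel (i : L) (s : Fin (m + 1)) (π : Equiv.Perm (Fin (m + 1))) :
    ∃ ρ : Equiv.Perm (Fin m),
      sgn k ρ = sgn k (Equiv.swap 0 (π s)) * sgn k π * sgn k (Equiv.swap 0 s) ∧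
      ∀ u : Fin d → L ⊕ Fin (m + 1), low i (π s) (relabel π u) = relabel ρ (low i s u) := by
  obtain ⟨ρ, hρ⟩ := exists_liftPerm (ρ := Equiv.swap 0 (π s) * π * Equiv.swap 0 s) (by
    simp [Equiv.swap_apply_left, Equiv.swap_apply_right])
  refine ⟨ρ, by rw [← sgn_liftPerm, ← hρ, map_mul, map_mul], fun u => ?_⟩
  funext x
  rcases h : u x with a | r
  · simp [low, relabel, h]
  · have h1 : Equiv.swap 0 (π s) (π r) = liftPerm ρ (Equiv.swap 0 s r) := by
      rw [← hρ]; simp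
    simp only [low, relabel, h, map_inr, elim_inr, h1]
    induction Equiv.swap 0 s r using Fin.cases with
    | zero => simp [liftPerm_zero]
    | succ q => simp [liftPerm_succ]

variable (k d m) in
/-- Replacing the first label by the letter `i`. -/
noncomputable def merge (i : L) :
    WordSpace k d (L ⊕ Fin (m + 1)) →ₗ[SymGroupAlgebra k d] WordSpace k d (L ⊕ Fin m) :=
  homOfSingle
    { toFun := fun c u => ∑ x with u x = inl i, c (ins x u)
      map_zero' := by funext u; simp
      map_add' := fun c c' => by
        funext u; simp only [WordSpace.add_apply, Finset.sum_add_distrib]; rfl }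
    (fun σ a c => by
      rw [WordSpace.single_smul, WordSpace.single_smul]
      funext u
      show ∑ x with u x = inl i, a * c (ins x u ∘ σ) =
        a * ∑ x with u (σ x) = inl i, c (ins x (u ∘ σ))
      rw [← Finset.mul_sum, Finset.sum_filter, Finset.sum_filter, ← Equiv.sum_comp σ]
      simp only [ins_comp_perm])

lemma merge_apply (i : L) (c : WordSpace k d (L ⊕ Fin (m + 1))) (u : Fin d → L ⊕ Fin m) :
    merge k d m i c u = ∑ x with u x = inl i, c (ins x u) := rfl

lemma merge_relabel {i : L} {c : WordSpace k d (L ⊕ Fin (m + 1))}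
    (hc : ∀ π u, c (relabel π u) = sgn k π * c u) (π : Equiv.Perm (Fin m)) (u) :
    merge k d m i c (relabel π u) = sgn k π * merge k d m i c u := by
  simp only [merge_apply, relabel_eq_inl, ins_relabel, hc, sgn_liftPerm, Finset.mul_sum]

lemma isStage_of_merge_ne_zero {μ : L → ℕ} {i : L} {c : WordSpace k d (L ⊕ Fin (m + 1))}
    (hc : ∀ u, c u ≠ 0 → IsStage μ i (m + 1) u) (u) (hu : merge k d m i c u ≠ 0) :
    IsStage μ i m u := by
  obtain ⟨x, hx, hx'⟩ := Finset.exists_ne_zero_of_sum_ne_zero ((merge_apply i c u).symm.trans_ne hu)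
  exact (isStage_ins (by simpa using hx)).1 (hc _ hx')

lemma isStage_relabel [Fintype L] {μ : L → ℕ} {i : L} {π : Equiv.Perm (Fin m)}
    {u : Fin d → L ⊕ Fin m} : IsStage μ i m (relabel π u) ↔ IsStage μ i m u := by
  have h1 : ∀ (π : Equiv.Perm (Fin m)) (u : Fin d → L ⊕ Fin m),
      IsStage μ i m u → IsStage μ i m (relabel π u) := fun π u h =>
    ⟨fun l hl => by rw [← h.other l hl]; simp only [wcount, relabel_eq_inl],
      by rw [← h.same]; simp only [wcount, relabel_eq_inl],
      fun s => by rw [← h.label (π⁻¹ s)]; simp only [wcount, relabel_eq_inr]⟩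
  exact ⟨fun h => by simpa [relabel_inv_relabel] using h1 π⁻¹ _ h, h1 π u⟩

/-- The sum over all ways to replace a label by the letter `i`, with weights depending on the
position. -/
noncomputable def splitOff (i : L) (wt : Finset (Fin d) → Fin d → k)
    (c : WordSpace k d (L ⊕ Fin m)) : WordSpace k d (L ⊕ Fin (m + 1)) :=
  fun u => ∑ s, ∑ x, if ∀ y, u y = inr s ↔ y = x then
    wt (block i u) x * (sgn k (Equiv.swap 0 s) * c (low i s u)) else 0

lemma splitOff_relabel {i : L} {wt : Finset (Fin d) → Fin d → k} {c : WordSpace k d (L ⊕ Fin m)}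
    (hc : ∀ π u, c (relabel π u) = sgn k π * c u) (π : Equiv.Perm (Fin (m + 1))) (u) :
    splitOff i wt c (relabel π u) = sgn k π * splitOff i wt c u := by
  unfold splitOff
  rw [← Equiv.sum_comp π, Finset.mul_sum]
  refine Finset.sum_congr rfl fun s _ => ?_
  rw [Finset.mul_sum]
  refine Finset.sum_congr rfl fun x _ => ?_
  have h1 : ∀ y, relabel π u y = inr (π s) ↔ u y = inr s := fun y => by
    rw [relabel_eq_inr, ← Equiv.Perm.mul_apply, inv_mul_cancel, Equiv.Perm.one_apply]
  simp only [h1, block_relabel]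
  split_ifs
  · obtain ⟨ρ, hρ, hρ'⟩ := exists_low_relabel (k := k) (d := d) i s π
    rw [hρ', hc, hρ]
    linear_combination (wt (block i u) x * sgn k π * sgn k (Equiv.swap 0 s) * c (low i s u)) *
      sgn_mul_self (k := k) (Equiv.swap 0 (π s))
  · simp

lemma isStage_of_splitOff_ne_zero [Fintype L] {μ : L → ℕ} {i : L}
    {wt : Finset (Fin d) → Fin d → k} {c : WordSpace k d (L ⊕ Fin m)}
    (hc : ∀ u, c u ≠ 0 → IsStage μ i m u) (u) (hu : splitOff i wt c u ≠ 0) :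
    IsStage μ i (m + 1) u := by
  obtain ⟨s, -, hs⟩ := Finset.exists_ne_zero_of_sum_ne_zero hu
  obtain ⟨x, -, hx⟩ := Finset.exists_ne_zero_of_sum_ne_zero hs
  have h1 : ∀ y, u y = inr s ↔ y = x := by
    by_contra h; exact hx (if_neg h)
  rw [if_pos h1] at hx
  have h2 := hc _ (right_ne_zero_of_mul (right_ne_zero_of_mul hx))
  rw [← isStage_ins (x := x) (low_eq_inl.2 (Or.inr ((h1 x).2 rfl))), ins_low_self h1,
    isStage_relabel] at h2
  exact h2

lemma sgn_swap_zero_zero : sgn k (Equiv.swap (0 : Fin (m + 1)) 0) = 1 := by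
  rw [Equiv.swap_self]; exact map_one _

lemma sgn_swap_zero_succ (s : Fin m) : sgn k (Equiv.swap (0 : Fin (m + 1)) s.succ) = -1 :=
  sgn_swap (Fin.succ_ne_zero s).symm

lemma splitOff_apply {i : L} {wt : Finset (Fin d) → Fin d → k} {c : WordSpace k d (L ⊕ Fin m)}
    {u : Fin d → L ⊕ Fin (m + 1)} {q : Fin (m + 1) → Fin d} (hq : ∀ x s, u x = inr s ↔ x = q s) :
    splitOff i wt c u = ∑ s, wt (block i u) (q s) * (sgn k (Equiv.swap 0 s) * c (low i s u)) := by
  unfold splitOff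
  refine Finset.sum_congr rfl fun s _ => ?_
  rw [Finset.sum_eq_single (q s), if_pos fun y => hq y s]
  · intro x _ hx
    rw [if_neg]
    intro h
    exact hx (((hq x s).1 ((h x).2 rfl)))
  · simp

lemma merge_splitOff [Fintype L] {i : L}
    {wt : Finset (Fin d) → Fin d → k} {c : WordSpace k d (L ⊕ Fin m)}
    {u : Fin d → L ⊕ Fin m} {q : Fin m → Fin d} (hq : ∀ x s, u x = inr s ↔ x = q s) :
    merge k d m i (splitOff i wt c) u = ∑ x with u x = inl i, (wt (block i u) x * c u -
      ∑ s, wt (block i u) (q s) * c (low i s.succ (ins x u))) := by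
  rw [merge_apply]
  refine Finset.sum_congr rfl fun x hx => ?_
  have hx' : u x = inl i := by simpa using hx
  rw [splitOff_apply (q := Fin.cases x q), Fin.sum_univ_succ, block_ins hx', sub_eq_add_neg,
    ← Finset.sum_neg_distrib]
  · simp only [Fin.cases_zero, Fin.cases_succ, sgn_swap_zero_zero, sgn_swap_zero_succ,
      low_zero_ins hx', one_mul, neg_mul, mul_neg]
  · intro y s
    induction s using Fin.cases with
    | zero => exact ins_eq_zero
    | succ s =>
      rw [ins_eq_succ, hq]
      refine and_iff_right_of_imp ?_
      rintro h rfl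
      rw [(hq _ _).2 h] at hx'
      cases hx'

lemma splitOff_merge {i : L}
    {wt : Finset (Fin d) → Fin d → k} {c : WordSpace k d (L ⊕ Fin (m + 1))}
    (hc : ∀ π u, c (relabel π u) = sgn k π * c u)
    {u : Fin d → L ⊕ Fin (m + 1)} {q : Fin (m + 1) → Fin d} (hq : ∀ x s, u x = inr s ↔ x = q s) :
    splitOff i wt (merge k d m i c) u = ∑ s, wt (block i u) (q s) * (c u +
      ∑ x with u x = inl i, c (low i s.succ (ins x u))) := by
  rw [splitOff_apply hq]
  refine Finset.sum_congr rfl fun s _ => ?_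
  congr 1
  rw [merge_apply]
  have h1 : (Finset.univ.filter fun x => low i s u x = inl i) =
      insert (q s) (Finset.univ.filter fun x => u x = inl i) := by
    ext x; simp [low_eq_inl, hq, or_comm]
  rw [h1, Finset.sum_insert, ins_low_self fun y => hq y s, hc, mul_add, ← mul_assoc, sgn_mul_self,
    one_mul, Finset.mul_sum]
  · congr 1
    refine Finset.sum_congr rfl fun x hx => ?_
    rw [ins_low (by simpa using hx), hc, ← mul_assoc, sgn_mul_self, one_mul]
  · simp only [Finset.mem_filter, Finset.mem_univ, true_and, (hq _ s).2 rfl, reduceCtorEq,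
      not_false_eq_true]

lemma sum_block {i : L} {u : Fin d → L ⊕ Fin m} {q : Fin m → Fin d}
    (hq : ∀ x s, u x = inr s ↔ x = q s) (f : Fin d → k) :
    ∑ x ∈ block i u, f x = (∑ x with u x = inl i, f x) + ∑ s, f (q s) := by
  have h1 : block i u = (Finset.univ.filter fun x => u x = inl i) ∪ Finset.univ.image q := by
    ext x
    simp only [mem_block, Finset.mem_union, Finset.mem_filter, Finset.mem_univ, true_and,
      Finset.mem_image, hq, eq_comm]
  have h2 : Function.Injective q := fun s t h => by
    have := (hq (q s) s).2 rfl
    rw [(hq (q s) t).2 h] at this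
    exact (Sum.inr_injective this).symm
  rw [h1, Finset.sum_union, Finset.sum_image fun _ _ _ _ h => h2 h]
  rw [Finset.disjoint_left]
  intro x hx hx'
  obtain ⟨s, -, rfl⟩ := Finset.mem_image.1 hx'
  simp only [Finset.mem_filter, Finset.mem_univ, true_and, (hq _ s).2 rfl, reduceCtorEq] at hx

/-- The homotopy formula. -/
lemma merge_splitOff_add [Fintype L] {i : L}
    {wt : Finset (Fin d) → Fin d → k} {c : WordSpace k d (L ⊕ Fin (m + 1))}
    (hc : ∀ π u, c (relabel π u) = sgn k π * c u)
    {u : Fin d → L ⊕ Fin (m + 1)} {q : Fin (m + 1) → Fin d} (hq : ∀ x s, u x = inr s ↔ x = q s) :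
    merge k d (m + 1) i (splitOff i wt c) u + splitOff i wt (merge k d m i c) u =
      (∑ x ∈ block i u, wt (block i u) x) * c u := by
  rw [merge_splitOff hq, splitOff_merge hc hq, sum_block hq, Finset.sum_sub_distrib]
  simp only [mul_add, Finset.sum_add_distrib, Finset.mul_sum, add_mul, Finset.sum_mul]
  rw [Finset.sum_comm]
  ring

lemma merge_splitOff_zero [Fintype L] {i : L}
    {wt : Finset (Fin d) → Fin d → k} {c : WordSpace k d (L ⊕ Fin 0)} (u : Fin d → L ⊕ Fin 0) :
    merge k d 0 i (splitOff i wt c) u = (∑ x ∈ block i u, wt (block i u) x) * c u := by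
  have hq : ∀ x s, u x = inr s ↔ x = (finZeroElim : Fin 0 → Fin d) s := fun x s => s.elim0
  rw [merge_splitOff hq, sum_block hq]
  simp [Finset.sum_mul]

variable [Fintype L]

variable (k d) in
/-- The terms of the complex of `μ` at the letter `i`. -/
abbrev Stage (μ : L → ℕ) (i : L) (t : ℕ) :
    Submodule (SymGroupAlgebra k d) (WordSpace k d (L ⊕ Fin t)) :=
  Alt k d (μ - Pi.single i t) t

/-- The differential of the complex of `μ` at the letter `i`. -/
noncomputable def stageMap {μ : L → ℕ} (hμ : ∑ l, μ l = d) (i : L) (t : ℕ) :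
    Stage k d μ i (t + 1) →ₗ[SymGroupAlgebra k d] Stage k d μ i t :=
  (merge k d t i).restrict fun c hc => by
    rw [mem_alt_stage hμ] at hc ⊢
    exact ⟨isStage_of_merge_ne_zero hc.1, merge_relabel hc.2⟩

lemma stageMap_coe {μ : L → ℕ} (hμ : ∑ l, μ l = d) (i : L) (t : ℕ) (c : Stage k d μ i (t + 1)) :
    (stageMap hμ i t c : WordSpace k d (L ⊕ Fin t)) = merge k d t i c := rfl

lemma splitOff_mem {μ : L → ℕ} (hμ : ∑ l, μ l = d) {i : L} {t : ℕ}
    (wt : Finset (Fin d) → Fin d → k) (c : Stage k d μ i t) :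
    splitOff i wt (c : WordSpace k d (L ⊕ Fin t)) ∈ Stage k d μ i (t + 1) := by
  have hc := (mem_alt_stage hμ).1 c.2
  rw [mem_alt_stage hμ]
  exact ⟨isStage_of_splitOff_ne_zero hc.1, splitOff_relabel hc.2⟩

open Classical in
/-- The weight concentrated in the first element. -/
noncomputable def firstWeight (k : Type u) [Field k] (S : Finset (Fin d)) (x : Fin d) : k :=
  if ∀ y ∈ S, x ≤ y then 1 else 0

lemma sum_firstWeight {S : Finset (Fin d)} (hS : S.Nonempty) : ∑ x ∈ S, firstWeight k S x = 1 := by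
  rw [Finset.sum_eq_single (S.min' hS)]
  · exact if_pos fun y hy => S.min'_le y hy
  · intro x hx hx'
    refine if_neg fun h => hx' ?_
    exact le_antisymm (h _ (S.min'_mem hS)) (S.min'_le x hx)
  · exact fun h => absurd (S.min'_mem hS) h

lemma block_nonempty {μ : L → ℕ} {i : L} (hi : 0 < μ i) {t : ℕ} {u : Fin d → L ⊕ Fin t}
    (h : IsStage μ i t u) : (block i u).Nonempty := by
  rw [← Finset.card_pos, card_block h]; exact hi

/-- The complex of `μ` at a letter of positive multiplicity is exact. -/
lemma exists_stageMap_eq {μ : L → ℕ} (hμ : ∑ l, μ l = d) {i : L} (hi : 0 < μ i) (t : ℕ)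
    (c : Stage k d μ i (t + 1)) (hc : stageMap hμ i t c = 0) :
    ∃ b, stageMap hμ i (t + 1) b = c := by
  refine ⟨⟨_, splitOff_mem hμ (firstWeight k) c⟩, Subtype.ext (funext fun u => ?_)⟩
  rw [stageMap_coe]
  have hc' := (mem_alt_stage hμ).1 c.2
  have hc0 : merge k d t i (c : WordSpace k d (L ⊕ Fin (t + 1))) = 0 := congrArg Subtype.val hc
  by_cases hu : IsStage μ i (t + 1) u
  · obtain ⟨q, hq⟩ := hu.exists_pos
    have h1 := merge_splitOff_add (i := i) (wt := firstWeight k) hc'.2 hq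
    rw [hc0, sum_firstWeight (block_nonempty hi hu), one_mul] at h1
    simpa [splitOff] using h1
  · rw [not_not.1 (mt (hc'.1 u) hu)]
    by_contra h
    exact hu (isStage_of_merge_ne_zero (isStage_of_splitOff_ne_zero hc'.1) u h)

lemma stageMap_zero_surjective {μ : L → ℕ} (hμ : ∑ l, μ l = d) {i : L} (hi : 0 < μ i) :
    Function.Surjective (stageMap (k := k) hμ i 0) := by
  intro c
  refine ⟨⟨_, splitOff_mem hμ (firstWeight k) c⟩, Subtype.ext (funext fun u => ?_)⟩
  rw [stageMap_coe]
  have hc' := (mem_alt_stage hμ).1 c.2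
  rw [merge_splitOff_zero]
  by_cases hu : IsStage μ i 0 u
  · rw [sum_firstWeight (block_nonempty hi hu), one_mul]
  · rw [not_not.1 (mt (hc'.1 u) hu), mul_zero]

lemma stageMap_stageMap {μ : L → ℕ} (hμ : ∑ l, μ l = d) (i : L) (t : ℕ)
    (c : Stage k d μ i (t + 2)) : stageMap hμ i t (stageMap hμ i (t + 1) c) = 0 := by
  refine Subtype.ext (funext fun u => ?_)
  have hc := (mem_alt_stage hμ).1 c.2
  rw [stageMap_coe, stageMap_coe, merge_apply]
  simp only [merge_apply]
  rw [Finset.sum_sigma']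
  refine Finset.sum_involution (fun a _ => ⟨a.2, a.1⟩) ?_ ?_ ?_ ?_
  · rintro ⟨x, y⟩ h
    simp only [Finset.mem_sigma, Finset.mem_filter, Finset.mem_univ, true_and, ins_eq_inl] at h
    have h1 : ins x (ins y u) = relabel (Equiv.swap 0 1) (ins y (ins x u)) := by
      funext z
      by_cases hx : z = x
      · have hy : z ≠ y := fun e => h.2.1 (e.symm.trans hx)
        subst hx
        simp [ins, relabel, hy]
      · by_cases hy : z = y
        · subst hy
          simp [ins, relabel, hx]
        · rcases hz : u z with l | s
          · simp [ins, relabel, hx, hy, hz]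
          · simp only [ins, relabel, hx, hy, hz, if_false, map_inr]
            rw [Equiv.swap_apply_of_ne_of_ne (Fin.succ_ne_zero _)
              (Fin.succ_succ_ne_one s)]
    show c.1 (ins y (ins x u)) + c.1 (ins x (ins y u)) = 0
    rw [h1, hc.2, sgn_swap (by simp)]
    ring
  · rintro ⟨x, y⟩ h _ e
    simp only [Finset.mem_sigma, Finset.mem_filter, Finset.mem_univ, true_and, ins_eq_inl] at h
    exact h.2.1 (congrArg Sigma.fst e)
  · rintro ⟨x, y⟩ h
    simp only [Finset.mem_sigma, Finset.mem_filter, Finset.mem_univ, true_and, ins_eq_inl] at h ⊢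
    exact ⟨h.2.2, fun e => h.2.1 e.symm, h.1⟩
  · rintro ⟨x, y⟩ h
    rfl

variable (k) in
/-- The contracting homotopy with constant weights. -/
noncomputable def stageSplit {μ : L → ℕ} (hμ : ∑ l, μ l = d) (i : L) (t : ℕ) :
    Stage k d μ i t →ₗ[SymGroupAlgebra k d] Stage k d μ i (t + 1) :=
  homOfSingle
    { toFun := fun c => ⟨_, splitOff_mem hμ (fun _ _ => 1) c⟩
      map_zero' := Subtype.ext (funext fun u => by simp [splitOff])
      map_add' := fun c c' => Subtype.ext (funext fun u => by
        simp only [splitOff, Submodule.coe_add, WordSpace.add_apply, one_mul, mul_add,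
          ← Finset.sum_add_distrib]
        refine Finset.sum_congr rfl fun s _ => Finset.sum_congr rfl fun x _ => ?_
        split_ifs <;> simp) }
    (fun σ a c => Subtype.ext (by
      show splitOff i (fun _ _ => 1) ((MonoidAlgebra.single σ a : SymGroupAlgebra k d) •
        (c : WordSpace k d (L ⊕ Fin t))) = (MonoidAlgebra.single σ a : SymGroupAlgebra k d) •
          splitOff i (fun _ _ => 1) (c : WordSpace k d (L ⊕ Fin t))
      rw [WordSpace.single_smul, WordSpace.single_smul]
      funext u
      simp only [splitOff, Finset.mul_sum]
      refine Finset.sum_congr rfl fun s _ => ?_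
      rw [← Equiv.sum_comp σ]
      refine Finset.sum_congr rfl fun x _ => ?_
      have h1 : (∀ y, u y = inr s ↔ y = σ x) ↔ ∀ y, (u ∘ σ) y = inr s ↔ y = x := by
        rw [← σ.forall_congr_right]
        simp
      simp only [h1, low_comp_perm]
      split_ifs
      · ring
      · simp))

lemma stageSplit_coe {μ : L → ℕ} (hμ : ∑ l, μ l = d) (i : L) (t : ℕ) (c : Stage k d μ i t) :
    (stageSplit k hμ i t c : WordSpace k d (L ⊕ Fin (t + 1))) = splitOff i (fun _ _ => 1) c.1 := rfl

lemma stageMap_stageSplit_add {μ : L → ℕ} (hμ : ∑ l, μ l = d) (i : L) (t : ℕ)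
    (c : Stage k d μ i (t + 1)) (u) :
    (stageMap hμ i (t + 1) (stageSplit k hμ i (t + 1) c)).1 u +
      (stageSplit k hμ i t (stageMap hμ i t c)).1 u = (μ i : k) * c.1 u := by
  have hc' := (mem_alt_stage hμ).1 c.2
  by_cases hu : IsStage μ i (t + 1) u
  · obtain ⟨q, hq⟩ := hu.exists_pos
    rw [stageMap_coe, stageSplit_coe, stageSplit_coe, stageMap_coe,
      merge_splitOff_add hc'.2 hq]
    simp [card_block hu]
  · rw [not_not.1 (mt (hc'.1 u) hu),
      not_not.1 (mt
        (((mem_alt_stage hμ).1 (stageMap hμ i (t + 1) (stageSplit k hμ i (t + 1) c)).2).1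
        u) hu),
      not_not.1 (mt (((mem_alt_stage hμ).1 (stageSplit k hμ i t (stageMap hμ i t c)).2).1 u) hu)]
    simp

end Merge

/-! ### Homomorphisms from alternating functions to tensor space -/

section HomToTensor

open Sum

variable {k : Type u} [Field k] {d p : ℕ} {L : Type} [DecidableEq L] {m : ℕ}

lemma WordSpace.single_one_smul {α : Type} (a : k) (c : WordSpace k d α) :
    (MonoidAlgebra.single 1 a : SymGroupAlgebra k d) • c = fun u => a * c u :=
  WordSpace.single_smul 1 a c

lemma TensorSpace.single_one_smul (a : k) (c : TensorSpace k p d) :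
    (MonoidAlgebra.single 1 a : SymGroupAlgebra k d) • c = fun u => a * c u :=
  TensorSpace.single_smul 1 a c

/-- The positions of the labels increase with the labels with respect to `v`. -/
def Incr {C : Type} [LinearOrder C] (u : Fin d → L ⊕ Fin m) (v : Fin d → C) : Prop :=
  ∀ x y s t, u x = inr s → u y = inr t → s < t → v x < v y

instance {C : Type} [LinearOrder C] (u : Fin d → L ⊕ Fin m) (v : Fin d → C) :
    Decidable (Incr u v) :=
  inferInstanceAs (Decidable (∀ x y s t, u x = inr s → u y = inr t → s < t → v x < v y))

lemma incr_comp_perm {C : Type} [LinearOrder C] {u : Fin d → L ⊕ Fin m} {v : Fin d → C}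
    (σ : Equiv.Perm (Fin d)) : Incr (u ∘ σ) (v ∘ σ) ↔ Incr u v :=
  ⟨fun h x y s t hx hy => by simpa using h (σ.symm x) (σ.symm y) s t (by simpa) (by simpa),
    fun h x y => h (σ x) (σ y)⟩

lemma HasContent.exists_pos {ν : L → ℕ} {u : Fin d → L ⊕ Fin m} (h : HasContent (labelled ν m) u) :
    ∃ q : Fin m → Fin d, ∀ x s, u x = inr s ↔ x = q s := by
  have h1 : ∀ s, ∃ y, ∀ x, u x = inr s ↔ x = y := fun s => by
    obtain ⟨y, hy⟩ := Finset.card_eq_one.1 (h (inr s))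
    exact ⟨y, fun x => by simpa using Finset.ext_iff.1 hy x⟩
  choose q hq using h1
  exact ⟨q, fun x s => hq s x⟩

lemma existsUnique_incr {C : Type} [LinearOrder C] {u : Fin d → L ⊕ Fin m} {v : Fin d → C}
    {q : Fin m → Fin d} (hq : ∀ x s, u x = inr s ↔ x = q s) (hv : Function.Injective (v ∘ q)) :
    ∃! π : Equiv.Perm (Fin m), Incr (relabel π u) v := by
  have h1 : ∀ π : Equiv.Perm (Fin m), Incr (relabel π u) v ↔ Monotone ((v ∘ q) ∘ ⇑π⁻¹) := by
    intro π
    have h2 : Incr (relabel π u) v ↔ StrictMono ((v ∘ q) ∘ ⇑π⁻¹) := by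
      simp only [Incr, relabel_eq_inr, hq]
      exact ⟨fun h s t hst => h _ _ s t rfl rfl hst, fun h x y s t hx hy hst => by
        rw [hx, hy]; exact h hst⟩
    rw [h2]
    exact ⟨StrictMono.monotone, fun h => h.strictMono_of_injective (hv.comp π⁻¹.injective)⟩
  refine ⟨(Tuple.sort (v ∘ q))⁻¹, (h1 _).2 (by rw [inv_inv]; exact Tuple.monotone_sort _),
    fun π hπ => ?_⟩
  have h3 := Tuple.unique_monotone ((h1 π).1 hπ) (Tuple.monotone_sort _)
  have h4 : π⁻¹ = Tuple.sort (v ∘ q) := Equiv.ext fun s => hv (congrFun h3 s)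
  rw [← h4, inv_inv]

lemma sum_incr {C : Type} [LinearOrder C] {u : Fin d → L ⊕ Fin m} {v : Fin d → C}
    {q : Fin m → Fin d} (hq : ∀ x s, u x = inr s ↔ x = q s) (hv : Function.Injective (v ∘ q))
    (a : k) : (∑ π : Equiv.Perm (Fin m), if Incr (relabel π u) v then a else 0) = a := by
  obtain ⟨π, hπ, hπ'⟩ := existsUnique_incr hq hv
  rw [Finset.sum_eq_single π, if_pos hπ]
  · exact fun ρ _ h => if_neg fun h' => h (hπ' ρ h')
  · simp

variable (k) in
/-- The antisymmetrization of a word. -/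
noncomputable def altWord (u : Fin d → L ⊕ Fin m) : WordSpace k d (L ⊕ Fin m) :=
  fun w => ∑ π : Equiv.Perm (Fin m), if w = relabel π u then sgn k π else 0

lemma relabel_eq_iff {π : Equiv.Perm (Fin m)} {u w : Fin d → L ⊕ Fin m} :
    relabel π w = u ↔ w = relabel π⁻¹ u :=
  ⟨fun h => by rw [← h, relabel_inv_relabel], fun h => by rw [h, relabel_relabel_inv]⟩

lemma altWord_relabel_left (π : Equiv.Perm (Fin m)) (u w : Fin d → L ⊕ Fin m) :
    altWord k u (relabel π w) = sgn k π * altWord k u w := by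
  unfold altWord
  rw [Finset.mul_sum, ← Equiv.sum_comp (Equiv.mulLeft π)]
  refine Finset.sum_congr rfl fun ρ _ => ?_
  have h1 : relabel π w = relabel (π * ρ) u ↔ w = relabel ρ u := by
    rw [relabel_mul, relabel_eq_iff, relabel_inv_relabel]
  simp only [Equiv.coe_mulLeft, h1, map_mul]
  split_ifs <;> simp

lemma altWord_relabel (π : Equiv.Perm (Fin m)) (u w : Fin d → L ⊕ Fin m) :
    altWord k (relabel π u) w = sgn k π * altWord k u w := by
  unfold altWord
  rw [Finset.mul_sum, ← Equiv.sum_comp (Equiv.mulRight π⁻¹)]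
  refine Finset.sum_congr rfl fun ρ _ => ?_
  rw [Equiv.coe_mulRight, relabel_mul, relabel_inv_relabel, map_mul, sgn_inv]
  split_ifs <;> simp [mul_comm]

lemma altWord_comp_perm (u w : Fin d → L ⊕ Fin m) (σ : Equiv.Perm (Fin d)) :
    altWord k (u ∘ σ) (w ∘ σ) = altWord k u w := by
  unfold altWord
  simp only [relabel_comp, σ.surjective.right_cancellable]

lemma altWord_mem {ν : L → ℕ} {u : Fin d → L ⊕ Fin m} (hu : HasContent (labelled ν m) u) :
    altWord k u ∈ Alt k d ν m := by
  refine ⟨fun w hw => ?_, fun π w => altWord_relabel_left π u w⟩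
  obtain ⟨π, -, hπ⟩ := Finset.exists_ne_zero_of_sum_ne_zero hw
  have h1 : w = relabel π u := by
    by_contra h; exact hπ (if_neg h)
  rw [h1, hasContent_relabel]; exact hu

section Matrix

variable {ν : L → ℕ} (φ : Alt k d ν m →ₗ[SymGroupAlgebra k d] TensorSpace k p d)

open Classical in
/-- The matrix of a homomorphism. -/
noncomputable def altMatrix (u : Fin d → L ⊕ Fin m) (v : Fin d → Fin p) : k :=
  if h : HasContent (labelled ν m) u then φ ⟨altWord k u, altWord_mem h⟩ v else 0

lemma altMatrix_of_hasContent {u : Fin d → L ⊕ Fin m} (h : HasContent (labelled ν m) u)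
    (v : Fin d → Fin p) : altMatrix φ u v = φ ⟨altWord k u, altWord_mem h⟩ v := dif_pos h

lemma altMatrix_comp_perm (σ : Equiv.Perm (Fin d)) (u : Fin d → L ⊕ Fin m) (v : Fin d → Fin p) :
    altMatrix φ (u ∘ σ) (v ∘ σ) = altMatrix φ u v := by
  by_cases h : HasContent (labelled ν m) u
  · rw [altMatrix_of_hasContent φ h, altMatrix_of_hasContent φ ((hasContent_comp_perm σ).2 h)]
    have h1 : (⟨altWord k u, altWord_mem h⟩ : Alt k d ν m) =
        (MonoidAlgebra.single σ 1 : SymGroupAlgebra k d) •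
          ⟨altWord k (u ∘ σ), altWord_mem ((hasContent_comp_perm σ).2 h)⟩ := by
      refine Subtype.ext ?_
      rw [Submodule.coe_smul, WordSpace.single_smul]
      funext w
      exact ((one_mul _).trans (altWord_comp_perm u w σ)).symm
    rw [h1, map_smul, TensorSpace.single_smul]
    exact (one_mul _).symm
  · rw [altMatrix, altMatrix, dif_neg h, dif_neg (mt (hasContent_comp_perm σ).1 h)]

lemma altMatrix_relabel (π : Equiv.Perm (Fin m)) (u : Fin d → L ⊕ Fin m) (v : Fin d → Fin p) :
    altMatrix φ (relabel π u) v = sgn k π * altMatrix φ u v := by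
  by_cases h : HasContent (labelled ν m) u
  · rw [altMatrix_of_hasContent φ h, altMatrix_of_hasContent φ (hasContent_relabel.2 h)]
    have h1 : (⟨altWord k (relabel π u), altWord_mem (hasContent_relabel.2 h)⟩ : Alt k d ν m) =
        (MonoidAlgebra.single 1 (sgn k π) : SymGroupAlgebra k d) •
          ⟨altWord k u, altWord_mem h⟩ := by
      refine Subtype.ext ?_
      rw [Submodule.coe_smul, WordSpace.single_one_smul]
      funext w
      exact altWord_relabel π u w
    rw [h1, map_smul, TensorSpace.single_one_smul]
  · rw [altMatrix, altMatrix, dif_neg h, dif_neg (mt hasContent_relabel.1 h), mul_zero]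

lemma altMatrix_eq_zero (h2 : (2 : k) ≠ 0) {u : Fin d → L ⊕ Fin m} {v : Fin d → Fin p} {x y : Fin d}
    {s t : Fin m} (hx : u x = inr s) (hy : u y = inr t) (hst : s ≠ t) (hv : v x = v y) :
    altMatrix φ u v = 0 := by
  by_cases h : HasContent (labelled ν m) u
  · obtain ⟨q, hq⟩ := h.exists_pos
    have hxq := (hq _ _).1 hx
    have hyq := (hq _ _).1 hy
    have h3 : v ∘ Equiv.swap x y = v := by
      funext z
      rcases eq_or_ne z x with rfl | hzx
      · simp [hv]
      · rcases eq_or_ne z y with rfl | hzy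
        · simp [hv]
        · simp [Equiv.swap_apply_of_ne_of_ne hzx hzy]
    have h4 : u ∘ Equiv.swap x y = relabel (Equiv.swap s t) u := by
      funext z
      rcases eq_or_ne z x with rfl | hzx
      · simp [relabel, hx, hy]
      · rcases eq_or_ne z y with rfl | hzy
        · simp [relabel, hx, hy]
        · rcases hz : u z with l | r
          · simp [relabel, Equiv.swap_apply_of_ne_of_ne hzx hzy, hz]
          · have hzq := (hq _ _).1 hz
            have hrs : r ≠ s := by rintro rfl; exact hzx (hzq.trans hxq.symm)
            have hrt : r ≠ t := by rintro rfl; exact hzy (hzq.trans hyq.symm)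
            simp [relabel, Equiv.swap_apply_of_ne_of_ne hzx hzy, hz,
              Equiv.swap_apply_of_ne_of_ne hrs hrt]
    have h5 := altMatrix_comp_perm φ (Equiv.swap x y) u v
    rw [h3, h4, altMatrix_relabel, sgn_swap hst] at h5
    have h6 : 2 * altMatrix φ u v = 0 := by linear_combination -h5
    exact (mul_eq_zero.1 h6).resolve_left h2
  · rw [altMatrix, dif_neg h]

lemma injective_of_altMatrix_ne_zero (h2 : (2 : k) ≠ 0) {u : Fin d → L ⊕ Fin m}
    {v : Fin d → Fin p} (hG : altMatrix φ u v ≠ 0) {q : Fin m → Fin d}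
    (hq : ∀ x s, u x = inr s ↔ x = q s) : Function.Injective (v ∘ q) := by
  intro s t hst
  by_contra hne
  exact hG (altMatrix_eq_zero φ h2 ((hq _ _).2 rfl) ((hq _ _).2 rfl) hne hst)

lemma hasContent_of_altMatrix_ne_zero {u : Fin d → L ⊕ Fin m}
    {v : Fin d → Fin p} (hG : altMatrix φ u v ≠ 0) : HasContent (labelled ν m) u := by
  by_contra h; exact hG (dif_neg h)

variable [Fintype L]

lemma alt_eq_sum (c : WordSpace k d (L ⊕ Fin m)) (hc : c ∈ Alt k d ν m) (w) :
    c w = ∑ u, (if Incr u (id : Fin d → Fin d) then c u else 0) * altWord k u w := by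
  unfold altWord
  simp only [Finset.mul_sum, mul_ite, mul_zero]
  rw [Finset.sum_comm]
  have h1 : ∀ π : Equiv.Perm (Fin m), (∑ u : Fin d → L ⊕ Fin m, if w = relabel π u then
      (if Incr u (id : Fin d → Fin d) then c u else 0) * sgn k π else 0) =
      if Incr (relabel π⁻¹ w) (id : Fin d → Fin d) then c w else 0 := fun π => by
    rw [Finset.sum_eq_single (relabel π⁻¹ w), if_pos (relabel_relabel_inv π w).symm, hc.2, sgn_inv]
    · split_ifs
      · rw [mul_right_comm, sgn_mul_self, one_mul]
      · rw [zero_mul]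
    · intro u _ hu
      exact if_neg fun h => hu (by rw [h, relabel_inv_relabel])
    · simp
  simp only [h1]
  rw [← Equiv.sum_comp (Equiv.inv (Equiv.Perm (Fin m)))]
  simp only [Equiv.inv_apply, inv_inv]
  by_cases hw : HasContent (labelled ν m) w
  · obtain ⟨q, hq⟩ := hw.exists_pos
    refine (sum_incr hq ?_ _).symm
    intro s t hst
    have h2 := (hq (q s) s).2 rfl
    rw [show q s = q t from hst, (hq _ _).2 rfl] at h2
    exact (Sum.inr_injective h2).symm
  · rw [not_not.1 (mt (hc.1 w) hw)]; simp

lemma hom_apply_eq_sum_id (c : Alt k d ν m) (v : Fin d → Fin p) :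
    φ c v = ∑ u, if Incr u (id : Fin d → Fin d) then altMatrix φ u v * c.1 u else 0 := by
  classical
  have h1 : c = ∑ u : Fin d → L ⊕ Fin m, if h : HasContent (labelled ν m) u then
      (MonoidAlgebra.single 1 (if Incr u (id : Fin d → Fin d) then c.1 u else 0) :
        SymGroupAlgebra k d) • (⟨altWord k u, altWord_mem h⟩ : Alt k d ν m) else 0 := by
    refine Subtype.ext (funext fun w => ?_)
    rw [alt_eq_sum c.1 c.2 w, Submodule.coe_sum, WordSpace.sum_apply]
    refine Finset.sum_congr rfl fun u _ => ?_
    split_ifs with h2 h3 h3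
    · rw [Submodule.coe_smul, WordSpace.single_one_smul]
    · rw [not_not.1 (mt (c.2.1 u) h3)]; simp
    · rw [Submodule.coe_smul, WordSpace.single_one_smul]
    · simp
  conv_lhs => rw [h1]
  rw [map_sum, TensorSpace.sum_apply]
  refine Finset.sum_congr rfl fun u _ => ?_
  by_cases h : HasContent (labelled ν m) u
  · rw [dif_pos h, map_smul, TensorSpace.single_one_smul, altMatrix_of_hasContent φ h]
    split_ifs
    · exact mul_comm _ _
    · exact zero_mul _
  · rw [dif_neg h, map_zero, altMatrix, dif_neg h, zero_mul, ite_self]; rfl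

lemma hom_apply_eq_sum (h2 : (2 : k) ≠ 0) (c : Alt k d ν m) (v : Fin d → Fin p) :
    φ c v = ∑ u, if Incr u v then altMatrix φ u v * c.1 u else 0 := by
  rw [hom_apply_eq_sum_id]
  have h3 : ∀ u : Fin d → L ⊕ Fin m, altMatrix φ u v * c.1 u =
      ∑ π : Equiv.Perm (Fin m), if Incr (relabel π u) v then altMatrix φ u v * c.1 u else 0 := by
    intro u
    by_cases h : altMatrix φ u v = 0
    · simp [h]
    · obtain ⟨q, hq⟩ := (hasContent_of_altMatrix_ne_zero φ h).exists_pos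
      exact (sum_incr hq (injective_of_altMatrix_ne_zero φ h2 h hq) _).symm
  have h4 : ∀ u : Fin d → L ⊕ Fin m, altMatrix φ u v * c.1 u =
      ∑ π : Equiv.Perm (Fin m), if Incr (relabel π u) (id : Fin d → Fin d) then
        altMatrix φ u v * c.1 u else 0 := by
    intro u
    by_cases h : altMatrix φ u v = 0
    · simp [h]
    · obtain ⟨q, hq⟩ := (hasContent_of_altMatrix_ne_zero φ h).exists_pos
      exact (sum_incr (v := (id : Fin d → Fin d)) hq
        (injective_of_altMatrix_ne_zero φ h2 h hq).of_comp _).symm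
  have h5 : ∀ (π : Equiv.Perm (Fin m)) (u : Fin d → L ⊕ Fin m),
      altMatrix φ (relabel π u) v * c.1 (relabel π u) = altMatrix φ u v * c.1 u := fun π u => by
    rw [altMatrix_relabel, c.2.2]
    linear_combination (altMatrix φ u v * c.1 u) * sgn_mul_self (k := k) π
  calc _ = ∑ u, ∑ π : Equiv.Perm (Fin m), if Incr u (id : Fin d → Fin d) ∧ Incr (relabel π u) v then
        altMatrix φ u v * c.1 u else 0 := by
        refine Finset.sum_congr rfl fun u _ => ?_
        by_cases h : Incr u (id : Fin d → Fin d)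
        · simp only [h, if_true, true_and]; exact h3 u
        · simp [h]
    _ = ∑ u, ∑ π : Equiv.Perm (Fin m), if Incr (relabel π u) (id : Fin d → Fin d) ∧ Incr u v then
        altMatrix φ u v * c.1 u else 0 := by
        rw [Finset.sum_comm]
        conv_rhs => rw [Finset.sum_comm, ← Equiv.sum_comp (Equiv.inv (Equiv.Perm (Fin m)))]
        refine Finset.sum_congr rfl fun π _ => ?_
        conv_rhs => rw [← Equiv.sum_comp ⟨relabel π, relabel π⁻¹, relabel_inv_relabel π,
          relabel_relabel_inv π⟩]
        refine Finset.sum_congr rfl fun u _ => ?_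
        simp only [Equiv.coe_fn_mk, Equiv.inv_apply, relabel_inv_relabel, h5]
    _ = _ := by
        refine Finset.sum_congr rfl fun u _ => ?_
        by_cases h : Incr u v
        · simp only [h, if_true, and_true]; exact (h4 u).symm
        · simp [h]

/-- The homomorphism on word space given by the words whose labels increase with the colours. -/
noncomputable def incrHom (K : (Fin d → L ⊕ Fin m) → (Fin d → Fin p) → k)
    (hK : ∀ (σ : Equiv.Perm (Fin d)) u v, K (u ∘ σ) (v ∘ σ) = K u v) :
    WordSpace k d (L ⊕ Fin m) →ₗ[SymGroupAlgebra k d] TensorSpace k p d :=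
  (tensorEquiv k p d).symm.toLinearMap ∘ₗ
    kernelHom (fun u v => if Incr u v then K u v else 0) fun σ u v => by
      simp only [incr_comp_perm, hK]

lemma incrHom_apply (K : (Fin d → L ⊕ Fin m) → (Fin d → Fin p) → k) (hK)
    (c : WordSpace k d (L ⊕ Fin m)) (v) :
    incrHom K hK c v = ∑ u, if Incr u v then K u v * c u else 0 := by
  show ∑ u, (if Incr u v then K u v else 0) * c u = _
  simp only [ite_mul, zero_mul]

/-- Homomorphisms from alternating functions to tensor space extend to word space. -/
lemma exists_extend (h2 : (2 : k) ≠ 0) :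
    ∃ Φ : WordSpace k d (L ⊕ Fin m) →ₗ[SymGroupAlgebra k d] TensorSpace k p d,
      ∀ c : Alt k d ν m, Φ c.1 = φ c :=
  ⟨incrHom (altMatrix φ) (altMatrix_comp_perm φ), fun c => funext fun v => by
    rw [hom_apply_eq_sum φ h2, incrHom_apply]⟩

end Matrix

end HomToTensor

/-! ### Homomorphisms from the complex of a letter to tensor space -/

section HomExactness

open Sum

variable {k : Type u} [Field k] {d p : ℕ} {L : Type} [DecidableEq L] {m : ℕ}

lemma block_low (i : L) (s : Fin (m + 1)) (u : Fin d → L ⊕ Fin (m + 1)) :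
    block i (low i s u) = block i u := by
  ext x
  simp only [mem_block, low_eq_inl, low_eq_inr]
  constructor
  · rintro ((h | h) | ⟨r, h⟩)
    · exact Or.inl h
    · exact Or.inr ⟨_, h⟩
    · exact Or.inr ⟨_, h⟩
  · rintro (h | ⟨r, h⟩)
    · exact Or.inl (Or.inl h)
    · by_cases hr : r = s
      · exact Or.inl (Or.inr (hr ▸ h))
      · have h1 : Equiv.swap 0 s r ≠ 0 := by
          rw [Ne, Equiv.swap_apply_eq_iff, Equiv.swap_apply_left]; exact hr
        obtain ⟨q, hq⟩ := Fin.exists_succ_eq.2 h1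
        exact Or.inr ⟨q, by rw [hq, Equiv.swap_apply_self]; exact h⟩

lemma low_zero_relabel (i : L) (s : Fin (m + 1)) (ρ : Equiv.Perm (Fin m))
    (z : Fin d → L ⊕ Fin (m + 1)) :
    low i 0 (relabel (liftPerm ρ * Equiv.swap 0 s) z) = relabel ρ (low i s z) := by
  funext x
  rcases h : z x with a | r
  · simp [low, relabel, h]
  · simp only [low, relabel, h, map_inr, elim_inr, Equiv.swap_self, Equiv.refl_apply,
      Equiv.Perm.mul_apply]
    induction Equiv.swap 0 s r using Fin.cases with
    | zero => simp [liftPerm_zero]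
    | succ q => simp [liftPerm_succ]

lemma sum_perm_succ (F : Equiv.Perm (Fin (m + 1)) → k) :
    ∑ π, F π = ∑ s, ∑ ρ : Equiv.Perm (Fin m), F (liftPerm ρ * Equiv.swap 0 s) := by
  rw [← Equiv.sum_comp (Equiv.inv _), ← Equiv.sum_comp Equiv.Perm.decomposeFin.symm,
    Fintype.sum_prod_type]
  refine Finset.sum_congr rfl fun s _ => ?_
  rw [← Equiv.sum_comp (Equiv.inv _)]
  refine Finset.sum_congr rfl fun ρ _ => congrArg F ?_
  rw [Equiv.inv_apply, Equiv.inv_apply]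
  refine inv_eq_of_mul_eq_one_left (Equiv.ext fun x => ?_)
  rw [Equiv.Perm.mul_apply, Equiv.Perm.mul_apply, Equiv.Perm.one_apply]
  induction x using Fin.cases with
  | zero => simp [liftPerm_zero]
  | succ x => simp [liftPerm_succ]

/-- Merging an antisymmetrized word. -/
lemma merge_altWord {i : L} {z : Fin d → L ⊕ Fin (m + 1)} {q : Fin (m + 1) → Fin d}
    (hq : ∀ x s, z x = inr s ↔ x = q s) (w : Fin d → L ⊕ Fin m) :
    merge k d m i (altWord k z) w =
      ∑ s, sgn k (Equiv.swap 0 s) * altWord k (low i s z) w := by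
  have h1 : ∀ π : Equiv.Perm (Fin (m + 1)),
      (∑ x with w x = inl i, if ins x w = relabel π z then sgn k π else 0) =
        if w = low i 0 (relabel π z) then sgn k π else 0 := by
    intro π
    have hq' : ∀ y, relabel π z y = inr 0 ↔ y = q (π⁻¹ 0) := fun y => by rw [relabel_eq_inr, hq]
    split_ifs with h
    · have h2 : w (q (π⁻¹ 0)) = inl i := by rw [h, low_eq_inl]; exact Or.inr ((hq' _).2 rfl)
      rw [Finset.sum_eq_single_of_mem (q (π⁻¹ 0)) (by simpa using h2), if_pos]
      · conv_lhs => rw [h]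
        rw [ins_low_self hq', Equiv.swap_self]; exact relabel_one _
      · intro x _ hx
        refine if_neg fun h3 => hx ?_
        rw [← hq', ← h3, ins_eq_zero]
    · refine Finset.sum_eq_zero fun x hx => if_neg fun h3 => h ?_
      rw [← h3, low_zero_ins (by simpa using hx)]
  rw [merge_apply]
  unfold altWord
  rw [Finset.sum_comm]
  simp only [h1]
  rw [sum_perm_succ]
  refine Finset.sum_congr rfl fun s _ => ?_
  rw [Finset.mul_sum]
  refine Finset.sum_congr rfl fun ρ _ => ?_
  simp only [low_zero_relabel, map_mul, sgn_liftPerm, mul_ite, mul_zero]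
  rw [mul_comm]

lemma sum_incr_altWord [Fintype L] {w : Fin d → L ⊕ Fin m}
    {H : (Fin d → L ⊕ Fin m) → k} {v : Fin d → Fin p} {q : Fin m → Fin d}
    (hq : ∀ x s, w x = inr s ↔ x = q s)
    (hH : ∀ π, H (relabel π w) = sgn k π * H w)
    (hv : H w ≠ 0 → Function.Injective (v ∘ q)) :
    ∑ u, (if Incr u v then H u * altWord k w u else 0) = H w := by
  have h1 : ∀ u, (if Incr u v then H u * altWord k w u else 0) =
      ∑ π : Equiv.Perm (Fin m), if u = relabel π w then
        (if Incr (relabel π w) v then H w else 0) else 0 := by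
    intro u
    unfold altWord
    by_cases h : Incr u v
    · rw [if_pos h, Finset.mul_sum]
      refine Finset.sum_congr rfl fun π _ => ?_
      split_ifs with h3 h4
      · rw [h3, hH]
        linear_combination H w * sgn_mul_self (k := k) π
      · exact absurd (h3 ▸ h) h4
      · exact mul_zero _
    · rw [if_neg h]
      refine (Finset.sum_eq_zero fun π _ => ?_).symm
      split_ifs with h3 h4
      · exact absurd (h3 ▸ h4) h
      · rfl
      · rfl
  simp only [h1]
  rw [Finset.sum_comm]
  simp only [Finset.sum_ite_eq', Finset.mem_univ, if_true]
  by_cases h0 : H w = 0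
  · simp [h0]
  · exact sum_incr hq (hv h0) _

lemma alt_hom_ext [Fintype L] {ν : L → ℕ}
    {φ ψ : Alt k d ν m →ₗ[SymGroupAlgebra k d] TensorSpace k p d}
    (h : ∀ u v, HasContent (labelled ν m) u → altMatrix φ u v = altMatrix ψ u v) : φ = ψ := by
  refine LinearMap.ext fun c => funext fun v => ?_
  rw [hom_apply_eq_sum_id, hom_apply_eq_sum_id]
  refine Finset.sum_congr rfl fun u _ => ?_
  by_cases hu : HasContent (labelled ν m) u
  · rw [h u v hu]
  · rw [altMatrix, altMatrix, dif_neg hu, dif_neg hu]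

variable [Fintype L] {μ : L → ℕ}

lemma HasContent.stage_low (hμ : ∑ l, μ l = d) {i : L} {t : ℕ} {u : Fin d → L ⊕ Fin (t + 1)}
    (hu : HasContent (labelled (μ - Pi.single i (t + 1)) (t + 1)) u) (s : Fin (t + 1)) :
    HasContent (labelled (μ - Pi.single i t) t) (low i s u) :=
  (hasContent_iff_isStage hμ).2 (isStage_low s ((hasContent_iff_isStage hμ).1 hu))

lemma hasContent_stage_ins (hμ : ∑ l, μ l = d) {i : L} {t : ℕ} {u : Fin d → L ⊕ Fin t}
    {x : Fin d} (hx : u x = inl i) :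
    HasContent (labelled (μ - Pi.single i (t + 1)) (t + 1)) (ins x u) ↔
      HasContent (labelled (μ - Pi.single i t) t) u := by
  rw [hasContent_iff_isStage hμ, hasContent_iff_isStage hμ, isStage_ins hx]

variable (hμ : ∑ l, μ l = d) (i : L)

/-- The matrix of the composition with the differential. -/
lemma altMatrix_comp_stageMap {t : ℕ}
    (φ : Stage k d μ i t →ₗ[SymGroupAlgebra k d] TensorSpace k p d)
    {u : Fin d → L ⊕ Fin (t + 1)} (hu : HasContent (labelled (μ - Pi.single i (t + 1)) (t + 1)) u)
    (v : Fin d → Fin p) :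
    altMatrix (φ ∘ₗ stageMap hμ i t) u v =
      ∑ s, sgn k (Equiv.swap 0 s) * altMatrix φ (low i s u) v := by
  obtain ⟨q, hq⟩ := hu.exists_pos
  have h1 : stageMap hμ i t ⟨altWord k u, altWord_mem hu⟩ = ∑ s,
      (MonoidAlgebra.single 1 (sgn k (Equiv.swap 0 s)) : SymGroupAlgebra k d) •
        (⟨altWord k (low i s u), altWord_mem (hu.stage_low hμ s)⟩ : Stage k d μ i t) := by
    refine Subtype.ext (funext fun w => ?_)
    rw [stageMap_coe, merge_altWord hq, Submodule.coe_sum, WordSpace.sum_apply]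
    refine Finset.sum_congr rfl fun s _ => ?_
    rw [Submodule.coe_smul, WordSpace.single_one_smul]
  rw [altMatrix_of_hasContent _ hu, LinearMap.comp_apply, h1, map_sum, TensorSpace.sum_apply]
  refine Finset.sum_congr rfl fun s _ => ?_
  rw [map_smul, TensorSpace.single_one_smul, altMatrix_of_hasContent _ (hu.stage_low hμ s)]

section Preimage

variable {t : ℕ} (φ : Stage k d μ i (t + 1) →ₗ[SymGroupAlgebra k d] TensorSpace k p d)

/-- The position `x` carries the letter `i` and the least colour of the block. -/
def IsLeastPos (x : Fin d) (w : Fin d → L ⊕ Fin m) (v : Fin d → Fin p) : Prop :=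
  w x = inl i ∧ ∀ y ∈ block i w, v x ≤ v y

open Classical in
/-- The matrix of a homomorphism through which `φ` factors. -/
noncomputable def leastMatrix (w : Fin d → L ⊕ Fin t) (v : Fin d → Fin p) : k :=
  if h : ∃ x, IsLeastPos i x w v then altMatrix φ (ins h.choose w) v else 0

variable {i}

lemma leastMatrix_eq {x : Fin d} {w : Fin d → L ⊕ Fin t} {v : Fin d → Fin p}
    (hx : IsLeastPos i x w v) : leastMatrix i φ w v = altMatrix φ (ins x w) v := by
  have h : ∃ x, IsLeastPos i x w v := ⟨x, hx⟩
  rw [leastMatrix, dif_pos h]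
  have hy := h.choose_spec
  set y := h.choose
  have hvy : v y = v x := le_antisymm (hy.2 x (mem_block.2 (Or.inl hx.1)))
    (hx.2 y (mem_block.2 (Or.inl hy.1)))
  have h1 : v ∘ Equiv.swap x y = v := by
    funext z
    rcases eq_or_ne z x with rfl | hzx
    · simp [hvy]
    · rcases eq_or_ne z y with rfl | hzy
      · simp [hvy]
      · simp [Equiv.swap_apply_of_ne_of_ne hzx hzy]
  have h2 : w ∘ Equiv.swap x y = w := by
    funext z
    rcases eq_or_ne z x with rfl | hzx
    · simp [hx.1, hy.1]
    · rcases eq_or_ne z y with rfl | hzy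
      · simp [hx.1, hy.1]
      · simp [Equiv.swap_apply_of_ne_of_ne hzx hzy]
  have h3 := ins_comp_perm y w (Equiv.swap x y)
  have h4 := ins_comp_perm x w (Equiv.swap x y)
  rw [h2, Equiv.swap_apply_left] at h4
  rw [← altMatrix_comp_perm φ (Equiv.swap x y), h4, h1]

lemma leastMatrix_eq_zero {w : Fin d → L ⊕ Fin t} {v : Fin d → Fin p}
    (h : ¬ ∃ x, IsLeastPos i x w v) : leastMatrix i φ w v = 0 := dif_neg h

lemma isLeastPos_comp_perm {x : Fin d} {w : Fin d → L ⊕ Fin m} {v : Fin d → Fin p}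
    (σ : Equiv.Perm (Fin d)) : IsLeastPos i x (w ∘ σ) (v ∘ σ) ↔ IsLeastPos i (σ x) w v := by
  simp only [IsLeastPos, mem_block, Function.comp_apply]
  rw [← σ.forall_congr_right (q := fun y => (w y = inl i ∨ ∃ s, w y = inr s) → v (σ x) ≤ v y)]

lemma leastMatrix_comp_perm (σ : Equiv.Perm (Fin d)) (w : Fin d → L ⊕ Fin t) (v : Fin d → Fin p) :
    leastMatrix i φ (w ∘ σ) (v ∘ σ) = leastMatrix i φ w v := by
  by_cases h : ∃ x, IsLeastPos i x w v
  · obtain ⟨x, hx⟩ := h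
    obtain ⟨x, rfl⟩ := σ.surjective x
    rw [leastMatrix_eq φ hx, leastMatrix_eq φ ((isLeastPos_comp_perm σ).2 hx), ← ins_comp_perm,
      altMatrix_comp_perm]
  · rw [leastMatrix_eq_zero φ h, leastMatrix_eq_zero]
    rintro ⟨x, hx⟩
    exact h ⟨σ x, (isLeastPos_comp_perm σ).1 hx⟩

lemma isLeastPos_relabel {x : Fin d} {w : Fin d → L ⊕ Fin m} {v : Fin d → Fin p}
    (π : Equiv.Perm (Fin m)) : IsLeastPos i x (relabel π w) v ↔ IsLeastPos i x w v := by
  simp only [IsLeastPos, relabel_eq_inl, block_relabel]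

lemma leastMatrix_relabel (π : Equiv.Perm (Fin t)) (w : Fin d → L ⊕ Fin t) (v : Fin d → Fin p) :
    leastMatrix i φ (relabel π w) v = sgn k π * leastMatrix i φ w v := by
  by_cases h : ∃ x, IsLeastPos i x w v
  · obtain ⟨x, hx⟩ := h
    rw [leastMatrix_eq φ hx, leastMatrix_eq φ ((isLeastPos_relabel π).2 hx), ins_relabel,
      altMatrix_relabel, sgn_liftPerm]
  · rw [leastMatrix_eq_zero φ h, leastMatrix_eq_zero, mul_zero]
    rintro ⟨x, hx⟩
    exact h ⟨x, (isLeastPos_relabel π).1 hx⟩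

lemma injective_of_leastMatrix_ne_zero (h2 : (2 : k) ≠ 0) {w : Fin d → L ⊕ Fin t}
    {v : Fin d → Fin p} {q : Fin t → Fin d} (hq : ∀ x s, w x = inr s ↔ x = q s)
    (h : leastMatrix i φ w v ≠ 0) : Function.Injective (v ∘ q) := by
  by_cases hx : ∃ x, IsLeastPos i x w v
  · obtain ⟨x, hx⟩ := hx
    rw [leastMatrix_eq φ hx] at h
    have h1 := injective_of_altMatrix_ne_zero φ h2 h (q := Fin.cases x q) (by
      intro y s
      induction s using Fin.cases with
      | zero => exact ins_eq_zero
      | succ s =>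
        rw [ins_eq_succ, hq]
        refine and_iff_right_of_imp ?_
        rintro hy rfl
        have := hx.1
        rw [(hq _ _).2 hy] at this
        cases this)
    exact fun a b hab => Fin.succ_injective _ (h1 (a₁ := a.succ) (a₂ := b.succ) hab)
  · exact absurd (leastMatrix_eq_zero φ hx) h

/-- A homomorphism which vanishes on boundaries satisfies the exchange relation. -/
lemma altMatrix_ins_eq_sum (hφ : φ ∘ₗ stageMap hμ i (t + 1) = 0)
    {u : Fin d → L ⊕ Fin (t + 1)} (hu : HasContent (labelled (μ - Pi.single i (t + 1)) (t + 1)) u)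
    {x : Fin d} (hx : u x = inl i) (v : Fin d → Fin p) :
    altMatrix φ u v = ∑ s, altMatrix φ (low i (Fin.succ s) (ins x u)) v := by
  have h1 := altMatrix_comp_stageMap hμ i φ ((hasContent_stage_ins hμ hx).2 hu) v
  rw [hφ, Fin.sum_univ_succ, sgn_swap_zero_zero, low_zero_ins hx,
    altMatrix_of_hasContent _ ((hasContent_stage_ins hμ hx).2 hu)] at h1
  simp only [sgn_swap_zero_succ, neg_one_mul, Finset.sum_neg_distrib, one_mul] at h1
  exact (eq_of_sub_eq_zero ((sub_eq_add_neg _ _).trans h1.symm))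

lemma sum_leastMatrix_low (h2 : (2 : k) ≠ 0) (hφ : φ ∘ₗ stageMap hμ i (t + 1) = 0)
    {u : Fin d → L ⊕ Fin (t + 1)} (hu : HasContent (labelled (μ - Pi.single i (t + 1)) (t + 1)) u)
    (v : Fin d → Fin p) :
    ∑ s, sgn k (Equiv.swap 0 s) * leastMatrix i φ (low i s u) v = altMatrix φ u v := by
  by_cases h : ∃ x, IsLeastPos i x u v
  · obtain ⟨x, hx⟩ := h
    rw [altMatrix_ins_eq_sum hμ φ hφ hu hx.1]
    refine Finset.sum_congr rfl fun s _ => ?_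
    rw [leastMatrix_eq φ (x := x) ⟨low_eq_inl.2 (Or.inl hx.1), by rw [block_low]; exact hx.2⟩,
      ins_low hx.1, altMatrix_relabel, ← mul_assoc, sgn_mul_self, one_mul]
  · obtain ⟨q, hq⟩ := hu.exists_pos
    have h1 : ∀ s, sgn k (Equiv.swap 0 s) * leastMatrix i φ (low i s u) v =
        if ∀ y ∈ block i u, v (q s) ≤ v y then altMatrix φ u v else 0 := by
      intro s
      split_ifs with h3
      · rw [leastMatrix_eq φ (x := q s)
          ⟨low_eq_inl.2 (Or.inr ((hq _ _).2 rfl)), by rw [block_low]; exact h3⟩,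
          ins_low_self fun y => hq y s, altMatrix_relabel, ← mul_assoc, sgn_mul_self, one_mul]
      · rw [leastMatrix_eq_zero, mul_zero]
        rintro ⟨x, hx, hx'⟩
        rw [block_low] at hx'
        rcases low_eq_inl.1 hx with hx | hx
        · exact h ⟨x, hx, hx'⟩
        · rw [(hq _ _).1 hx] at hx'
          exact h3 hx'
    simp only [h1]
    by_cases h0 : altMatrix φ u v = 0
    · simp [h0]
    have hinj := injective_of_altMatrix_ne_zero φ h2 h0 hq
    have hmem : ∀ s, q s ∈ block i u := fun s => mem_block.2 (Or.inr ⟨s, (hq _ _).2 rfl⟩)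
    obtain ⟨x, hx, hx'⟩ := Finset.exists_min_image (block i u) v ⟨_, hmem 0⟩
    rcases mem_block.1 hx with h3 | ⟨s, h3⟩
    · exact absurd ⟨x, h3, hx'⟩ h
    · have hxs := (hq _ _).1 h3
      rw [hxs] at hx'
      rw [Finset.sum_eq_single s, if_pos hx']
      · intro r _ hr
        refine if_neg fun h4 => hr (hinj ?_)
        exact le_antisymm (h4 _ (hmem s)) (hx' _ (hmem r))
      · simp

/-- The complex of a letter is exact after passing to homomorphisms to tensor space. -/
lemma exists_comp_stageMap_eq (h2 : (2 : k) ≠ 0) (hφ : φ ∘ₗ stageMap hμ i (t + 1) = 0) :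
    ∃ ψ : Stage k d μ i t →ₗ[SymGroupAlgebra k d] TensorSpace k p d,
      ψ ∘ₗ stageMap hμ i t = φ := by
  refine ⟨incrHom (leastMatrix i φ) (leastMatrix_comp_perm φ) ∘ₗ Submodule.subtype _,
    alt_hom_ext fun u v hu => ?_⟩
  rw [altMatrix_comp_stageMap hμ i _ hu, ← sum_leastMatrix_low hμ φ h2 hφ hu]
  refine Finset.sum_congr rfl fun s _ => ?_
  have hu' := hu.stage_low hμ s
  obtain ⟨q, hq⟩ := hu'.exists_pos
  rw [altMatrix_of_hasContent _ hu', LinearMap.comp_apply, Submodule.subtype_apply, incrHom_apply,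
    sum_incr_altWord (H := fun u => leastMatrix i φ u v) hq
      (fun π => leastMatrix_relabel φ π _ v) (injective_of_leastMatrix_ne_zero φ h2 hq)]

end Preimage

end HomExactness

/-! ### Standard words -/

section Standard

variable {k : Type u} [Field k] {d p : ℕ} {α β : Type}

variable (p) in
/-- The positions can be coloured such that letters of the same colour increase. -/
def IsStandard (rk : α → ℕ) (u : Fin d → α) : Prop :=
  ∃ v : Fin d → Fin p, ∀ x y, x < y → v x = v y → rk (u x) ≤ rk (u y)

lemma IsStandard.comp_left {rk : α → ℕ} {rk' : β → ℕ} {g : α → β}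
    (hg : ∀ a b, rk a ≤ rk b → rk' (g a) ≤ rk' (g b)) {u : Fin d → α} (hu : IsStandard p rk u) :
    IsStandard p rk' (g ∘ u) := by
  obtain ⟨v, hv⟩ := hu
  exact ⟨v, fun x y hxy h => hg _ _ (hv x y hxy h)⟩

lemma exists_strictAntiOn {rk : α → ℕ} {u : Fin d → α} (hu : ¬ IsStandard p rk u) :
    ∃ s : Finset (Fin d), s.card = p + 1 ∧ StrictAntiOn (rk ∘ u) s := by
  classical
  by_contra! hs
  let chain : ℕ → Fin d → Prop := fun n x => ∃ s : Finset (Fin d), s.card = n + 1 ∧ x ∈ s ∧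
    (∀ y ∈ s, y ≤ x) ∧ StrictAntiOn (rk ∘ u) s
  have h0 : ∀ x, chain 0 x := fun x => ⟨{x}, by simp, by simp, by simp, by simp⟩
  let col : Fin d → ℕ := fun x => Nat.findGreatest (chain · x) p
  have hcol : ∀ x, chain (col x) x := fun x =>
    Nat.findGreatest_spec (P := (chain · x)) (Nat.zero_le p) (h0 x)
  have hlt : ∀ x, col x < p := fun x => by
    refine lt_of_le_of_ne (Nat.findGreatest_le p) fun h => ?_
    obtain ⟨s, hs1, -, -, hs2⟩ := hcol x
    exact hs s (by rw [hs1, h]) hs2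
  refine hu ⟨fun x => ⟨col x, hlt x⟩, fun x y hxy hc => ?_⟩
  by_contra! hrk
  have hc' : col x = col y := congrArg Fin.val hc
  obtain ⟨s, hs1, hs2, hs3, hs4⟩ := hcol x
  have hy : y ∉ s := fun h => absurd (hs3 y h) (not_le.2 hxy)
  have h1 : chain (col x + 1) y := by
    refine ⟨insert y s, by rw [Finset.card_insert_of_notMem hy, hs1], Finset.mem_insert_self _ _,
      ?_, ?_⟩
    · intro z hz
      rcases Finset.mem_insert.1 hz with rfl | hz
      · exact le_rfl
      · exact (hs3 z hz).trans hxy.le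
    · have h2 : ∀ z ∈ s, rk (u y) < rk (u z) := fun z hz => by
        rcases (hs3 z hz).eq_or_lt with rfl | h
        · exact hrk
        · exact hrk.trans (hs4 hz hs2 h)
      intro a ha b hb hab
      rcases Finset.mem_insert.1 ha with ha' | ha'
      · rcases Finset.mem_insert.1 hb with hb' | hb'
        · exact absurd hab (by rw [ha', hb']; exact lt_irrefl _)
        · exact absurd (hab.trans_le (hs3 b hb')) (not_lt.2 (ha' ▸ hxy.le))
      · rcases Finset.mem_insert.1 hb with hb' | hb'
        · rw [hb']; exact h2 a ha'
        · exact hs4 ha' hb' hab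
  have h3 : col x + 1 ≤ col y := Nat.le_findGreatest (hlt x) h1
  omega

lemma eq_one_of_strictMonoOn {s : Finset (Fin d)} {σ : Equiv.Perm (Fin d)}
    (hs : ∀ x, σ x ≠ x → x ∈ s) (hσ : StrictMonoOn σ s) : σ = 1 := by
  refine Equiv.ext fun x => ?_
  induction x using WellFoundedLT.induction with
  | ind x ih =>
  rw [Equiv.Perm.one_apply]
  by_contra hx
  have h1 : x < σ x := by
    refine lt_of_le_of_ne (not_lt.1 fun h => hx ?_) (Ne.symm hx)
    exact σ.injective (ih _ h)
  have h2 : σ (σ⁻¹ x) = x := by simp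
  have h3 : σ⁻¹ x ≠ x := fun h => hx (by rw [h] at h2; exact h2)
  rcases lt_or_gt_of_ne h3 with h | h
  · exact h3 ((ih _ h).symm.trans h2)
  · have h4 := hσ (hs x hx) (hs (σ⁻¹ x) (by rw [h2]; exact h3.symm)) h
    rw [h2] at h4
    exact absurd h1 (not_lt.2 h4.le)

/-- The measure of a word. -/
def wordWeight (rk : α → ℕ) (u : Fin d → α) : ℕ := ∑ x : Fin d, (x : ℕ) * rk (u x)

lemma wordWeight_lt {rk : α → ℕ} {u : Fin d → α} {s : Finset (Fin d)}
    (hs : StrictAntiOn (rk ∘ u) s) {σ : Equiv.Perm (Fin d)} (hσ : ∀ x, σ x ≠ x → x ∈ s)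
    (h1 : σ ≠ 1) : wordWeight rk u < wordWeight rk (u ∘ σ) := by
  have h2 : AntivaryOn (fun x : Fin d => (x : ℕ)) (rk ∘ u) s := by
    intro a ha b hb hab
    by_contra! h
    exact absurd hab (not_lt.2 (hs ha hb h).le)
  have h3 := (h2.sum_smul_lt_sum_smul_comp_perm_iff (σ := σ) (fun x hx => hσ x hx)).2 (by
    intro h4
    refine h1 (eq_one_of_strictMonoOn hσ fun a ha b hb hab => ?_)
    have hmem : ∀ a ∈ s, σ a ∈ s := fun a ha => by
      by_cases h : σ a = a
      · rw [h]; exact ha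
      · exact hσ _ fun h' => h (σ.injective h')
    by_contra! h5
    have h6 : σ b < σ a := lt_of_le_of_ne h5 fun h => hab.ne' (σ.injective h)
    exact absurd (h4 ha hb (hs (hmem b hb) (hmem a ha) h6)) (not_le.2 hab))
  have h5 : ∀ τ : Equiv.Perm (Fin d), (∀ x, τ x ≠ x → x ∈ s) → wordWeight rk (u ∘ τ) =
      (∑ x ∈ s, (x : Fin d).val • rk (u (τ x))) + ∑ x ∈ sᶜ, (x : Fin d).val * rk (u x) := by
    intro τ hτ
    unfold wordWeight
    rw [ ← Finset.sum_add_sum_compl s]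
    congr 1
    refine Finset.sum_congr rfl fun x hx => ?_
    rw [Function.comp_apply, not_not.1 (mt (hτ x) (Finset.mem_compl.1 hx))]
  have h6 := h5 1 (by simp)
  rw [show u ∘ ⇑(1 : Equiv.Perm (Fin d)) = u from rfl] at h6
  rw [h6, h5 σ hσ]
  exact Nat.add_lt_add_right h3 _

lemma wordWeight_le [Fintype α] (rk : α → ℕ) (u : Fin d → α) :
    wordWeight rk u ≤ ∑ x : Fin d, (x : ℕ) * ∑ a, rk a := by
  unfold wordWeight
  exact Finset.sum_le_sum fun _ _ => Nat.mul_le_mul_left _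
    (Finset.single_le_sum (f := rk) (fun _ _ => Nat.zero_le _) (Finset.mem_univ _))

variable (p) in
/-- The element is killed by all homomorphisms to tensor space. -/
def Rejected (c : WordSpace k d α) : Prop :=
  ∀ φ : WordSpace k d α →ₗ[SymGroupAlgebra k d] TensorSpace k p d, φ c = 0

/-- The antisymmetrizer of a set of more than `p` positions kills tensor space. -/
lemma antisymmetrizer_smul {s : Finset (Fin d)} (hs : p < s.card) (t : TensorSpace k p d) :
    (∑ σ : Equiv.Perm (Fin d) with ∀ x, σ x ≠ x → x ∈ s,
      (MonoidAlgebra.single σ (sgn k σ) : SymGroupAlgebra k d)) • t = 0 := by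
  rw [Finset.sum_smul]
  funext v
  rw [TensorSpace.sum_apply]
  simp only [TensorSpace.single_smul]
  obtain ⟨x, hx, y, hy, hxy, hv⟩ := Finset.exists_ne_map_eq_of_card_lt_of_maps_to
    (s := s) (t := Finset.univ) (by simpa using hs) (f := v) (fun _ _ => Finset.mem_univ _)
  have hsw : v ∘ Equiv.swap x y = v := by
    funext z
    rcases eq_or_ne z x with rfl | hzx
    · simp [hv]
    · rcases eq_or_ne z y with rfl | hzy
      · simp [hv]
      · simp [Equiv.swap_apply_of_ne_of_ne hzx hzy]
  refine Finset.sum_involution (fun σ _ => Equiv.swap x y * σ) ?_ ?_ ?_ ?_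
  · intro σ _
    rw [map_mul, sgn_swap hxy, Equiv.Perm.coe_mul, ← Function.comp_assoc, hsw]
    ring
  · intro σ _ _ h
    exact hxy (Equiv.swap_eq_one_iff.1 (mul_eq_right.1 h))
  · intro σ hσ
    rw [Finset.mem_filter] at hσ ⊢
    refine ⟨Finset.mem_univ _, fun z hz => ?_⟩
    by_contra hzs
    have h1 : σ z = z := not_not.1 (mt (hσ.2 z) hzs)
    refine hz ?_
    rw [Equiv.Perm.mul_apply, h1, Equiv.swap_apply_of_ne_of_ne]
    · rintro rfl; exact hzs hx
    · rintro rfl; exact hzs hy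
  · intro σ _
    rw [← mul_assoc, Equiv.swap_mul_self, one_mul]

lemma Rejected.add {c c' : WordSpace k d α} (h : Rejected p c) (h' : Rejected p c') :
    Rejected p (c + c') := fun φ => by rw [map_add, h, h', add_zero]

lemma Rejected.smul {c : WordSpace k d α} (h : Rejected p c) (r : SymGroupAlgebra k d) :
    Rejected p (r • c) := fun φ => by rw [map_smul, h, smul_zero]

lemma Rejected.sum {ι : Type*} {s : Finset ι} {c : ι → WordSpace k d α}
    (h : ∀ i ∈ s, Rejected p (c i)) : Rejected p (∑ i ∈ s, c i) := fun φ => by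
  rw [map_sum]; exact Finset.sum_eq_zero fun i hi => h i hi φ

lemma Rejected.map {c : WordSpace k d α} (h : Rejected p c)
    (f : WordSpace k d α →ₗ[SymGroupAlgebra k d] WordSpace k d β) : Rejected p (f c) :=
  fun φ => h (φ ∘ₗ f)

variable [DecidableEq α]

variable (k) in
/-- The indicator function of a word. -/
def delta (u : Fin d → α) : WordSpace k d α := fun w => if w = u then 1 else 0

lemma single_smul_delta (σ : Equiv.Perm (Fin d)) (a : k) (u : Fin d → α) :
    (MonoidAlgebra.single σ a : SymGroupAlgebra k d) • delta k u =
      fun w => a * delta k (u ∘ ⇑σ⁻¹) w := by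
  rw [WordSpace.single_smul]
  funext w
  have h1 : w ∘ σ = u ↔ w = u ∘ ⇑σ⁻¹ :=
    ⟨fun h => by rw [← h]; funext x; simp, fun h => by rw [h]; funext x; simp⟩
  show a * (if w ∘ σ = u then 1 else 0) = a * (if w = u ∘ ⇑σ⁻¹ then 1 else 0)
  simp only [h1]

lemma exists_standard_delta [Fintype α] (rk : α → ℕ) (u : Fin d → α) :
    ∃ c : WordSpace k d α, Rejected p (delta k u - c) ∧
      ∀ w, c w ≠ 0 → IsStandard p rk w ∧ ∃ σ : Equiv.Perm (Fin d), w = u ∘ σ := by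
  classical
  induction hn : (∑ x : Fin d, (x : ℕ) * ∑ a, rk a) - wordWeight rk u using Nat.strong_induction_on
    generalizing u with
  | _ n ih =>
  by_cases hu : IsStandard p rk u
  · refine ⟨delta k u, fun φ => by rw [sub_self, map_zero], fun w hw => ?_⟩
    have h1 : w = u := by
      by_contra h; exact hw (if_neg h)
    exact ⟨h1 ▸ hu, 1, h1⟩
  obtain ⟨s, hs, hs'⟩ := exists_strictAntiOn hu
  have h1 : ∀ σ : Equiv.Perm (Fin d), ∃ c : WordSpace k d α, (∀ x, σ x ≠ x → x ∈ s) → σ ≠ 1 →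
      Rejected p (delta k (u ∘ ⇑σ⁻¹) - c) ∧
      ∀ w, c w ≠ 0 → IsStandard p rk w ∧ ∃ τ : Equiv.Perm (Fin d), w = u ∘ τ := by
    intro σ
    by_cases hσ : (∀ x, σ x ≠ x → x ∈ s) ∧ σ ≠ 1
    · have h2 := wordWeight_lt hs' (σ := σ⁻¹) (fun x hx => hσ.1 x fun h => hx (by
        rw [Equiv.Perm.inv_eq_iff_eq, h])) (by simpa using hσ.2)
      obtain ⟨c, hc, hc'⟩ := ih ((∑ x : Fin d, (x : ℕ) * ∑ a, rk a) -
        wordWeight rk (u ∘ ⇑σ⁻¹)) (by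
        have := wordWeight_le rk u
        have := wordWeight_le rk (u ∘ ⇑σ⁻¹)
        omega) (u ∘ ⇑σ⁻¹) rfl
      refine ⟨c, fun _ _ => ⟨hc, fun w hw => ⟨(hc' w hw).1, ?_⟩⟩⟩
      obtain ⟨τ, hτ⟩ := (hc' w hw).2
      exact ⟨σ⁻¹ * τ, hτ⟩
    · exact ⟨0, fun h h' => absurd ⟨h, h'⟩ hσ⟩
  choose c hc using h1
  let S : Finset (Equiv.Perm (Fin d)) := Finset.univ.filter fun σ => ∀ x, σ x ≠ x → x ∈ s
  have hS : (1 : Equiv.Perm (Fin d)) ∈ S := by simp [S]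
  have hS' : ∀ σ ∈ S.erase 1, (∀ x, σ x ≠ x → x ∈ s) ∧ σ ≠ 1 := fun σ hσ => by
    rw [Finset.mem_erase] at hσ
    exact ⟨(Finset.mem_filter.1 hσ.2).2, hσ.1⟩
  refine ⟨-∑ σ ∈ S.erase 1, (MonoidAlgebra.single 1 (sgn k σ) : SymGroupAlgebra k d) • c σ, ?_, ?_⟩
  · have h2 : delta k u - -∑ σ ∈ S.erase 1,
        (MonoidAlgebra.single 1 (sgn k σ) : SymGroupAlgebra k d) • c σ
        = (∑ σ ∈ S, (MonoidAlgebra.single σ (sgn k σ) : SymGroupAlgebra k d)) • delta k u +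
        ∑ σ ∈ S.erase 1, (MonoidAlgebra.single 1 (-sgn k σ) : SymGroupAlgebra k d) •
          (delta k (u ∘ ⇑σ⁻¹) - c σ) := by
      rw [Finset.sum_smul, ← Finset.add_sum_erase S _ hS, sub_neg_eq_add, add_assoc,
        ← Finset.sum_add_distrib]
      congr 1
      · rw [map_one]; exact (one_smul _ _).symm
      · refine Finset.sum_congr rfl fun σ _ => ?_
        rw [single_smul_delta, WordSpace.single_one_smul, WordSpace.single_one_smul]
        funext w
        show _ = sgn k σ * delta k (u ∘ ⇑σ⁻¹) w + -sgn k σ * (delta k (u ∘ ⇑σ⁻¹) w - c σ w)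
        ring
    rw [h2]
    refine Rejected.add (fun φ => ?_) (Rejected.sum fun σ hσ => Rejected.smul ?_ _)
    · rw [map_smul]; exact antisymmetrizer_smul (by omega) _
    · exact (hc σ (hS' σ hσ).1 (hS' σ hσ).2).1
  · intro w hw
    have h3 : ∑ σ ∈ S.erase 1, sgn k σ * c σ w ≠ 0 := by
      intro h
      refine hw ?_
      show -(∑ σ ∈ S.erase 1, (MonoidAlgebra.single 1 (sgn k σ) : SymGroupAlgebra k d) • c σ :
        WordSpace k d α) w = 0
      rw [WordSpace.sum_apply]
      simp only [WordSpace.single_one_smul, h, neg_zero]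
    obtain ⟨σ, hσ, hσ'⟩ := Finset.exists_ne_zero_of_sum_ne_zero h3
    exact (hc σ (hS' σ hσ).1 (hS' σ hσ).2).2 w (right_ne_zero_of_mul hσ')

/-- Straightening. -/
lemma exists_standard [Fintype α] (rk : α → ℕ) (c : WordSpace k d α) :
    ∃ c' : WordSpace k d α, Rejected p (c - c') ∧ ∀ w, c' w ≠ 0 → IsStandard p rk w ∧
      ∃ (u : Fin d → α) (σ : Equiv.Perm (Fin d)), c u ≠ 0 ∧ w = u ∘ σ := by
  choose f hf hf' using fun u : Fin d → α => exists_standard_delta (k := k) (p := p) rk u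
  refine ⟨∑ u, (MonoidAlgebra.single 1 (c u) : SymGroupAlgebra k d) • f u, ?_, fun w hw => ?_⟩
  · have h1 : c - ∑ u, (MonoidAlgebra.single 1 (c u) : SymGroupAlgebra k d) • f u =
        ∑ u, (MonoidAlgebra.single 1 (c u) : SymGroupAlgebra k d) • (delta k u - f u) := by
      simp only [smul_sub, Finset.sum_sub_distrib]
      congr 1
      funext w
      rw [WordSpace.sum_apply, Finset.sum_eq_single w]
      · rw [WordSpace.single_one_smul]; simp [delta]
      · intro u _ hu
        rw [WordSpace.single_one_smul]; simp [delta, hu.symm]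
      · simp
    rw [h1]
    exact Rejected.sum fun u _ => (hf u).smul _
  · rw [WordSpace.sum_apply] at hw
    obtain ⟨u, -, hu⟩ := Finset.exists_ne_zero_of_sum_ne_zero hw
    rw [WordSpace.single_one_smul] at hu
    obtain ⟨h1, σ, h2⟩ := hf' u w (right_ne_zero_of_mul hu)
    exact ⟨h1, u, σ, left_ne_zero_of_mul hu, h2⟩

lemma wordWeight_comp_lt [Fintype α] {rk : α → ℕ} (hrk : Function.Injective rk) {u : Fin d → α}
    {v : Fin d → Fin p} (hv : ∀ x y, x < y → v x = v y → rk (u x) ≤ rk (u y))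
    {σ : Equiv.Perm (Fin d)} (hσ : v ∘ σ = v) (hu : u ∘ σ ≠ u) :
    wordWeight rk (u ∘ σ) < wordWeight rk u := by
  have hvσ : ∀ x, v (σ x) = v x := congrFun hσ
  obtain ⟨N, hN⟩ : ∃ N, ∀ a : α, rk a < N := ⟨(∑ a, rk a) + 1, fun a => Nat.lt_succ_of_le
    (Finset.single_le_sum (fun _ _ => Nat.zero_le _) (Finset.mem_univ _))⟩
  let f : Fin d → ℕ := fun x => (v x : ℕ) * d + x
  let g : Fin d → ℕ := fun x => (v x : ℕ) * N + rk (u x)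
  have hlex : ∀ (a b n r s : ℕ), r < n → s < n → a * n + r < b * n + s → a < b ∨ a = b ∧ r < s := by
    intro a b n r s hr hs h
    rcases lt_trichotomy a b with h1 | h1 | h1
    · exact Or.inl h1
    · subst h1; exact Or.inr ⟨rfl, by omega⟩
    · exfalso
      have : (b + 1) * n ≤ a * n := Nat.mul_le_mul_right n h1
      rw [add_mul] at this
      omega
  have hlex' : ∀ (a b n r s : ℕ), r < n → a < b → a * n + r < b * n + s := by
    intro a b n r s hr h
    have : (a + 1) * n ≤ b * n := Nat.mul_le_mul_right n h
    rw [add_mul] at this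
    omega
  have hf : Function.Injective f := by
    intro x y hxy
    by_contra hne
    have hva : (v x : ℕ) = v y := by
      rcases lt_trichotomy (v x : ℕ) (v y) with h | h | h
      · exact absurd hxy (hlex' _ _ _ _ _ x.2 h).ne
      · exact h
      · exact absurd hxy (hlex' _ _ _ _ _ y.2 h).ne'
    simp only [f, hva] at hxy
    exact hne (Fin.ext (by omega))
  have hfg : Monovary f g := by
    intro x y hxy
    rcases hlex _ _ _ _ _ (hN _) (hN _) hxy with h | ⟨h, h'⟩
    · exact (hlex' _ _ _ _ _ x.2 h).le
    · have h1 : x ≤ y := by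
        by_contra! h2
        exact absurd (hv y x h2 (Fin.ext h.symm)) (not_le.2 h')
      simp only [f, h]
      exact Nat.add_le_add_left h1 _
  have hmono : ∀ g' : Fin d → ℕ, Monovary f g' → Monotone (g' ∘ Tuple.sort f) := by
    intro g' h a b hab
    by_contra! h1
    have h2 := h h1
    have h3 := Tuple.monotone_sort f hab
    have h4 : a = b := (Tuple.sort f).injective (hf (le_antisymm h3 h2))
    subst h4
    exact lt_irrefl _ h1
  have h1 := (hfg.sum_smul_comp_perm_lt_sum_smul_iff (σ := σ)).2 (by
    intro h
    have h2 : g ∘ σ = g := by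
      have h3 := Tuple.unique_monotone (f := g) (σ := σ * Tuple.sort f) (τ := Tuple.sort f)
        (hmono _ h) (hmono _ hfg)
      funext x
      obtain ⟨a, rfl⟩ := (Tuple.sort f).surjective x
      exact congrFun h3 a
    refine hu (funext fun x => hrk ?_)
    have h3 := congrFun h2 x
    simp only [g, Function.comp_apply, hvσ] at h3
    exact Nat.add_left_cancel h3)
  have h2 : ∑ x, (v x : ℕ) * rk (u (σ x)) = ∑ x, (v x : ℕ) * rk (u x) := by
    rw [← Equiv.sum_comp σ fun x => (v x : ℕ) * rk (u x)]
    simp only [hvσ]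
  have h3 : ∀ w : Fin d → α, ∑ x, ((v x : ℕ) * d + x) * ((v x : ℕ) * N + rk (w x)) =
      ∑ x, (((v x : ℕ) * d + x) * ((v x : ℕ) * N)) + d * ∑ x, (v x : ℕ) * rk (w x) +
        wordWeight rk w := by
    intro w
    rw [wordWeight, Finset.mul_sum, ← Finset.sum_add_distrib, ← Finset.sum_add_distrib]
    exact Finset.sum_congr rfl fun x _ => by ring
  simp only [f, g, smul_eq_mul, hvσ] at h1
  have h4 := h3 (u ∘ σ)
  simp only [Function.comp_apply, h2] at h4
  rw [h3 u, h4] at h1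
  exact Nat.lt_of_add_lt_add_left h1

/-- Standard words are linearly independent modulo the rejected elements. -/
lemma eq_zero_of_standard [Fintype α] {rk : α → ℕ} (hrk : Function.Injective rk)
    {c : WordSpace k d α} (hc : ∀ u, c u ≠ 0 → IsStandard p rk u) (h : Rejected p c) : c = 0 := by
  classical
  by_contra hne
  obtain ⟨u₁, hu₁⟩ := Function.ne_iff.1 hne
  obtain ⟨u, hu, hmin⟩ := Finset.exists_min_image (Finset.univ.filter fun u => c u ≠ 0)
    (wordWeight rk) ⟨u₁, by simpa using hu₁⟩
  simp only [Finset.mem_filter, Finset.mem_univ, true_and] at hu hmin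
  obtain ⟨v, hv⟩ := hc u hu
  let K : (Fin d → α) → (Fin d → Fin p) → k := fun w z =>
    if ∃ σ : Equiv.Perm (Fin d), w = u ∘ σ ∧ z = v ∘ σ then 1 else 0
  have hK : ∀ (σ : Equiv.Perm (Fin d)) w z, K (w ∘ σ) (z ∘ σ) = K w z := by
    intro σ w z
    refine if_congr ⟨?_, ?_⟩ rfl rfl
    · rintro ⟨τ, h1, h2⟩
      refine ⟨τ * σ⁻¹, ?_, ?_⟩
      · rw [Equiv.Perm.coe_mul, ← Function.comp_assoc, ← h1]; funext x; simp
      · rw [Equiv.Perm.coe_mul, ← Function.comp_assoc, ← h2]; funext x; simp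
    · rintro ⟨τ, rfl, rfl⟩
      exact ⟨τ * σ, rfl, rfl⟩
  have h1 : ∑ w, K w v * c w = 0 :=
    congrFun (h ((tensorEquiv k p d).symm.toLinearMap ∘ₗ kernelHom K hK)) v
  rw [Finset.sum_eq_single u] at h1
  · rw [show K u v = 1 from if_pos ⟨1, rfl, rfl⟩, one_mul] at h1
    exact hu h1
  · intro w _ hw
    by_cases hK1 : ∃ σ : Equiv.Perm (Fin d), w = u ∘ σ ∧ v = v ∘ σ
    · obtain ⟨σ, rfl, hσ⟩ := hK1
      have h2 : c (u ∘ σ) = 0 := by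
        by_contra h3
        exact absurd (wordWeight_comp_lt hrk hv hσ.symm hw) (not_lt.2 (hmin _ h3))
      rw [h2, mul_zero]
    · rw [show K w v = 0 from if_neg hK1, zero_mul]
  · simp

end Standard

/-! ### Exactness of the complexes over the quotient -/

section StandardAlt

open Sum

variable {k : Type u} [Field k] {d p : ℕ} {L : Type} [DecidableEq L] [Fintype L] {m : ℕ}

variable (m) in
/-- The order of the letters with the labels in reverse order below the letter `i`. -/
noncomputable def stageRank (i : L) : L ⊕ Fin m → ℕ :=
  Sum.elim (fun l => if l = i then m else m + 1 + Fintype.equivFin L l) (fun s => m - 1 - s)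

lemma stageRank_injective (i : L) : Function.Injective (stageRank m i) := by
  rintro (a | a) (b | b) h <;> simp only [stageRank, elim_inl, elim_inr] at h
  · split_ifs at h with h1 h2 h2
    · rw [h1, h2]
    · omega
    · omega
    · exact congrArg _ ((Fintype.equivFin L).injective (Fin.ext (by omega)))
  · split_ifs at h <;> omega
  · split_ifs at h <;> omega
  · exact congrArg _ (Fin.ext (by omega))

/-- Identify the label `s + 1` with the label `s`. -/
def glue (s : Fin m) : L ⊕ Fin (m + 1) → L ⊕ Fin (m + 1) :=
  Sum.map id fun r => if r = s.succ then s.castSucc else r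

lemma stageRank_glue (i : L) (s : Fin m) (a b : L ⊕ Fin (m + 1))
    (h : stageRank (m + 1) i a ≤ stageRank (m + 1) i b) :
    stageRank (m + 1) i (glue s a) ≤ stageRank (m + 1) i (glue s b) := by
  rcases a with a | a <;> rcases b with b | b <;>
    simp only [glue, stageRank, Sum.map_inl, Sum.map_inr, elim_inl, elim_inr, id] at h ⊢
  · exact h
  · exfalso; split_ifs at h <;> omega
  · rw [apply_ite Fin.val]
    simp only [Fin.val_castSucc]
    split_ifs <;> omega
  · rw [apply_ite Fin.val, apply_ite Fin.val]
    simp only [Fin.ext_iff, Fin.val_succ, Fin.val_castSucc]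
    split_ifs <;> omega

lemma glue_relabel (s : Fin m) (u : Fin d → L ⊕ Fin (m + 1)) :
    glue s ∘ relabel (Equiv.swap s.castSucc s.succ) u = glue s ∘ u := by
  have hne : s.castSucc ≠ s.succ := Fin.castSucc_lt_succ.ne
  funext x
  rcases h : u x with l | r
  · simp [glue, relabel, h]
  · simp only [glue, relabel, h, Function.comp_apply, Sum.map_inr]
    rcases eq_or_ne r s.castSucc with rfl | h1
    · simp [hne]
    · rcases eq_or_ne r s.succ with rfl | h2
      · simp [hne]
      · rw [Equiv.swap_apply_of_ne_of_ne h1 h2]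

lemma eq_or_eq_relabel_of_glue_eq {ν : L → ℕ} {s : Fin m} {u w : Fin d → L ⊕ Fin (m + 1)}
    (hu : HasContent (labelled ν (m + 1)) u) (hw : HasContent (labelled ν (m + 1)) w)
    (h : glue s ∘ w = glue s ∘ u) : w = u ∨ w = relabel (Equiv.swap s.castSucc s.succ) u := by
  have hne : s.castSucc ≠ s.succ := Fin.castSucc_lt_succ.ne
  obtain ⟨q, hq⟩ := hu.exists_pos
  obtain ⟨r, hr⟩ := hw.exists_pos
  have h1 : ∀ x, (u x ≠ inr s.castSucc ∧ u x ≠ inr s.succ ∧ w x = u x) ∨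
      ((u x = inr s.castSucc ∨ u x = inr s.succ) ∧
        (w x = inr s.castSucc ∨ w x = inr s.succ)) := by
    intro x
    have h2 := congrFun h x
    rcases hux : u x with a | a <;> rcases hwx : w x with b | b <;>
      simp only [glue, Function.comp_apply, hux, hwx, Sum.map_inl, Sum.map_inr, id, inl.injEq,
        inr.injEq, reduceCtorEq] at h2 ⊢
    · simp [h2]
    · by_cases ha : a = s.succ <;> by_cases hb : b = s.succ <;> simp [ha, hb] at h2 ⊢
      · exact h2
      · exact Or.inr h2.symm
      · by_cases hc : a = s.castSucc
        · exact Or.inr ⟨hc, h2.trans hc⟩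
        · exact Or.inl ⟨hc, h2⟩
  have ha : u (q s.castSucc) = inr s.castSucc := (hq _ _).2 rfl
  have hb : u (q s.succ) = inr s.succ := (hq _ _).2 rfl
  have hab : q s.castSucc ≠ q s.succ := fun h => hne (inr.inj (by rw [← ha, h, hb]))
  have hex : ∀ x y a, w x = inr a → w y = inr a → x = y := fun x y a hx hy =>
    ((hr _ _).1 hx).trans ((hr _ _).1 hy).symm
  have hwa := ((h1 (q s.castSucc)).resolve_left fun h => h.1 ha).2
  have hwb := ((h1 (q s.succ)).resolve_left fun h => h.2.1 hb).2
  rcases hwa with hwa | hwa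
  · left
    have hwb := hwb.resolve_left fun h => hab (hex _ _ _ hwa h)
    funext x
    rcases h1 x with h2 | ⟨h2 | h2, -⟩
    · exact h2.2.2
    · rw [(hq _ _).1 h2, hwa, ha]
    · rw [(hq _ _).1 h2, hwb, hb]
  · right
    have hwb := hwb.resolve_right fun h => hab (hex _ _ _ hwa h)
    funext x
    rcases h1 x with h2 | ⟨h2 | h2, -⟩
    · rw [h2.2.2]
      rcases hux : u x with l | t
      · simp [relabel, hux]
      · have h3 : t ≠ s.castSucc := fun h => h2.1 (by rw [hux, h])
        have h4 : t ≠ s.succ := fun h => h2.2.1 (by rw [hux, h])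
        simp [relabel, hux, Equiv.swap_apply_of_ne_of_ne h3 h4]
    · rw [(hq _ _).1 h2, hwa]; simp [relabel, ha]
    · rw [(hq _ _).1 h2, hwb]; simp [relabel, hb]

/-- Straightening preserves the alternating elements. -/
lemma exists_standard_alt (h2 : (2 : k) ≠ 0) (i : L) {ν : L → ℕ} (c : Alt k d ν m) :
    ∃ c' : Alt k d ν m, Rejected p (c.1 - c'.1) ∧
      ∀ w, c'.1 w ≠ 0 → IsStandard p (stageRank m i) w := by
  obtain ⟨c', hc', hw⟩ := exists_standard (p := p) (stageRank m i) c.1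
  have hcon : ∀ w, c' w ≠ 0 → HasContent (labelled ν m) w := fun w h => by
    obtain ⟨-, u, σ, hu, rfl⟩ := hw w h
    exact (hasContent_comp_perm σ).2 ((mem_alt.1 c.2).1 u hu)
  refine ⟨⟨c', mem_alt.2 ⟨hcon, ?_⟩⟩, hc', fun w h => (hw w h).1⟩
  rcases m with _ | m
  · intro π u
    rw [Subsingleton.elim π 1, relabel_one, map_one, one_mul]
  have hswap : ∀ (s : Fin m) u, c' (relabel (Equiv.swap s.castSucc s.succ) u) = -c' u := by
    intro s
    have hne : s.castSucc ≠ s.succ := Fin.castSucc_lt_succ.ne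
    let K : (Fin d → L ⊕ Fin (m + 1)) → (Fin d → L ⊕ Fin (m + 1)) → k := fun u w =>
      if glue s ∘ u = w then 1 else 0
    have hK : ∀ (σ : Equiv.Perm (Fin d)) u v, K (u ∘ σ) (v ∘ σ) = K u v := fun σ u v => by
      refine if_congr ⟨fun h => ?_, fun h => ?_⟩ rfl rfl
      · funext x
        have := congrFun h (σ⁻¹ x)
        simpa using this
      · rw [← h]; rfl
    have hpush : kernelHom K hK c.1 = 0 := by
      funext w
      rw [kernelHom_apply]
      refine Finset.sum_involution
        (fun u _ => relabel (Equiv.swap s.castSucc s.succ) u) ?_ ?_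
        (fun _ _ => Finset.mem_univ _) ?_
      · intro u _
        simp only [K]
        rw [glue_relabel, (mem_alt.1 c.2).2, sgn_swap hne]
        ring
      · intro u _ hu h
        have h3 := (mem_alt.1 c.2).2 (Equiv.swap s.castSucc s.succ) u
        rw [h, sgn_swap hne] at h3
        have h4 : (2 : k) * c.1 u = 0 := by linear_combination h3
        exact hu (by rw [(mul_eq_zero.1 h4).resolve_left h2, mul_zero])
      · intro u _
        rw [← relabel_mul, Equiv.swap_mul_self, relabel_one]
    have hpush' : kernelHom K hK c' = 0 := by
      refine eq_zero_of_standard (p := p) (stageRank_injective i) (fun w h => ?_) fun φ => ?_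
      · rw [kernelHom_apply] at h
        obtain ⟨u, -, hu⟩ := Finset.exists_ne_zero_of_sum_ne_zero h
        have h3 : glue s ∘ u = w := by
          by_contra h3; exact left_ne_zero_of_mul hu (if_neg h3)
        rw [← h3]
        exact (hw u (right_ne_zero_of_mul hu)).1.comp_left (stageRank_glue i s)
      · have h3 := hc'.map (kernelHom K hK) φ
        rw [map_sub, map_sub, hpush, map_zero, zero_sub, neg_eq_zero] at h3
        exact h3
    intro u
    by_cases hu : HasContent (labelled ν (m + 1)) u
    · have h3 : ∑ w, K w (glue s ∘ u) * c' w = 0 := congrFun hpush' (glue s ∘ u)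
      rw [Fintype.sum_eq_add u (relabel (Equiv.swap s.castSucc s.succ) u)] at h3
      · rw [show K u (glue s ∘ u) = 1 from if_pos rfl,
          show K (relabel (Equiv.swap s.castSucc s.succ) u) (glue s ∘ u) = 1 from
            if_pos (glue_relabel s u)] at h3
        linear_combination h3
      · intro h
        obtain ⟨q, hq⟩ := hu.exists_pos
        have h4 : u (q s.castSucc) = inr s.castSucc := (hq _ _).2 rfl
        have h5 := congrFun h (q s.castSucc)
        rw [h4] at h5
        simp [relabel, h4, hne] at h5
      · rintro w ⟨hw1, hw2⟩
        by_cases hcw : c' w = 0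
        · rw [hcw, mul_zero]
        · rw [show K w (glue s ∘ u) = 0 from if_neg fun h => ?_, zero_mul]
          rcases eq_or_eq_relabel_of_glue_eq hu (hcon w hcw) h with h | h
          · exact hw1 h
          · exact hw2 h
    · rw [not_not.1 (mt (hcon u) hu), not_not.1 (mt (hcon _) (mt hasContent_relabel.1 hu)),
        neg_zero]
  intro π
  induction (show π ∈ Submonoid.closure (Set.range fun i : Fin m =>
      Equiv.swap i.castSucc i.succ) from Equiv.Perm.mclosure_swap_castSucc_succ m ▸
      Submonoid.mem_top π) using Submonoid.closure_induction with
  | mem x hx =>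
    obtain ⟨s, rfl⟩ := hx
    intro u
    rw [hswap, sgn_swap Fin.castSucc_lt_succ.ne, neg_one_mul]
  | one => intro u; rw [relabel_one, map_one, one_mul]
  | mul x y _ _ hx hy => intro u; rw [relabel_mul, hx, hy, map_mul, mul_assoc]

lemma isStandard_of_merge_ne_zero {i : L} {c : WordSpace k d (L ⊕ Fin (m + 1))}
    (hc : ∀ w, c w ≠ 0 → IsStandard p (stageRank (m + 1) i) w) (u) (hu : merge k d m i c u ≠ 0) :
    IsStandard p (stageRank m i) u := by
  rw [merge_apply] at hu
  obtain ⟨x, hx, h⟩ := Finset.exists_ne_zero_of_sum_ne_zero hu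
  have hx := (Finset.mem_filter.1 hx).2
  let g : L ⊕ Fin (m + 1) → L ⊕ Fin m := Sum.elim inl fun r => Fin.cases (inl i) inr r
  have h1 : u = g ∘ ins x u := by
    conv_lhs => rw [← low_zero_ins hx]
    funext y
    simp [low, g]
  rw [h1]
  refine (hc _ h).comp_left fun a b hab => ?_
  rcases a with a | a <;> rcases b with b | b <;>
    simp only [stageRank, elim_inl, elim_inr, g] at hab ⊢
  · split_ifs at hab ⊢ <;> omega
  · exfalso; split_ifs at hab <;> omega
  · induction a using Fin.cases <;>
      simp only [Fin.cases_zero, Fin.cases_succ, elim_inl, elim_inr] <;>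
      split_ifs <;> omega
  · induction a using Fin.cases <;> induction b using Fin.cases <;>
      simp only [Fin.cases_zero, Fin.cases_succ, elim_inl, elim_inr, if_true, Fin.val_zero,
        Fin.val_succ, le_refl] at hab ⊢ <;> omega

lemma mk_alt_eq_zero_iff (h2 : (2 : k) ≠ 0) {ν : L → ℕ} (c : Alt k d ν m) :
    LQuot.mk (k := k) (d := d) p c = 0 ↔ Rejected p c.1 := by
  rw [← LQuot.mk_zero, LQuot.mk_eq_iff]
  constructor
  · intro h φ
    have := h (φ ∘ₗ (Alt k d ν m).subtype)
    rw [map_zero] at this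
    exact this
  · intro h φ
    obtain ⟨Φ, hΦ⟩ := exists_extend φ h2
    rw [← hΦ, h, map_zero]

lemma subsingleton_alt (h2 : (2 : k) ≠ 0) (ν : L → ℕ) (hm : p < m) :
    Subsingleton (LQuot (k := k) (d := d) p (Alt k d ν m)) := by
  refine LQuot.subsingleton fun φ c => ?_
  funext v
  rw [hom_apply_eq_sum_id]
  refine Finset.sum_eq_zero fun u _ => ?_
  rw [show altMatrix φ u v = 0 from ?_, zero_mul, ite_self]
  by_contra hG
  obtain ⟨q, hq⟩ := (hasContent_of_altMatrix_ne_zero φ hG).exists_pos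
  have := Fintype.card_le_of_injective _ (injective_of_altMatrix_ne_zero φ h2 hG hq)
  simp only [Fintype.card_fin] at this
  omega

/-- The complex of `μ` at the letter `i` is exact over the quotient, and remains so after applying
homomorphisms to tensor space. -/
lemma homExact_stage (h2 : (2 : k) ≠ 0) {μ : L → ℕ} (hμ : ∑ l, μ l = d) {i : L} (hi : 0 < μ i) :
    HomExact (TensorSpace k p d) (fun t => LQuot (k := k) (d := d) p (Stage k d μ i t))
      (fun t => LQuot.map (stageMap hμ i t)) where
  surj x := by
    obtain ⟨x, rfl⟩ := LQuot.mk_surjective x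
    obtain ⟨y, rfl⟩ := stageMap_zero_surjective hμ hi x
    exact ⟨LQuot.mk p y, LQuot.map_mk _ _⟩
  comp t x := by
    obtain ⟨x, rfl⟩ := LQuot.mk_surjective x
    rw [LQuot.map_mk, LQuot.map_mk, stageMap_stageMap, LQuot.mk_zero]
  exact t x hx := by
    obtain ⟨c, rfl⟩ := LQuot.mk_surjective x
    rw [LQuot.map_mk, mk_alt_eq_zero_iff h2] at hx
    obtain ⟨c', hc', hst⟩ := exists_standard_alt (p := p) h2 i c
    have h1 : stageMap hμ i t c' = 0 := by
      refine Subtype.ext (eq_zero_of_standard (p := p) (stageRank_injective i)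
        (isStandard_of_merge_ne_zero hst) fun φ => ?_)
      have h3 := hc'.map (merge k d t i) φ
      rw [map_sub, map_sub, ← stageMap_coe hμ, hx φ, zero_sub, neg_eq_zero] at h3
      exact h3
    obtain ⟨y, hy⟩ := exists_stageMap_eq hμ hi t c' h1
    refine ⟨LQuot.mk p y, ?_⟩
    rw [LQuot.map_mk, hy, eq_comm, LQuot.mk_eq_iff]
    intro φ
    rw [← sub_eq_zero, ← map_sub, ← map_zero φ]
    exact LQuot.mk_eq_iff.1 (((mk_alt_eq_zero_iff h2 (c - c')).2 hc').trans LQuot.mk_zero.symm) φ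
  hom t g hg := by
    obtain ⟨ψ, hψ⟩ := exists_comp_stageMap_eq hμ (LQuot.coeval g) h2 (by
      refine LinearMap.ext fun x => ?_
      exact LinearMap.congr_fun hg (LQuot.mk p x))
    refine ⟨LQuot.eval ψ, LinearMap.ext fun x => ?_⟩
    obtain ⟨c, rfl⟩ := LQuot.mk_surjective x
    exact LinearMap.congr_fun hψ c
  bounded := ⟨p + 1, fun t ht => subsingleton_alt h2 _ ht⟩

end StandardAlt

/-! ### Retracts between spaces of words -/

section Retracts

open Sum

variable {k : Type u} [Field k] {d p : ℕ} {α β : Type} [DecidableEq α] [DecidableEq β]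

section Scale

variable {V : Type u} [AddCommGroup V] [Module (SymGroupAlgebra k d) V]

variable (d V) in
/-- Multiplication by a scalar. -/
noncomputable def scale (a : k) : V →ₗ[SymGroupAlgebra k d] V where
  toFun x := (MonoidAlgebra.single 1 a : SymGroupAlgebra k d) • x
  map_add' := smul_add _
  map_smul' r x := by
    rw [RingHom.id_apply, smul_smul, smul_smul]
    congr 1
    exact Algebra.commutes a r

lemma scale_apply (a : k) (x : V) :
    scale d V a x = (MonoidAlgebra.single 1 a : SymGroupAlgebra k d) • x := rfl

lemma scale_scale_inv {a : k} (ha : a ≠ 0) (x : V) : scale d V a⁻¹ (scale d V a x) = x := by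
  rw [scale_apply, scale_apply, smul_smul, MonoidAlgebra.single_mul_single, inv_mul_cancel₀ ha,
    one_mul]
  exact one_smul _ x

lemma coe_scale {P : Submodule (SymGroupAlgebra k d) (WordSpace k d α)} (a : k) (c : P) (u) :
    (scale d P a c).1 u = a * c.1 u :=
  congrFun (WordSpace.single_one_smul a c.1) u

end Scale

/-- Substitution of letters, restricted to the words of content `κ`. -/
noncomputable def pull [Fintype β] (κ : β → ℕ) (h : β → α) :
    WordSpace k d α →ₗ[SymGroupAlgebra k d] WordSpace k d β :=
  homOfSingle
    { toFun := fun c v => if HasContent κ v then c (h ∘ v) else 0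
      map_zero' := by funext v; exact ite_self _
      map_add' := fun c c' => by
        funext v
        show (if _ then c (h ∘ v) + c' (h ∘ v) else 0) = (if _ then _ else _) + if _ then _ else _
        split_ifs
        · rfl
        · rw [add_zero] }
    (fun σ a c => by
      rw [WordSpace.single_smul, WordSpace.single_smul]
      funext v
      show (if HasContent κ v then a * c ((h ∘ v) ∘ σ) else 0) =
        a * if HasContent κ (v ∘ σ) then c (h ∘ v ∘ σ) else 0
      simp only [hasContent_comp_perm, mul_ite, mul_zero]
      rfl)

lemma pull_apply [Fintype β] (κ : β → ℕ) (h : β → α) (c : WordSpace k d α) (v : Fin d → β) :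
    pull κ h c v = if HasContent κ v then c (h ∘ v) else 0 := rfl

lemma pull_mem [Fintype β] (κ : β → ℕ) (h : β → α) (c : WordSpace k d α) :
    pull κ h c ∈ contentSpace k d κ := fun v hv => by
  by_contra hcon; exact hv (if_neg hcon)

lemma pull_id [Fintype α] {κ : α → ℕ} {c : WordSpace k d α} (hc : c ∈ contentSpace k d κ) :
    pull κ id c = c := by
  funext u
  rw [pull_apply]
  split_ifs with h
  · rfl
  · exact (not_not.1 (mt (mem_contentSpace.1 hc u) h)).symm

lemma HasContent.comp [Fintype α] {κ : α → ℕ} {κ' : β → ℕ} {g : α → β} {h : β → α}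
    (hκ : ∀ b, κ' b = ∑ a with g a = b, κ a) (hg : ∀ a, κ a ≠ 0 → h (g a) = a) {u : Fin d → α}
    (hu : HasContent κ u) : HasContent κ' (g ∘ u) ∧ h ∘ g ∘ u = u := by
  refine ⟨fun b => ?_, funext fun x => hg _ ?_⟩
  · rw [wcount_comp_left, hκ]
    exact Finset.sum_congr rfl fun a _ => hu a
  · rw [← hu, wcount]
    exact (Finset.card_pos.2 ⟨x, by simp⟩).ne'

variable [Fintype α] [Fintype β]

lemma isRetract_content {κ : α → ℕ} {κ' : β → ℕ} {g : α → β} {h : β → α}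
    (hκ : ∀ b, κ' b = ∑ a with g a = b, κ a) (hg : ∀ a, κ a ≠ 0 → h (g a) = a) :
    IsRetract (SymGroupAlgebra k d) (contentSpace k d κ) (contentSpace k d κ') := by
  refine ⟨(pull κ' h).restrict fun c _ => pull_mem κ' h c,
    (pull κ g).restrict fun c _ => pull_mem κ g c, LinearMap.ext fun c => Subtype.ext ?_⟩
  funext u
  show (if HasContent κ u then (if HasContent κ' (g ∘ u) then c.1 (h ∘ g ∘ u) else 0) else 0) =
    c.1 u
  by_cases hu : HasContent κ u
  · rw [if_pos hu, if_pos (hu.comp hκ hg).1, (hu.comp hκ hg).2]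
  · rw [if_neg hu, not_not.1 (mt (mem_contentSpace.1 c.2 u) hu)]

/-- Renaming the letters. -/
noncomputable def contentEquiv (e : α ≃ β) {κ : α → ℕ} {κ' : β → ℕ} (hκ : ∀ a, κ' (e a) = κ a) :
    contentSpace k d κ ≃ₗ[SymGroupAlgebra k d] contentSpace k d κ' :=
  have h1 : ∀ u : Fin d → α, HasContent κ u → HasContent κ' (e ∘ u) := fun u hu b => by
    obtain ⟨a, rfl⟩ := e.surjective b
    rw [wcount_injective_comp e.injective, hu, hκ]
  have h2 : ∀ v : Fin d → β, HasContent κ' v → HasContent κ (e.symm ∘ v) := fun v hv a => by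
    obtain ⟨b, rfl⟩ := e.symm.surjective a
    rw [wcount_injective_comp e.symm.injective, hv, ← hκ, e.apply_symm_apply]
  { (pull κ' e.symm).restrict fun c _ => pull_mem κ' e.symm c with
    invFun := (pull κ e).restrict fun c _ => pull_mem κ e c
    left_inv := fun c => by
      refine Subtype.ext (funext fun u => ?_)
      show (if HasContent κ u then (if HasContent κ' (e ∘ u) then c.1 (e.symm ∘ e ∘ u) else 0)
        else 0) = c.1 u
      by_cases hu : HasContent κ u
      · rw [if_pos hu, if_pos (h1 u hu), ← Function.comp_assoc, e.symm_comp_self, Function.id_comp]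
      · rw [if_neg hu, not_not.1 (mt (mem_contentSpace.1 c.2 u) hu)]
    right_inv := fun c => by
      refine Subtype.ext (funext fun v => ?_)
      show (if HasContent κ' v then (if HasContent κ (e.symm ∘ v) then c.1 (e ∘ e.symm ∘ v) else 0)
        else 0) = c.1 v
      by_cases hv : HasContent κ' v
      · rw [if_pos hv, if_pos (h2 v hv), ← Function.comp_assoc, e.self_comp_symm, Function.id_comp]
      · rw [if_neg hv, not_not.1 (mt (mem_contentSpace.1 c.2 v) hv)] }

section Alternating

variable {L : Type} [DecidableEq L] {m : ℕ}

/-- The alternating sum over the relabellings. -/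
noncomputable def alternate : WordSpace k d (L ⊕ Fin m) →ₗ[SymGroupAlgebra k d]
    WordSpace k d (L ⊕ Fin m) :=
  homOfSingle
    { toFun := fun c u => ∑ π, sgn k π * c (relabel π u)
      map_zero' := by
        funext u; exact Finset.sum_eq_zero fun π _ => mul_zero _
      map_add' := fun c c' => by
        funext u
        show ∑ π, sgn k π * (c (relabel π u) + c' (relabel π u)) = ∑ π, _ + ∑ π, _
        simp only [mul_add, Finset.sum_add_distrib] }
    (fun σ a c => by
      rw [WordSpace.single_smul, WordSpace.single_smul]
      funext u
      show ∑ π, sgn k π * (a * c (relabel π u ∘ σ)) = a * ∑ π, sgn k π * c (relabel π (u ∘ σ))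
      rw [Finset.mul_sum]
      exact Finset.sum_congr rfl fun π _ => by rw [relabel_comp]; ring)

lemma alternate_apply (c : WordSpace k d (L ⊕ Fin m)) (u) :
    alternate c u = ∑ π, sgn k π * c (relabel π u) := rfl

lemma alternate_mem {ν : L → ℕ} {c : WordSpace k d (L ⊕ Fin m)}
    (hc : c ∈ contentSpace k d (labelled ν m)) : alternate c ∈ Alt k d ν m := by
  refine mem_alt.2 ⟨fun u hu => ?_, fun π u => ?_⟩
  · rw [alternate_apply] at hu
    obtain ⟨π, -, h⟩ := Finset.exists_ne_zero_of_sum_ne_zero hu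
    exact hasContent_relabel.1 (mem_contentSpace.1 hc _ (right_ne_zero_of_mul h))
  · rw [alternate_apply, alternate_apply, ← Equiv.sum_comp (Equiv.mulRight π⁻¹), Finset.mul_sum]
    refine Finset.sum_congr rfl fun ρ _ => ?_
    rw [Equiv.coe_mulRight, ← relabel_mul, inv_mul_cancel_right, map_mul, sgn_inv]
    ring

lemma isRetract_alt_content (ν : L → ℕ) (hm : ((m.factorial : ℕ) : k) ≠ 0) :
    IsRetract (SymGroupAlgebra k d) (Alt k d ν m) (contentSpace k d (labelled ν m)) := by
  refine ⟨LinearMap.id.restrict fun c hc => (mem_alt.1 hc).1,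
    scale d _ ((m.factorial : k))⁻¹ ∘ₗ alternate.restrict fun c hc => alternate_mem hc,
    LinearMap.ext fun c => Subtype.ext (funext fun u => ?_)⟩
  rw [LinearMap.comp_apply, LinearMap.comp_apply, coe_scale]
  show _ * alternate c.1 u = c.1 u
  have h : ∀ π : Equiv.Perm (Fin m), sgn k π * c.1 (relabel π u) = c.1 u := fun π => by
    rw [(mem_alt.1 c.2).2, ← mul_assoc, sgn_mul_self, one_mul]
  simp only [alternate_apply, h, Finset.sum_const, Finset.card_univ, Fintype.card_perm,
    Fintype.card_fin, nsmul_eq_mul]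
  rw [inv_mul_cancel_left₀ hm]

lemma alt_eq_contentSpace (ν : L → ℕ) (hm : m ≤ 1) :
    Alt k d ν m = contentSpace k d (labelled ν m) := by
  have : Subsingleton (Equiv.Perm (Fin m)) := by
    have : Subsingleton (Fin m) := Fin.subsingleton_iff_le_one.2 hm
    infer_instance
  refine le_antisymm (fun c hc => (mem_alt.1 hc).1) fun c hc => mem_alt.2 ⟨hc, fun π u => ?_⟩
  rw [Subsingleton.elim π 1, relabel_one, map_one, one_mul]

end Alternating

section GroupAlgebra

/-- The map to the group algebra determined by a word. -/
noncomputable def toGroupAlgebra (u₀ : Fin d → α) :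
    WordSpace k d α →ₗ[SymGroupAlgebra k d] SymGroupAlgebra k d :=
  homOfSingle
    { toFun := fun c => ∑ σ : Equiv.Perm (Fin d), MonoidAlgebra.single σ (c (u₀ ∘ ⇑σ⁻¹))
      map_zero' := Finset.sum_eq_zero fun σ _ => MonoidAlgebra.single_zero _
      map_add' := fun c c' => by
        rw [← Finset.sum_add_distrib]
        exact Finset.sum_congr rfl fun σ _ => MonoidAlgebra.single_add _ _ _ }
    (fun τ a c => by
      rw [WordSpace.single_smul]
      show ∑ σ : Equiv.Perm (Fin d), MonoidAlgebra.single σ (a * c ((u₀ ∘ ⇑σ⁻¹) ∘ τ)) =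
        MonoidAlgebra.single τ a * ∑ σ : Equiv.Perm (Fin d), MonoidAlgebra.single σ (c (u₀ ∘ ⇑σ⁻¹))
      rw [Finset.mul_sum, ← Equiv.sum_comp (Equiv.mulLeft τ)]
      refine Finset.sum_congr rfl fun σ _ => ?_
      rw [Equiv.coe_mulLeft, MonoidAlgebra.single_mul_single]
      congr 3
      funext x
      simp)

lemma toGroupAlgebra_apply (u₀ : Fin d → α) (c : WordSpace k d α) :
    toGroupAlgebra u₀ c =
      ∑ σ : Equiv.Perm (Fin d), MonoidAlgebra.single σ (c (u₀ ∘ ⇑σ⁻¹)) := rfl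

/-- The map from the group algebra sending `1` to the indicator function of a word. -/
noncomputable def ofGroupAlgebra (u₀ : Fin d → α) :
    SymGroupAlgebra k d →ₗ[SymGroupAlgebra k d] WordSpace k d α :=
  LinearMap.toSpanSingleton _ _ (delta k u₀)

lemma ofGroupAlgebra_single (u₀ : Fin d → α) (σ : Equiv.Perm (Fin d)) (a : k) (w : Fin d → α) :
    ofGroupAlgebra u₀ (MonoidAlgebra.single σ a) w = if w = u₀ ∘ ⇑σ⁻¹ then a else 0 := by
  rw [ofGroupAlgebra, LinearMap.toSpanSingleton_apply, single_smul_delta]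
  show a * (if _ then 1 else 0) = _
  rw [mul_ite, mul_one, mul_zero]

lemma ofGroupAlgebra_mem {κ : α → ℕ} {u₀ : Fin d → α} (hu : HasContent κ u₀)
    (r : SymGroupAlgebra k d) : ofGroupAlgebra u₀ r ∈ contentSpace k d κ := by
  refine Submodule.smul_mem _ r fun u h => ?_
  by_cases h' : u = u₀
  · rwa [h']
  · exact absurd (if_neg h') h

lemma ofGroupAlgebra_toGroupAlgebra {κ : α → ℕ} {u₀ : Fin d → α} (hu : HasContent κ u₀)
    {c : WordSpace k d α} (hc : c ∈ contentSpace k d κ) (w : Fin d → α) :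
    ofGroupAlgebra u₀ (toGroupAlgebra u₀ c) w = ((∏ a, (κ a).factorial : ℕ) : k) * c w := by
  rw [toGroupAlgebra_apply, map_sum, WordSpace.sum_apply]
  simp only [ofGroupAlgebra_single]
  by_cases hw : HasContent κ w
  · obtain ⟨τ, hτ⟩ := exists_perm_of_wcount_eq (u := u₀) (v := w) fun a => (hu a).trans (hw a).symm
    have h1 : ∀ σ : Equiv.Perm (Fin d), (if w = u₀ ∘ ⇑σ⁻¹ then c (u₀ ∘ ⇑σ⁻¹) else 0) =
        if w = u₀ ∘ ⇑σ⁻¹ then c w else 0 := fun σ => by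
      split_ifs with h
      · rw [← h]
      · rfl
    simp only [h1]
    rw [← Finset.sum_filter, Finset.sum_const, nsmul_eq_mul]
    congr 2
    have h2 := DomMulAct.stabilizer_card u₀
    rw [Fintype.card_subtype] at h2
    rw [show (∏ a, (κ a).factorial) = ∏ a, (Fintype.card {x // u₀ x = a}).factorial from
      Finset.prod_congr rfl fun a _ => by rw [← hu a, Fintype.card_subtype]; rfl, ← h2]
    refine Finset.card_bij (fun σ _ => τ * σ) (fun σ hσ => ?_) (fun σ _ σ' _ h => mul_left_cancel h)
      fun σ hσ => ⟨τ⁻¹ * σ, ?_, by simp⟩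
    · simp only [Finset.mem_filter, Finset.mem_univ, true_and] at hσ ⊢
      rw [Equiv.Perm.coe_mul, ← Function.comp_assoc, hτ, hσ]
      funext x; simp
    · simp only [Finset.mem_filter, Finset.mem_univ, true_and] at hσ ⊢
      rw [← hτ]
      funext x
      show u₀ (τ x) = u₀ ((τ⁻¹ * σ)⁻¹ x)
      rw [mul_inv_rev, inv_inv]
      show u₀ (τ x) = u₀ (σ⁻¹ (τ x))
      have h4 := congrFun hσ (σ⁻¹ (τ x))
      rw [Function.comp_apply, ← Equiv.Perm.mul_apply σ, mul_inv_cancel] at h4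
      exact h4
  · rw [not_not.1 (mt (mem_contentSpace.1 hc w) hw), mul_zero]
    refine Finset.sum_eq_zero fun σ _ => if_neg fun h => hw ?_
    rw [h]
    exact (hasContent_comp_perm σ⁻¹).2 hu

lemma isRetract_content_groupAlgebra {κ : α → ℕ} (hκ : ((∏ a, (κ a).factorial : ℕ) : k) ≠ 0) :
    IsRetract (SymGroupAlgebra k d) (contentSpace k d κ) (SymGroupAlgebra k d) := by
  by_cases h : ∃ u : Fin d → α, HasContent κ u
  · obtain ⟨u, hu⟩ := h
    refine ⟨toGroupAlgebra u ∘ₗ (contentSpace k d κ).subtype,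
      scale d _ ((∏ a, (κ a).factorial : ℕ) : k)⁻¹ ∘ₗ (ofGroupAlgebra u).codRestrict _
        fun r => ofGroupAlgebra_mem hu r,
      LinearMap.ext fun c => Subtype.ext (funext fun w => ?_)⟩
    rw [LinearMap.comp_apply, LinearMap.comp_apply, coe_scale]
    show _ * ofGroupAlgebra u (toGroupAlgebra u c.1) w = c.1 w
    rw [ofGroupAlgebra_toGroupAlgebra hu c.2, inv_mul_cancel_left₀ hκ]
  · have : Subsingleton (contentSpace k d κ) := ⟨fun c c' => Subtype.ext (funext fun u => by
      have hu : ¬ HasContent κ u := fun h' => h ⟨u, h'⟩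
      rw [not_not.1 (mt (mem_contentSpace.1 c.2 u) hu),
        not_not.1 (mt (mem_contentSpace.1 c'.2 u) hu)])⟩
    exact IsRetract.of_subsingleton

/-- The regular module is the space of the words of a content without repetitions. -/
lemma nonempty_groupAlgebra_equiv {κ : α → ℕ} (hκ : ∀ a, κ a ≤ 1) {u : Fin d → α}
    (hu : HasContent κ u) :
    Nonempty (SymGroupAlgebra k d ≃ₗ[SymGroupAlgebra k d] contentSpace k d κ) := by
  have h1 : (∏ a, (κ a).factorial) = 1 := Finset.prod_eq_one fun a _ => by
    have := hκ a
    interval_cases κ a <;> rfl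
  have hinj : Function.Injective u := fun x y hxy => by
    have h2 := (hu (u x)).trans_le (hκ (u x))
    exact Finset.card_le_one.1 h2 x (by simp) y (by simp [hxy])
  refine ⟨LinearEquiv.ofBijective ((ofGroupAlgebra u).codRestrict _
        fun r => ofGroupAlgebra_mem hu r) ⟨?_, fun c => ?_⟩⟩
  · intro r r' hr
    refine MonoidAlgebra.ext (Finsupp.ext fun τ => ?_)
    have h2 : ∀ s : SymGroupAlgebra k d, ofGroupAlgebra u s (u ∘ ⇑τ⁻¹) = s.coeff τ := fun s => by
      induction s using MonoidAlgebra.induction_linear with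
      | zero => rw [map_zero]; rfl
      | add f g hf hg => rw [map_add, WordSpace.add_apply, hf, hg]; rfl
      | single σ a =>
        rw [ofGroupAlgebra_single, MonoidAlgebra.coeff_single, Finsupp.single_apply]
        refine if_congr ⟨fun h => ?_, fun h => by rw [h]⟩ rfl rfl
        exact (inv_injective (Equiv.ext fun x => hinj (congrFun h x))).symm
    rw [← h2 r, ← h2 r']
    exact congrFun (congrArg Subtype.val hr) _
  · refine ⟨toGroupAlgebra u c.1, Subtype.ext (funext fun w => ?_)⟩
    show ofGroupAlgebra u (toGroupAlgebra u c.1) w = c.1 w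
    rw [ofGroupAlgebra_toGroupAlgebra hu c.2, h1, Nat.cast_one, one_mul]

end GroupAlgebra

end Retracts

/-! ### Terms with a good resolution -/

section Terms

open Sum

variable {k : Type u} [Field k] {d p : ℕ} {α L : Type} [DecidableEq α] [Fintype α]
  [DecidableEq L] [Fintype L] {m : ℕ}

lemma subsingleton_contentSpace {κ : α → ℕ} (h : ∑ a, κ a ≠ d) :
    Subsingleton (contentSpace k d κ) := by
  have h1 : ∀ (c : contentSpace k d κ) u, c.1 u = 0 := fun c u => by
    by_contra hu
    refine h ?_
    rw [← sum_wcount u]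
    exact Finset.sum_congr rfl fun a _ => (mem_contentSpace.1 c.2 u hu a).symm
  exact ⟨fun c c' => Subtype.ext (funext fun u => by rw [h1, h1])⟩

lemma sum_labelled (ν : L → ℕ) (m : ℕ) : ∑ a, labelled ν m a = ∑ l, ν l + m := by
  simp [labelled, Fintype.sum_sum_type]

lemma subsingleton_alt_of_sum {ν : L → ℕ} (h : ∑ l, ν l + m ≠ d) :
    Subsingleton (Alt k d ν m) := by
  rw [← sum_labelled] at h
  have := subsingleton_contentSpace (k := k) h
  refine ⟨fun c c' => Subtype.ext ?_⟩
  have h1 := Subsingleton.elim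
    (⟨c.1, (mem_alt.1 c.2).1⟩ : contentSpace k d (labelled ν m)) ⟨c'.1, (mem_alt.1 c'.2).1⟩
  exact Subtype.mk.inj h1

lemma LQuot.subsingleton_of_subsingleton {V : Type u} [AddCommGroup V]
    [Module (SymGroupAlgebra k d) V] [Subsingleton V] :
    Subsingleton (LQuot (k := k) (d := d) p V) :=
  LQuot.subsingleton fun φ x => by rw [Subsingleton.elim x 0, map_zero]

lemma projective_content {κ : α → ℕ} (hκ : ((∏ a, (κ a).factorial : ℕ) : k) ≠ 0) :
    Module.Projective (LambdaAlgebra k p d) (LQuot (k := k) (d := d) p (contentSpace k d κ)) :=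
  ((LQuot.isRetract (isRetract_content_groupAlgebra hκ)).trans
    (.of_equiv LQuot.selfEquiv.symm)).projective

/-- Without labels, the alternating functions are all functions. -/
noncomputable def contentEquivAlt (ν : L → ℕ) :
    contentSpace k d ν ≃ₗ[SymGroupAlgebra k d] Alt k d ν 0 :=
  (contentEquiv (Equiv.sumEmpty L (Fin 0)).symm (κ' := labelled ν 0) fun _ => rfl).trans
    (LinearEquiv.ofEq _ _ (alt_eq_contentSpace ν zero_le_one).symm)

lemma isRetract_stage_succ (h2 : (2 : k) ≠ 0) {μ : L → ℕ} (hμ : ∑ l, μ l = d) {i : L}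
    (hi : (μ i : k) ≠ 0) {t : ℕ} (ht : p < t + 2) :
    IsRetract (LambdaAlgebra k p d) (LQuot (k := k) (d := d) p (Stage k d μ i (t + 1)))
      (LQuot (k := k) (d := d) p (Stage k d μ i t)) := by
  refine LQuot.isRetract_of_comp (stageMap hμ i t)
    (scale d _ ((μ i : k))⁻¹ ∘ₗ stageSplit k hμ i t) fun φ x => ?_
  have h1 : stageSplit k hμ i t (stageMap hμ i t x) =
      scale d _ (μ i : k) x - stageMap hμ i (t + 1) (stageSplit k hμ i (t + 1) x) := by
    refine Subtype.ext (funext fun u => ?_)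
    show (stageSplit k hμ i t (stageMap hμ i t x)).1 u = (scale d _ (μ i : k) x).1 u -
      (stageMap hμ i (t + 1) (stageSplit k hμ i (t + 1) x)).1 u
    rw [coe_scale, ← stageMap_stageSplit_add hμ i t x u, add_sub_cancel_left]
  have := subsingleton_alt (k := k) (d := d) (p := p) h2 (μ - Pi.single i (t + 1 + 1)) ht
  have h3 : ∀ y : Stage k d μ i (t + 2), (φ ∘ₗ stageMap hμ i (t + 1)) y = 0 := fun y => by
    rw [LQuot.mk_eq_iff.1 (Subsingleton.elim (LQuot.mk (k := k) (d := d) p y) (LQuot.mk p 0)),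
      map_zero]
  rw [LinearMap.comp_apply, h1, map_sub, map_sub, scale_scale_inv hi, sub_eq_self]
  rw [scale_apply, map_smul, ← LinearMap.comp_apply φ, h3, smul_zero]

lemma isRetract_alt_prime (h2 : (2 : k) ≠ 0) [CharP k p] (hp : p ≠ 0) {ν : L → ℕ}
    (hν : ∑ l, ν l + p = d) {i : L} (hi : ¬ p ∣ ν i) :
    IsRetract (LambdaAlgebra k p d) (LQuot (k := k) (d := d) p (Alt k d ν p))
      (LQuot (k := k) (d := d) p (Alt k d (ν + Pi.single i 1) (p - 1))) := by
  obtain ⟨t, rfl⟩ : ∃ t, p = t + 1 := ⟨p - 1, by omega⟩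
  have h1 := isRetract_stage_succ (k := k) (d := d) (p := t + 1) h2 (μ := ν + Pi.single i (t + 1))
    (by simpa [Finset.sum_add_distrib] using hν) (i := i) (t := t) (by
      rw [Pi.add_apply, Pi.single_eq_same, Nat.cast_add, CharP.cast_eq_zero k (t + 1), add_zero, Ne,
        CharP.cast_eq_zero_iff k (t + 1)]
      exact hi) (by omega)
  rw [Nat.add_sub_cancel]
  unfold Stage at h1
  rwa [add_tsub_cancel_right, show ν + Pi.single i (t + 1) - Pi.single i t = ν + Pi.single i 1 by
    rw [add_comm t, Pi.single_add, ← add_assoc, add_tsub_cancel_right]] at h1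

variable {A : Type*} [Ring A] {X X' : Type*} [AddCommGroup X] [Module A X] [AddCommGroup X']
  [Module A X'] {φ : X →ₗ[A] X'} {ψ : X' →ₗ[A] X}

lemma isRetract_ker (h : ∀ x, φ (ψ x) = x) : IsRetract A (LinearMap.ker φ) X :=
  ⟨(LinearMap.ker φ).subtype, (LinearMap.id - ψ ∘ₗ φ).codRestrict _ fun x => by simp [h],
    LinearMap.ext fun x => Subtype.ext (by simp)⟩

lemma nonempty_equiv_ker_prod (h : ∀ x, φ (ψ x) = x) :
    Nonempty (X ≃ₗ[A] LinearMap.ker φ × X') :=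
  ⟨LinearEquiv.ofLinearMap (((LinearMap.id - ψ ∘ₗ φ).codRestrict _ fun x => by simp [h]).prod φ)
    ((LinearMap.ker φ).subtype.coprod ψ)
    (LinearMap.ext fun ⟨x, y⟩ => Prod.ext (Subtype.ext (by simp [h])) (by simp [h]))
    (LinearMap.ext fun x => by simp)⟩

end Terms

section KerLQuot

variable {k : Type u} [Field k] {d p : ℕ} {V V' : Type u} [AddCommGroup V]
  [Module (SymGroupAlgebra k d) V] [AddCommGroup V'] [Module (SymGroupAlgebra k d) V']
  {φ : V →ₗ[SymGroupAlgebra k d] V'} {ψ : V' →ₗ[SymGroupAlgebra k d] V}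

lemma LQuot.map_map_apply (h : ∀ x, φ (ψ x) = x) (F : LQuot (k := k) (d := d) p V') :
    LQuot.map φ (LQuot.map ψ F) = F := by
  obtain ⟨x, rfl⟩ := LQuot.mk_surjective F
  rw [LQuot.map_mk, LQuot.map_mk, h]

/-- The kernel of a split epimorphism. -/
lemma LQuot.nonempty_ker_equiv (h : ∀ x, φ (ψ x) = x) :
    Nonempty (LinearMap.ker (LQuot.map (p := p) φ) ≃ₗ[LambdaAlgebra k p d]
      LQuot (k := k) (d := d) p (LinearMap.ker φ)) := by
  let ρ : V →ₗ[SymGroupAlgebra k d] LinearMap.ker φ :=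
    (LinearMap.id - ψ ∘ₗ φ).codRestrict _ fun x => by simp [h]
  have h1 : ∀ x : LinearMap.ker φ, ρ x = x := fun x => Subtype.ext (by simp [ρ])
  refine ⟨LinearEquiv.ofLinearMap (LQuot.map ρ ∘ₗ (LinearMap.ker (LQuot.map (p := p) φ)).subtype)
    ((LQuot.map (LinearMap.ker φ).subtype).codRestrict _ fun F => ?_)
    (LinearMap.ext fun F => ?_) (LinearMap.ext fun F => Subtype.ext ?_)⟩
  · obtain ⟨x, rfl⟩ := LQuot.mk_surjective F
    rw [LinearMap.mem_ker, LQuot.map_mk, LQuot.map_mk]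
    exact (congrArg _ x.2).trans LQuot.mk_zero
  · obtain ⟨x, rfl⟩ := LQuot.mk_surjective F
    exact congrArg (LQuot.mk p) (h1 x)
  · obtain ⟨F, hF⟩ := F
    obtain ⟨x, rfl⟩ := LQuot.mk_surjective F
    have h2 := congrArg (LQuot.map ψ) (LinearMap.mem_ker.1 hF)
    rw [map_zero, LQuot.map_mk, LQuot.map_mk, ← LQuot.mk_zero, LQuot.mk_eq_iff] at h2
    show LQuot.mk p (x - ψ (φ x)) = LQuot.mk p x
    exact LQuot.mk_eq_iff.2 fun θ => by rw [map_sub, h2, map_zero, sub_zero]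

end KerLQuot

/-! ### Good contents -/

section Good

open Sum

variable {k : Type u} [Field k] {p : ℕ}

lemma factorial_cast_ne_zero [CharP k p] (hp : p.Prime) {n : ℕ} (hn : n < p) :
    ((n.factorial : ℕ) : k) ≠ 0 := fun h => by
  rw [CharP.cast_eq_zero_iff k p, hp.dvd_factorial] at h
  omega

lemma sum_add_sum_eq_of_eqOn_compl {α : Type} [Fintype α] [DecidableEq α] (s : Finset α)
    {f g : α → ℕ} (h : ∀ a ∉ s, f a = g a) : ∑ a, f a + ∑ a ∈ s, g a = ∑ a, g a + ∑ a ∈ s, f a := by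
  rw [← Finset.sum_add_sum_compl s f, ← Finset.sum_add_sum_compl s g,
    Finset.sum_congr rfl fun a ha => h a (Finset.mem_compl.1 ha)]
  ring

lemma sum_labelled_sq {L : Type} [Fintype L] (ν : L → ℕ) (m : ℕ) :
    ∑ a, labelled ν m a ^ 2 = ∑ l, ν l ^ 2 + m := by
  simp [labelled, Fintype.sum_sum_type]

lemma sum_sub_single {L : Type} [Fintype L] [DecidableEq L] {κ : L → ℕ} {i : L} {s : ℕ}
    (h : s ≤ κ i) : ∑ l, (κ - Pi.single i s : L → ℕ) l + s = ∑ l, κ l := by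
  have h1 : κ = κ - Pi.single i s + Pi.single i s := by
    funext l
    by_cases hl : l = i
    · subst hl; simp [h]
    · simp [hl]
  conv_rhs => rw [h1]
  simp [Finset.sum_add_distrib]

variable {Y : Type u} [AddCommGroup Y]

theorem relRes_content [CharP k p] (hp : p.Prime) (hp3 : 3 ≤ p)
    [Module (LambdaAlgebra k p (2 * p)) Y]
    (hY : IsRetract (LambdaAlgebra k p (2 * p)) Y (TensorSpace k p (2 * p)))
    {α : Type} [Fintype α] [DecidableEq α] (κ : α → ℕ) (hκ : ∑ a, κ a = 2 * p)
    (hg : ∃ a, ¬ p ∣ κ a) :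
    RelRes (LambdaAlgebra k p (2 * p)) Y
      (LQuot (k := k) (d := 2 * p) p (contentSpace k (2 * p) κ)) := by
  induction hn : ∑ a, κ a ^ 2 using Nat.strong_induction_on generalizing α with
  | _ n ih =>
  have h2 : (2 : k) ≠ 0 := fun h => by
    have h3 : ((2 : ℕ) : k) = 0 := by exact_mod_cast h
    rw [CharP.cast_eq_zero_iff k p] at h3
    have := Nat.le_of_dvd two_pos h3
    omega
  by_cases hs : ∀ a, κ a < p
  · refine .of_projective (projective_content ?_)
    rw [Nat.cast_prod]
    exact Finset.prod_ne_zero_iff.2 fun a _ => factorial_cast_ne_zero hp (hs a)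
  push Not at hs
  obtain ⟨i, hi⟩ := hs
  have key : ∀ s, 0 < s → s < p → ∀ ν : α → ℕ, ∑ a, ν a + s = 2 * p →
      ∑ a, ν a ^ 2 + s < ∑ a, κ a ^ 2 → RelRes (LambdaAlgebra k p (2 * p)) Y
        (LQuot (k := k) (d := 2 * p) p (Alt k (2 * p) ν s)) := by
    intro s hs0 hsp ν hν hlt
    refine RelRes.of_isRetract (ih _ ?_ (labelled ν s) ?_ ⟨inr ⟨0, hs0⟩, ?_⟩ rfl)
      (LQuot.isRetract (isRetract_alt_content ν (factorial_cast_ne_zero hp hsp)))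
    · rwa [sum_labelled_sq, ← hn]
    · rwa [sum_labelled]
    · show ¬ p ∣ 1
      exact fun h => by have := Nat.le_of_dvd one_pos h; omega
  have H := (homExact_stage (k := k) (p := p) h2 hκ (i := i) (by omega)).of_isRetract hY
  have h0 := H.relRes fun t => ?_
  · refine h0.of_isRetract (LQuot.isRetract (.of_equiv ?_))
    have h1 : κ - Pi.single i 0 = κ := by rw [Pi.single_zero, tsub_zero]
    rw [Stage, h1]
    exact contentEquivAlt κ
  · rcases lt_trichotomy (t + 1) p with ht | ht | ht
    · refine key (t + 1) (by omega) ht _ ?_ ?_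
      · rw [sum_sub_single (by omega), hκ]
      · have h1 := sum_add_sum_eq_of_eqOn_compl {i}
          (f := fun a => (κ - Pi.single i (t + 1) : α → ℕ) a ^ 2)
          (g := fun a => κ a ^ 2) (fun a ha => by
            simp [show a ≠ i by simpa using ha])
        rw [Finset.sum_singleton, Finset.sum_singleton] at h1
        have h3 : (κ - Pi.single i (t + 1) : α → ℕ) i = κ i - (t + 1) := by simp
        rw [h3] at h1
        obtain ⟨r, hr⟩ : ∃ r, κ i = r + (t + 1) + 1 := ⟨κ i - (t + 1) - 1, by omega⟩
        rw [hr, show r + (t + 1) + 1 - (t + 1) = r + 1 by omega] at h1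
        nlinarith
    · obtain ⟨a, ha⟩ := hg
      have h3 : ¬ p ∣ (κ - Pi.single i p : α → ℕ) a := by
        by_cases hai : a = i
        · subst hai
          rw [Pi.sub_apply, Pi.single_eq_same]
          intro h
          exact ha ((Nat.dvd_sub_iff_left hi dvd_rfl).1 h)
        · simpa [hai] using ha
      have h4 : ∑ l, (κ - Pi.single i p : α → ℕ) l + p = 2 * p := by rw [sum_sub_single hi, hκ]
      have h5 := isRetract_alt_prime (k := k) h2 hp.ne_zero h4 h3
      suffices h : ∀ s, p = s → RelRes (LambdaAlgebra k p (2 * p)) Y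
        (LQuot (k := k) (d := 2 * p) p (Stage k (2 * p) κ i s)) from h _ ht.symm
      rintro _ rfl
      refine RelRes.of_isRetract (key (p - 1) (by omega) (by omega) _ ?_ ?_) h5
      · have h6 : ∑ l, (κ - Pi.single i p + Pi.single a 1 : α → ℕ) l =
            ∑ l, (κ - Pi.single i p : α → ℕ) l + 1 := by
          simp [Finset.sum_add_distrib]
        omega
      · obtain ⟨q, rfl⟩ : ∃ q, p = q + 1 := ⟨p - 1, by omega⟩
        obtain ⟨r, hr⟩ : ∃ r, κ i = r + (q + 1) := ⟨κ i - (q + 1), by omega⟩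
        have h6 := sum_add_sum_eq_of_eqOn_compl {i, a}
          (f := fun l => (κ - Pi.single i (q + 1) + Pi.single a 1 : α → ℕ) l ^ 2)
          (g := fun l => κ l ^ 2) (fun l hl => by
            rw [Finset.mem_insert, Finset.mem_singleton, not_or] at hl
            simp [hl.1, hl.2])
        by_cases hai : a = i
        · subst hai
          have h7 : (κ - Pi.single a (q + 1) + Pi.single a 1 : α → ℕ) a = r + 1 := by simp [hr]
          rw [Finset.pair_eq_singleton, Finset.sum_singleton, Finset.sum_singleton, h7, hr] at h6
          rw [Nat.add_sub_cancel]
          nlinarith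
        · have h7 : (κ - Pi.single i (q + 1) + Pi.single a 1 : α → ℕ) i = r := by
            simp [hr, Ne.symm hai]
          have h8 : (κ - Pi.single i (q + 1) + Pi.single a 1 : α → ℕ) a = κ a + 1 := by simp [hai]
          have h9 : κ i + κ a ≤ 2 * (q + 1) := by
            rw [← hκ, ← Finset.sum_pair (Ne.symm hai)]
            exact Finset.sum_le_sum_of_subset (Finset.subset_univ _)
          have h10 : κ a ≠ q + 1 := fun h => ha ⟨1, by rw [h, mul_one]⟩
          have h11 : κ a ≤ q := by omega
          rw [Finset.sum_pair (Ne.symm hai), Finset.sum_pair (Ne.symm hai), h7, h8, hr] at h6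
          rw [Nat.add_sub_cancel]
          nlinarith
    · have : Subsingleton (LQuot (k := k) (d := 2 * p) p (Stage k (2 * p) κ i (t + 1))) :=
        subsingleton_alt h2 _ ht
      exact .of_projective inferInstance

end Good

/-! ### The complement of the trivial summands -/

section Reduced

variable {k : Type u} [Field k] {p d : ℕ} {α : Type} [DecidableEq α] [Fintype α]

lemma sum_comp_perm {M : Type*} [AddCommMonoid M] (σ : Equiv.Perm (Fin d)) (f : (Fin d → α) → M) :
    ∑ u, f (u ∘ σ) = ∑ u, f u :=
  (Equiv.arrowCongr σ⁻¹ (Equiv.refl α)).sum_comp f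

lemma sum_content_comp_perm {M : Type*} [AddCommMonoid M] (κ : α → ℕ) (σ : Equiv.Perm (Fin d))
    (f : (Fin d → α) → M) :
    ∑ u with HasContent κ u, f (u ∘ σ) = ∑ u with HasContent κ u, f u := by
  rw [Finset.sum_filter, Finset.sum_filter,
    ← sum_comp_perm σ fun u => if HasContent κ u then f u else 0]
  exact Finset.sum_congr rfl fun u _ => if_congr (hasContent_comp_perm σ).symm rfl rfl

/-- The sum of the values at the words of content `κ`. -/
noncomputable def contentSum (κ : α → ℕ) : WordSpace k d α →+ k where
  toFun c := ∑ u with HasContent κ u, c u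
  map_zero' := Finset.sum_const_zero
  map_add' _ _ := Finset.sum_add_distrib

lemma contentSum_eq {κ : α → ℕ} (c : WordSpace k d α) :
    contentSum κ c = ∑ u, if HasContent κ u then c u else 0 :=
  Finset.sum_filter _ _

lemma contentSum_single (κ : α → ℕ) (σ : Equiv.Perm (Fin d)) (a : k) (c : WordSpace k d α) :
    contentSum κ (fun u => a * c (u ∘ σ) : WordSpace k d α) = a * contentSum κ c :=
  (Finset.mul_sum _ _ _).symm.trans (congrArg _ (sum_content_comp_perm κ σ c))

lemma contentSum_of_mem {κ : α → ℕ} {c : WordSpace k d α} (hc : c ∈ contentSpace k d κ) :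
    contentSum κ c = ∑ u, c u :=
  Finset.sum_filter_of_ne fun u _ hu => mem_contentSpace.1 hc u hu

lemma contentSum_of_ne {κ κ' : α → ℕ} {c : WordSpace k d α} (hc : c ∈ contentSpace k d κ)
    (h : κ' ≠ κ) : contentSum κ' c = 0 := by
  refine Finset.sum_eq_zero fun u hu => ?_
  by_contra hcu
  refine h (funext fun a => ?_)
  rw [← (Finset.mem_filter.1 hu).2 a, mem_contentSpace.1 hc u hcu a]

variable (k p d) in
/-- The functions on words whose sums over the words of a content divisible by `p` are zero. -/
noncomputable def Reduced (α : Type) [DecidableEq α] [Fintype α] :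
    Submodule (SymGroupAlgebra k d) (WordSpace k d α) :=
  wordSubmodule (fun c => ∀ κ : α → ℕ, (∀ a, p ∣ κ a) → contentSum κ c = 0)
    (fun _ _ => map_zero _)
    (fun c c' h h' κ hκ => by rw [map_add, h κ hκ, h' κ hκ, add_zero])
    (fun σ a c h κ hκ => by rw [contentSum_single, h κ hκ, mul_zero])

variable (k p d) in
/-- The part of content `κ` of the space `Reduced`. -/
noncomputable def Piece (κ : α → ℕ) : Submodule (SymGroupAlgebra k d) (WordSpace k d α) :=
  contentSpace k d κ ⊓ Reduced k p d α

lemma mem_piece {κ : α → ℕ} {c : WordSpace k d α} : c ∈ Piece k p d κ ↔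
    c ∈ contentSpace k d κ ∧ ((∀ a, p ∣ κ a) → ∑ u, c u = 0) := by
  refine and_congr_right fun hc => ⟨fun h hκ => ?_, fun h κ' hκ' => ?_⟩
  · rw [← contentSum_of_mem hc, h κ hκ]
  · by_cases hκ : κ' = κ
    · subst hκ
      rw [contentSum_of_mem hc, h hκ']
    · exact contentSum_of_ne hc hκ

lemma piece_eq_contentSpace {κ : α → ℕ} (hκ : ∃ a, ¬ p ∣ κ a) :
    Piece k p d κ = contentSpace k d κ := by
  ext c
  rw [mem_piece, and_iff_left_iff_imp]
  exact fun _ h => absurd h (not_forall.2 hκ)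

lemma pull_id_mem_piece (κ : α → ℕ) {c : WordSpace k d α} (hc : c ∈ Reduced k p d α) :
    pull κ id c ∈ Piece k p d κ := by
  refine mem_piece.2 ⟨pull_mem κ id c, fun hκ => ?_⟩
  rw [← hc κ hκ, contentSum_eq]
  rfl

lemma isRetract_piece (κ : α → ℕ) :
    IsRetract (SymGroupAlgebra k d) (Piece k p d κ) (Reduced k p d α) :=
  ⟨LinearMap.id.restrict fun _ hc => hc.2, (pull κ id).restrict fun _ hc => pull_id_mem_piece κ hc,
    LinearMap.ext fun c => Subtype.ext (pull_id c.2.1)⟩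

lemma memAdd_content {κ : α → ℕ} (hκ : ∃ a, ¬ p ∣ κ a) :
    MemAdd (LambdaAlgebra k p d) (LQuot (k := k) (d := d) p (Reduced k p d α))
      (LQuot (k := k) (d := d) p (contentSpace k d κ)) := by
  rw [← piece_eq_contentSpace (k := k) (d := d) hκ]
  exact (MemAdd.self _ _).of_isRetract (LQuot.isRetract (isRetract_piece κ))

variable (d α) in
/-- The contents of the words. -/
def contents : Finset (α → ℕ) := (Finset.univ : Finset (Fin d → α)).image wcount

lemma mem_contents {κ : α → ℕ} : κ ∈ contents d α ↔ ∃ u : Fin d → α, HasContent κ u := by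
  simp only [contents, Finset.mem_image, Finset.mem_univ, true_and, funext_iff, HasContent]

lemma sum_contents {M : Type*} [AddCommMonoid M] (u : Fin d → α) (x : M) :
    ∑ κ ∈ contents d α, (if HasContent κ u then x else 0) = x := by
  rw [Finset.sum_eq_single (wcount u), if_pos (show HasContent (wcount u) u from fun _ => rfl)]
  · exact fun κ _ hκ => if_neg fun h => hκ (funext fun a => (h a).symm)
  · exact fun h => absurd (mem_contents.2 ⟨u, fun _ => rfl⟩) h

lemma isRetract_reduced : ∃ (n : ℕ) (κ : Fin n → α → ℕ), (∀ j, ∑ a, κ j a = d) ∧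
    IsRetract (LambdaAlgebra k p d) (LQuot (k := k) (d := d) p (Reduced k p d α))
      (∀ j, LQuot (k := k) (d := d) p (Piece k p d (κ j))) := by
  let e := (contents d α).equivFin.symm
  refine ⟨_, fun j => (e j).1, fun j => ?_,
    LinearMap.pi fun j => LQuot.map
      ((pull (e j).1 id).restrict fun _ hc => pull_id_mem_piece _ hc),
    ∑ j, LQuot.map (LinearMap.id.restrict fun _ hc => (Submodule.mem_inf.1 hc).2) ∘ₗ
      LinearMap.proj j, ?_⟩
  · obtain ⟨u, hu⟩ := mem_contents.1 (e j).2
    exact (Finset.sum_congr rfl fun a _ => (hu a).symm).trans (sum_wcount u)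
  · refine LinearMap.ext fun F => ?_
    obtain ⟨c, rfl⟩ := LQuot.mk_surjective F
    rw [LinearMap.comp_apply, LinearMap.sum_apply]
    let mkHom : Reduced k p d α →+ LQuot (k := k) (d := d) p (Reduced k p d α) :=
      ⟨⟨LQuot.mk p, LQuot.mk_zero⟩, LQuot.mk_add⟩
    show ∑ j, mkHom ⟨pull (e j).1 id c.1, (pull_id_mem_piece _ c.2).2⟩ = mkHom c
    rw [← map_sum]
    refine congrArg mkHom (Subtype.ext (funext fun u => ?_))
    rw [AddSubmonoidClass.coe_finsetSum, WordSpace.sum_apply]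
    exact (e.sum_comp fun κ : contents d α => if HasContent κ.1 u then c.1 u else 0).trans
      ((Finset.sum_coe_sort (contents d α) fun κ => if HasContent κ u then c.1 u else 0).trans
        (sum_contents u _))

end Reduced

section Splitting

variable {k : Type u} [Field k] {p d : ℕ}

section

variable {X X' : Type*} [AddCommGroup X] [Module (LambdaAlgebra k p d) X]
  [AddCommGroup X'] [Module (LambdaAlgebra k p d) X']

/-- An additive map commuting with the images of the monomials is linear. -/
noncomputable def lambdaHomOfSingle (f : X →+ X')
    (h : ∀ (σ : Equiv.Perm (Fin d)) (a : k) (x : X),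
      f (toLambda k p d (MonoidAlgebra.single σ a) • x) =
        toLambda k p d (MonoidAlgebra.single σ a) • f x) :
    X →ₗ[LambdaAlgebra k p d] X' where
  toFun := f
  map_add' := f.map_add
  map_smul' r x := by
    rw [RingHom.id_apply]
    obtain ⟨r, rfl⟩ := toLambda_surjective r
    induction r using MonoidAlgebra.induction_linear with
    | zero => rw [map_zero, zero_smul, zero_smul]; exact f.map_zero
    | add r s hr hs =>
      rw [map_add, add_smul, add_smul, ← hr, ← hs]
      exact f.map_add _ _
    | single σ a => exact h σ a x

end

lemma TrivialModule.single_smul [NeZero p] (σ : Equiv.Perm (Fin d)) (a : k)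
    (x : TrivialModule k p d) :
    toLambda k p d (MonoidAlgebra.single σ a) • x = (HMul.hMul (α := k) (β := k) a x : k) := by
  show HMul.hMul (α := k) (β := k) (augmentation k d (MonoidAlgebra.single σ a)) x = _
  rw [augmentation, MonoidAlgebra.lift_single]
  simp

lemma card_content_mul {α : Type} [DecidableEq α] [Fintype α] {κ : α → ℕ} {u₀ : Fin d → α}
    (hu : HasContent κ u₀) :
    (Finset.univ.filter fun u : Fin d → α => HasContent κ u).card * ∏ a, (κ a).factorial =
      d.factorial := by
  have h1 : ((Finset.univ.filter fun u : Fin d → α => HasContent κ u).card : ℚ) *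
      ((∏ a, (κ a).factorial : ℕ) : ℚ) = d.factorial := by
    let c : WordSpace ℚ d α := fun u => if HasContent κ u then 1 else 0
    have hc : c ∈ contentSpace ℚ d κ := fun u h => by
      by_contra h'; exact h (if_neg h')
    have h2 := fun w => ofGroupAlgebra_toGroupAlgebra hu hc w
    have h3 : ∑ w, ofGroupAlgebra u₀ (toGroupAlgebra u₀ c) w = d.factorial := by
      simp only [toGroupAlgebra_apply, map_sum, WordSpace.sum_apply, ofGroupAlgebra_single]
      rw [Finset.sum_comm]
      simp only [Finset.sum_ite_eq', Finset.mem_univ, if_true]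
      have h4 : ∀ σ : Equiv.Perm (Fin d), c (u₀ ∘ ⇑σ⁻¹) = 1 := fun σ =>
        if_pos ((hasContent_comp_perm σ⁻¹).2 hu)
      simp only [h4]
      simp [Fintype.card_perm]
    rw [← h3]
    simp only [h2]
    rw [← Finset.mul_sum, mul_comm]
    congr 1
    simp
  exact_mod_cast h1

lemma card_content_ne_zero [CharP k p] (hp : p.Prime) (hp3 : 3 ≤ p) {α : Type} [DecidableEq α]
    [Fintype α] {κ : α → ℕ} (hκ : ∀ a, p ∣ κ a) {u₀ : Fin (2 * p) → α} (hu : HasContent κ u₀) :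
    ((Finset.univ.filter fun u : Fin (2 * p) → α => HasContent κ u).card : k) ≠ 0 := by
  rw [Ne, CharP.cast_eq_zero_iff k p]
  intro h
  choose ν hν using hκ
  have h1 : ∑ a, ν a = 2 := by
    refine Nat.eq_of_mul_eq_mul_left hp.pos ?_
    rw [Finset.mul_sum, mul_comm p 2, ← sum_wcount u₀]
    exact Finset.sum_congr rfl fun a _ => by rw [hu a, hν]
  have h2 : p ^ 2 ∣ ∏ a, (κ a).factorial := by
    rw [← h1, ← Finset.prod_pow_eq_pow_sum]
    refine Finset.prod_dvd_prod_of_dvd _ _ fun a _ => ?_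
    have h3 := Nat.prod_factorial_dvd_factorial_sum (Finset.range (ν a)) fun _ => p
    rw [Finset.prod_const, Finset.sum_const, Finset.card_range, smul_eq_mul, mul_comm,
      ← hν] at h3
    exact (pow_dvd_pow_of_dvd (Nat.dvd_factorial hp.pos le_rfl) _).trans h3
  have h3 := mul_dvd_mul h h2
  rw [card_content_mul hu, ← pow_succ'] at h3
  have : Fact p.Prime := ⟨hp⟩
  rw [padicValNat_dvd_iff_le (Nat.factorial_ne_zero _), mul_comm, padicValNat_factorial_mul,
    padicValNat.eq_zero_of_not_dvd fun h => by
      have := Nat.le_of_dvd two_pos h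
      omega] at h3
  omega

end Splitting

section Splitting

variable {k : Type u} [Field k] {p d : ℕ} [NeZero p]

/-- The sum over the words of content `κ`, as a homomorphism to the trivial module. -/
noncomputable def contentSumHom (κ : Fin p → ℕ) :
    TensorSpace k p d →ₗ[LambdaAlgebra k p d] TrivialModule k p d :=
  lambdaHomOfSingle (contentSum (k := k) (d := d) κ : WordSpace k d (Fin p) →+ k) fun σ a x => by
    rw [TrivialModule.single_smul, toLambda_smul, TensorSpace.single_smul]
    exact contentSum_single κ σ a x

/-- The multiples of the indicator function of the words of content `κ`. -/
noncomputable def indicatorHom {α : Type} [DecidableEq α] [Fintype α] (κ : α → ℕ) (a : k) :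
    k →+ WordSpace k d α where
  toFun x u := if HasContent κ u then a * x else 0
  map_zero' := funext fun u => by rw [mul_zero]; exact ite_self _
  map_add' x y := funext fun u => by
    show (if _ then a * (x + y) else 0) = (if _ then _ else _) + if _ then _ else _
    rw [mul_add]
    split_ifs
    · rfl
    · rw [add_zero]

lemma indicatorHom_mem {α : Type} [DecidableEq α] [Fintype α] (κ : α → ℕ) (a x : k) :
    indicatorHom κ a x ∈ contentSpace k d κ := fun u hu => by
  by_contra h; exact hu (if_neg h)

lemma contentSum_indicatorHom {α : Type} [DecidableEq α] [Fintype α] (κ : α → ℕ) (a x : k) :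
    contentSum κ (indicatorHom (d := d) κ a x) =
      (Finset.univ.filter fun u : Fin d → α => HasContent κ u).card * (a * x) := by
  refine (Finset.sum_congr rfl fun u hu => if_pos (Finset.mem_filter.1 hu).2).trans ?_
  rw [Finset.sum_const, nsmul_eq_mul]

/-- The multiples of the indicator function of the words of content `κ`, as the image of the
trivial module. -/
noncomputable def spread (κ : Fin p → ℕ) (a : k) :
    TrivialModule k p d →ₗ[LambdaAlgebra k p d] TensorSpace k p d :=
  lambdaHomOfSingle (indicatorHom (d := d) κ a : k →+ WordSpace k d (Fin p)) fun σ b x => by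
    rw [TrivialModule.single_smul, toLambda_smul, TensorSpace.single_smul]
    funext u
    have h1 : ∀ y : k, (if HasContent κ u then a * (b * y) else 0) =
        b * if HasContent κ (u ∘ σ) then a * y else 0 := fun y => by
      simp only [hasContent_comp_perm, mul_ite, mul_zero, mul_left_comm]
    exact h1 x

/-- Tensor space is the sum of trivial modules, one for each content divisible by `p`, and
of the module obtained from `Reduced`. -/
theorem nonempty_tensorSpace_equiv {n : ℕ} {κ : Fin n → Fin p → ℕ} (hinj : Function.Injective κ)
    (hκ : ∀ j a, p ∣ κ j a)
    (hne : ∀ j, ((Finset.univ.filter fun u : Fin d → Fin p => HasContent (κ j) u).card : k) ≠ 0)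
    (hall : ∀ κ' : Fin p → ℕ, (∀ a, p ∣ κ' a) → (∃ u : Fin d → Fin p, HasContent κ' u) →
      ∃ j, κ j = κ') :
    Nonempty (TensorSpace k p d ≃ₗ[LambdaAlgebra k p d]
      (Fin n → TrivialModule k p d) × LQuot (k := k) (d := d) p (Reduced k p d (Fin p))) := by
  let N : Fin n → k := fun j =>
    (Finset.univ.filter fun u : Fin d → Fin p => HasContent (κ j) u).card
  let s : TensorSpace k p d →ₗ[LambdaAlgebra k p d] (Fin n → TrivialModule k p d) :=
    LinearMap.pi fun j => contentSumHom (κ j)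
  have hs : ∀ f j, s f j = contentSum (k := k) (d := d) (κ j) f := fun _ _ => rfl
  let E : (Fin n → TrivialModule k p d) →ₗ[LambdaAlgebra k p d] TensorSpace k p d :=
    ∑ j, spread (κ j) (N j)⁻¹ ∘ₗ LinearMap.proj j
  have hsE : ∀ x, s (E x) = x := fun x => by
    funext j
    rw [hs, LinearMap.sum_apply]
    refine (map_sum (contentSum (k := k) (d := d) (κ j))
      (fun j' => indicatorHom (d := d) (κ j') (N j')⁻¹ (x j')) Finset.univ).trans
      ((Finset.sum_eq_single j (fun j' _ hj' => contentSum_of_ne (indicatorHom_mem _ _ _)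
        fun h => hj' (hinj h).symm) fun h => absurd (Finset.mem_univ _) h).trans ?_)
    exact (contentSum_indicatorHom _ _ _).trans (mul_inv_cancel_left₀ (hne j) _)
  have hmem : ∀ f : TensorSpace k p d,
      (f : WordSpace k d (Fin p)) ∈ Reduced k p d (Fin p) ↔ s f = 0 := fun f => by
    refine ⟨fun h => funext fun j => h _ (hκ j), fun h κ' hκ' => ?_⟩
    by_cases hu : ∃ u : Fin d → Fin p, HasContent κ' u
    · obtain ⟨j, rfl⟩ := hall κ' hκ' hu
      exact congrFun h j
    · exact Finset.sum_eq_zero fun u h => absurd ⟨u, (Finset.mem_filter.1 h).2⟩ hu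
  have hsub : ∀ f, s (f - E (s f)) = 0 := fun f => by rw [map_sub, hsE, sub_self]
  let π : TensorSpace k p d →ₗ[SymGroupAlgebra k d] Reduced k p d (Fin p) :=
    { toFun := fun f => ⟨tensorEquiv k p d (f - E (s f)), (hmem _).2 (hsub f)⟩
      map_add' := fun f f' => Subtype.ext (map_add (LinearMap.id - E ∘ₗ s) f f')
      map_smul' := fun r f => Subtype.ext (map_smul (LinearMap.id - E ∘ₗ s) (toLambda k p d r) f) }
  let ι : Reduced k p d (Fin p) →ₗ[SymGroupAlgebra k d] TensorSpace k p d :=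
    (tensorEquiv k p d).symm.toLinearMap ∘ₗ (Reduced k p d (Fin p)).subtype
  have hι : ∀ c, s (ι c) = 0 := fun c => (hmem _).1 c.2
  have hιπ : ∀ f, s f = 0 → ι (π f) = f := fun f hf => by
    show f - E (s f) = f
    rw [hf, map_zero, sub_zero]
  have hπι : ∀ c, π (ι c) = c := fun c => Subtype.ext (hιπ _ (hι c))
  let e : LinearMap.ker s ≃ₗ[LambdaAlgebra k p d]
      LQuot (k := k) (d := d) p (Reduced k p d (Fin p)) :=
    LinearEquiv.ofLinearMap (LQuot.ofTensor π ∘ₗ (LinearMap.ker s).subtype)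
      ((LQuot.eval ι).codRestrict _ fun F => by
        obtain ⟨c, rfl⟩ := LQuot.mk_surjective F
        exact hι c)
      (LinearMap.ext fun F => by
        obtain ⟨c, rfl⟩ := LQuot.mk_surjective F
        exact congrArg (LQuot.mk p) (hπι c))
      (LinearMap.ext fun f => Subtype.ext (hιπ _ f.2))
  obtain ⟨e'⟩ := nonempty_equiv_ker_prod hsE
  exact ⟨(e'.trans (e.prodCongr (.refl _ _))).trans (LinearEquiv.prodComm _ _ _)⟩

theorem exists_tensorSpace_equiv [CharP k p] (hp : p.Prime) (hp3 : 3 ≤ p) :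
    ∃ n, 0 < n ∧ Nonempty (TensorSpace k p (2 * p) ≃ₗ[LambdaAlgebra k p (2 * p)]
      (Fin n → TrivialModule k p (2 * p)) ×
        LQuot (k := k) (d := 2 * p) p (Reduced k p (2 * p) (Fin p))) := by
  let B := (contents (2 * p) (Fin p)).filter fun κ => ∀ a, p ∣ κ a
  refine ⟨B.card, ?_, nonempty_tensorSpace_equiv (κ := fun j => (B.equivFin.symm j).1)
    (Subtype.val_injective.comp B.equivFin.symm.injective)
    (fun j => (Finset.mem_filter.1 (B.equivFin.symm j).2).2) (fun j => ?_) fun κ hκ hu => ?_⟩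
  · refine Finset.card_pos.2 ⟨wcount fun _ => 0, Finset.mem_filter.2
      ⟨mem_contents.2 ⟨_, fun _ => rfl⟩, fun a => ?_⟩⟩
    rw [wcount]
    by_cases h : 0 = a
    · simp [h]
    · simp [h]
  · have h1 := Finset.mem_filter.1 (B.equivFin.symm j).2
    obtain ⟨u, hu⟩ := mem_contents.1 h1.1
    exact card_content_ne_zero hp hp3 h1.2 hu
  · exact ⟨B.equivFin ⟨κ, Finset.mem_filter.2 ⟨mem_contents.2 hu, hκ⟩⟩, by simp⟩

theorem isRetract_tensorSpace [CharP k p] (hp : p.Prime) (hp3 : 3 ≤ p) :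
    IsRetract (LambdaAlgebra k p (2 * p))
      (LQuot (k := k) (d := 2 * p) p (Reduced k p (2 * p) (Fin p))) (TensorSpace k p (2 * p)) := by
  obtain ⟨n, -, ⟨e⟩⟩ := exists_tensorSpace_equiv (k := k) hp hp3
  refine ⟨e.symm.toLinearMap ∘ₗ LinearMap.inr _ _ _, LinearMap.snd _ _ _ ∘ₗ e.toLinearMap,
    LinearMap.ext fun x => ?_⟩
  simp

end Splitting

/-! ### Fusing two letters -/

section Fuse

open Sum

variable {k : Type u} [Field k] {d p : ℕ} {L : Type} [DecidableEq L] {m t : ℕ} {i j : L}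

/-- Replacing the letter `j` by the letter `i`. -/
def fuseLetter (i j : L) (m : ℕ) : L ⊕ Fin m → L ⊕ Fin m :=
  Sum.map (fun l => if l = j then i else l) id

/-- Replacing the letter `j` by the letter `i` in a word. -/
def fuse (i j : L) (u : Fin d → L ⊕ Fin m) : Fin d → L ⊕ Fin m := fuseLetter i j m ∘ u

lemma fuse_comp_perm (u : Fin d → L ⊕ Fin m) (σ : Equiv.Perm (Fin d)) :
    fuse i j (u ∘ σ) = fuse i j u ∘ σ := rfl

lemma fuse_relabel (π : Equiv.Perm (Fin m)) (u : Fin d → L ⊕ Fin m) :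
    fuse i j (relabel π u) = relabel π (fuse i j u) := by
  funext x; rcases h : u x <;> simp [fuse, fuseLetter, relabel, h]

lemma fuse_ins (x : Fin d) (u : Fin d → L ⊕ Fin m) : fuse i j (ins x u) = ins x (fuse i j u) := by
  funext y
  by_cases hy : y = x
  · simp [ins, hy, fuse, fuseLetter]
  · rcases h : u y <;> simp [ins, hy, fuse, fuseLetter, h]

lemma fuse_low_zero (u : Fin d → L ⊕ Fin (m + 1)) :
    fuse i j (low i 0 u) = low i 0 (fuse i j u) := by
  funext x
  rcases h : u x with l | s
  · simp [low, fuse, fuseLetter, h]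
  · simp only [low, fuse, fuseLetter, h, Function.comp, elim_inr, Sum.map_inr, id]
    induction Equiv.swap 0 0 s using Fin.cases <;> simp

lemma fuse_eq_inr {u : Fin d → L ⊕ Fin m} {x : Fin d} {s : Fin m} :
    fuse i j u x = inr s ↔ u x = inr s := by
  rcases h : u x <;> simp [fuse, fuseLetter, h]

lemma fuse_eq_inl_self {u : Fin d → L ⊕ Fin m} {x : Fin d} :
    fuse i j u x = inl i ↔ u x = inl i ∨ u x = inl j := by
  rcases h : u x with l | s
  · simp only [fuse, fuseLetter, Function.comp, h, Sum.map_inl, Sum.inl.injEq]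
    split_ifs with hl
    · simp [hl]
    · simp [hl]
  · simp [fuse, fuseLetter, h]

lemma fuse_eq_inl_of_ne {u : Fin d → L ⊕ Fin m} {x : Fin d} {l : L} (hi : l ≠ i) (hj : l ≠ j) :
    fuse i j u x = inl l ↔ u x = inl l := by
  rcases h : u x with a | s
  · simp only [fuse, fuseLetter, Function.comp, h, Sum.map_inl, Sum.inl.injEq]
    split_ifs with ha
    · simp [ha, hi.symm, hj.symm]
    · rfl
  · simp [fuse, fuseLetter, h]

lemma fuse_ne_inl_right (hij : i ≠ j) {u : Fin d → L ⊕ Fin m} {x : Fin d} :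
    fuse i j u x ≠ inl j := by
  rcases h : u x with a | s
  · simp only [fuse, fuseLetter, Function.comp, h, Sum.map_inl, Ne, Sum.inl.injEq]
    split_ifs with ha
    · exact hij
    · exact ha
  · simp [fuse, fuseLetter, h]

/-- The multiplicities after replacing the letter `j` by the letter `i`. -/
def fused (i j : L) (μ : L → ℕ) (l : L) : ℕ :=
  if l = i then μ i + μ j else if l = j then 0 else μ l

lemma fused_self (μ : L → ℕ) : fused i j μ i = μ i + μ j := if_pos rfl

lemma fused_right (hij : i ≠ j) (μ : L → ℕ) : fused i j μ j = 0 :=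
  (if_neg hij.symm).trans (if_pos rfl)

lemma fused_of_ne {l : L} (hi : l ≠ i) (hj : l ≠ j) (μ : L → ℕ) : fused i j μ l = μ l :=
  (if_neg hi).trans (if_neg hj)

lemma sum_fused [Fintype L] (hij : i ≠ j) (μ : L → ℕ) : ∑ l, fused i j μ l = ∑ l, μ l := by
  have hj : j ∈ Finset.univ.erase i := Finset.mem_erase.2 ⟨hij.symm, Finset.mem_univ _⟩
  rw [← Finset.add_sum_erase _ _ (Finset.mem_univ i), ← Finset.add_sum_erase _ _ hj,
    ← Finset.add_sum_erase _ _ (Finset.mem_univ i), ← Finset.add_sum_erase _ _ hj, fused_self,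
    fused_right hij, zero_add, add_assoc]
  congr 2
  refine Finset.sum_congr rfl fun l hl => ?_
  simp only [Finset.mem_erase, Finset.mem_univ, and_true] at hl
  exact fused_of_ne hl.2 hl.1 μ

lemma wcount_fuse_self (hij : i ≠ j) (u : Fin d → L ⊕ Fin m) :
    wcount (fuse i j u) (inl i) = wcount u (inl i) + wcount u (inl j) := by
  unfold wcount
  simp only [fuse_eq_inl_self]
  rw [Finset.filter_or, Finset.card_union_of_disjoint]
  rw [Finset.disjoint_filter]
  intro x _ h h'
  exact hij (Sum.inl_injective (h.symm.trans h'))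

lemma IsStage.fuse (hij : i ≠ j) {μ : L → ℕ} {u : Fin d → L ⊕ Fin t} (hu : IsStage μ i t u) :
    IsStage (fused i j μ) i t (fuse i j u) where
  other l hl := by
    rcases eq_or_ne l j with rfl | hj
    · rw [fused_right hij, wcount, Finset.card_eq_zero]
      exact Finset.filter_eq_empty_iff.2 fun x _ => fuse_ne_inl_right hij
    · rw [fused_of_ne hl hj, ← hu.other l hl]
      simp only [wcount, fuse_eq_inl_of_ne hl hj]
  same := by
    rw [wcount_fuse_self hij, fused_self, ← hu.same, ← hu.other j hij.symm]; omega
  label s := by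
    rw [← hu.label s]; simp only [wcount, fuse_eq_inr]

variable [Fintype L]

variable (k d m) in
/-- The sum over the fibres of `fuse`. -/
noncomputable def push (i j : L) :
    WordSpace k d (L ⊕ Fin m) →ₗ[SymGroupAlgebra k d] WordSpace k d (L ⊕ Fin m) :=
  kernelHom (fun u w => if fuse i j u = w then 1 else 0) fun σ u w => by
    simp only [fuse_comp_perm, σ.surjective.injective_comp_right.eq_iff]

lemma push_apply (c : WordSpace k d (L ⊕ Fin m)) (w : Fin d → L ⊕ Fin m) :
    push k d m i j c w = ∑ u with fuse i j u = w, c u := by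
  refine Eq.trans (Finset.sum_congr rfl fun u _ => ?_) (Finset.sum_filter _ _).symm
  exact (ite_mul _ _ _ _).trans (by rw [one_mul, zero_mul])

lemma push_relabel {c : WordSpace k d (L ⊕ Fin m)}
    (hc : ∀ π u, c (relabel π u) = sgn k π * c u) (π : Equiv.Perm (Fin m)) (w) :
    push k d m i j c (relabel π w) = sgn k π * push k d m i j c w := by
  rw [push_apply, push_apply]
  refine Eq.trans ?_ (Finset.mul_sum _ _ _).symm
  refine Finset.sum_bij' (fun u _ => relabel π⁻¹ u) (fun u _ => relabel π u) ?_ ?_ ?_ ?_ ?_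
  · intro u hu
    simp only [Finset.mem_filter, Finset.mem_univ, true_and] at hu ⊢
    rw [fuse_relabel, hu, relabel_inv_relabel]
  · intro u hu
    simp only [Finset.mem_filter, Finset.mem_univ, true_and] at hu ⊢
    rw [fuse_relabel, hu]
  · intro u _; exact relabel_relabel_inv π u
  · intro u _; exact relabel_inv_relabel π u
  · intro u _
    rw [hc, sgn_inv, ← mul_assoc, sgn_mul_self, one_mul]

lemma sum_fuse_ins (f : (Fin d → L ⊕ Fin (m + 1)) → k) (w : Fin d → L ⊕ Fin m) :
    ∑ u with fuse i j u = w, ∑ x with u x = inl i, f (ins x u) =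
      ∑ x with w x = inl i, ∑ u with fuse i j u = ins x w, f u := by
  rw [Finset.sum_sigma', Finset.sum_sigma']
  have key : ∀ {x : Fin d} {u' : Fin d → L ⊕ Fin (m + 1)}, fuse i j u' = ins x w →
      ∀ y, u' y = inr 0 ↔ y = x := fun {x u'} h y => by
    rw [← fuse_eq_inr (i := i) (j := j), h, ins_eq_zero]
  have key' : ∀ {x : Fin d} {u' : Fin d → L ⊕ Fin (m + 1)}, fuse i j u' = ins x w →
      ins x (low i 0 u') = u' := fun {x u'} h => by
    rw [ins_low_self (key h), Equiv.swap_self]; exact relabel_one _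
  refine Finset.sum_bij' (fun a _ => ⟨a.2, ins a.2 a.1⟩) (fun a _ => ⟨low i 0 a.2, a.1⟩)
    ?_ ?_ ?_ ?_ ?_
  · rintro ⟨u, x⟩ h
    simp only [Finset.mem_sigma, Finset.mem_filter, Finset.mem_univ, true_and] at h ⊢
    obtain ⟨rfl, h⟩ := h
    exact ⟨fuse_eq_inl_self.2 (Or.inl h), fuse_ins x u⟩
  · rintro ⟨x, u'⟩ h
    simp only [Finset.mem_sigma, Finset.mem_filter, Finset.mem_univ, true_and] at h ⊢
    exact ⟨by rw [fuse_low_zero, h.2, low_zero_ins h.1],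
      low_eq_inl.2 (Or.inr ((key h.2 x).2 rfl))⟩
  · rintro ⟨u, x⟩ h
    simp only [Finset.mem_sigma, Finset.mem_filter, Finset.mem_univ, true_and] at h
    exact Sigma.ext (low_zero_ins h.2) (heq_of_eq rfl)
  · rintro ⟨x, u'⟩ h
    simp only [Finset.mem_sigma, Finset.mem_filter, Finset.mem_univ, true_and] at h
    exact Sigma.ext rfl (heq_of_eq (key' h.2))
  · rintro ⟨u, x⟩ h
    rfl

lemma push_merge (c : WordSpace k d (L ⊕ Fin (m + 1))) :
    push k d m i j (merge k d m i c) = merge k d m i (push k d (m + 1) i j c) :=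
  funext fun w => (push_apply _ w).trans <| (sum_fuse_ins c w).trans <|
    Finset.sum_congr rfl fun _ _ => (push_apply c _).symm

/-- The map of the complexes induced by `push`. -/
noncomputable def pushStage {μ : L → ℕ} (hμ : ∑ l, μ l = d) (hij : i ≠ j) (t : ℕ) :
    Stage k d μ i t →ₗ[SymGroupAlgebra k d] Stage k d (fused i j μ) i t :=
  (push k d t i j).restrict fun c hc => by
    rw [mem_alt_stage hμ] at hc
    rw [mem_alt_stage ((sum_fused hij μ).trans hμ)]
    refine ⟨fun w hw => ?_, push_relabel hc.2⟩
    obtain ⟨u, hu, hu'⟩ := Finset.exists_ne_zero_of_sum_ne_zero ((push_apply c w).symm.trans_ne hw)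
    rw [← (Finset.mem_filter.1 hu).2]
    exact (hc.1 u hu').fuse hij

/-- Pulling back along `fuse`. -/
noncomputable def pullStage (μ : L → ℕ) (i j : L) (t : ℕ) :
    Stage k d (fused i j μ) i t →ₗ[SymGroupAlgebra k d] Stage k d μ i t :=
  (pull (labelled (μ - Pi.single i t) t) (fuseLetter i j t)).restrict fun c hc =>
    mem_alt.2 ⟨fun u hu => by_contra fun h => hu ((pull_apply _ _ _ _).trans (if_neg h)),
      fun π u => by
      rw [pull_apply, pull_apply, mul_ite, mul_zero]
      refine if_congr hasContent_relabel ?_ rfl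
      exact (congrArg c (fuse_relabel π u)).trans ((mem_alt.1 hc).2 π _)⟩

lemma pushStage_stageMap {μ : L → ℕ} (hμ : ∑ l, μ l = d) (hij : i ≠ j) (t : ℕ)
    (c : Stage k d μ i (t + 1)) : pushStage hμ hij t (stageMap hμ i t c) =
      stageMap ((sum_fused hij μ).trans hμ) i t (pushStage hμ hij (t + 1) c) :=
  Subtype.ext (push_merge c.1)

lemma card_fuse_fiber {μ : L → ℕ} (hij : i ≠ j) {w : Fin d → L ⊕ Fin t}
    (hw : IsStage (fused i j μ) i t w) (ht : t ≤ μ i) (P : (Fin d → L ⊕ Fin t) → Prop)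
    [DecidablePred P] (hP : ∀ u, P u ↔ IsStage μ i t u) :
    ((Finset.univ.filter fun u => fuse i j u = w).filter P).card =
      (μ i + μ j - t).choose (μ j) := by
  have h1 : (Finset.univ.filter fun x => w x = inl i).card = μ i + μ j - t := by
    have := hw.same
    rw [fused_self, wcount] at this
    omega
  have hwj : ∀ x, w x ≠ inl j := by
    have h2 := hw.other j hij.symm
    rw [fused_right hij, wcount, Finset.card_eq_zero, Finset.filter_eq_empty_iff] at h2
    exact fun x => h2 (Finset.mem_univ x)
  rw [← h1, ← Finset.card_powersetCard]
  refine Finset.card_bij' (fun u _ => Finset.univ.filter fun x => u x = inl j)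
    (fun S _ x => if x ∈ S then inl j else w x) ?_ ?_ ?_ ?_
  · intro u hu
    simp only [Finset.mem_filter, Finset.mem_univ, true_and, hP] at hu
    obtain ⟨rfl, hu⟩ := hu
    rw [Finset.mem_powersetCard]
    refine ⟨fun x hx => ?_, hu.other j hij.symm⟩
    simp only [Finset.mem_filter, Finset.mem_univ, true_and] at hx ⊢
    exact fuse_eq_inl_self.2 (Or.inr hx)
  · intro S hS
    rw [Finset.mem_powersetCard] at hS
    have hS1 : ∀ x ∈ S, w x = inl i := fun x hx => by simpa using hS.1 hx
    have h3 : fuse i j (fun x => if x ∈ S then inl j else w x) = w := by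
      funext x
      by_cases hx : x ∈ S
      · rw [hS1 x hx, fuse_eq_inl_self]; simp [hx]
      · rcases h : w x with l | s
        · have hl : l ≠ j := fun e => hwj x (by rw [h, e])
          simp [fuse, fuseLetter, hx, h, hl]
        · simp [fuse, fuseLetter, hx, h]
    simp only [Finset.mem_filter, Finset.mem_univ, true_and, hP]
    refine ⟨h3, ?_⟩
    have h4 : wcount (fun x => if x ∈ S then inl j else w x) (inl j) = μ j := by
      rw [wcount, ← hS.2]
      congr 1; ext x
      by_cases hx : x ∈ S <;> simp [hx, hwj x]
    refine ⟨fun l hl => ?_, ?_, fun s => ?_⟩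
    · rcases eq_or_ne l j with rfl | hj
      · exact h4
      · rw [← fused_of_ne hl hj μ, ← hw.other l hl]
        conv_rhs => rw [← h3]
        simp only [wcount, fuse_eq_inl_of_ne hl hj]
    · have h5 := wcount_fuse_self hij (fun x => if x ∈ S then inl j else w x)
      have h6 := hw.same
      rw [h3, h4] at h5
      rw [fused_self] at h6
      omega
    · rw [← hw.label s]
      conv_rhs => rw [← h3]
      simp only [wcount, fuse_eq_inr]
  · intro u hu
    simp only [Finset.mem_filter, Finset.mem_univ, true_and, hP] at hu
    obtain ⟨rfl, hu⟩ := hu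
    funext x
    by_cases hx : u x = inl j
    · simp [hx]
    · rcases h : u x with l | s
      · have hl : l ≠ j := fun e => hx (by rw [h, e])
        simp [h, fuse, fuseLetter, hl]
      · simp [h, fuse, fuseLetter]
  · intro S hS
    ext x
    by_cases hx : x ∈ S <;> simp [hx, hwj x]

lemma pushStage_pullStage {μ : L → ℕ} (hμ : ∑ l, μ l = d) (hij : i ≠ j) (ht : t ≤ μ i)
    (c : Stage k d (fused i j μ) i t) : pushStage hμ hij t (pullStage μ i j t c) =
      scale d _ (((μ i + μ j - t).choose (μ j) : ℕ) : k) c := by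
  refine Subtype.ext (funext fun w => ?_)
  rw [coe_scale]
  have hμ' := (sum_fused hij μ).trans hμ
  refine (push_apply (pullStage μ i j t c).1 w).trans ?_
  by_cases hw : IsStage (fused i j μ) i t w
  · have h1 : ∀ u ∈ Finset.univ.filter (fun u => fuse i j u = w), (pullStage μ i j t c).1 u =
        if HasContent (labelled (μ - Pi.single i t) t) u then c.1 w else 0 := fun u hu => by
      rw [← (Finset.mem_filter.1 hu).2]; rfl
    rw [Finset.sum_congr rfl h1, ← Finset.sum_filter, Finset.sum_const,
      card_fuse_fiber hij hw ht _ fun u => hasContent_iff_isStage hμ, nsmul_eq_mul]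
  · rw [not_not.1 (mt (((mem_alt_stage hμ').1 c.2).1 w) hw), mul_zero]
    refine Finset.sum_eq_zero fun u hu => if_neg fun h => hw ?_
    rw [← (Finset.mem_filter.1 hu).2]
    exact ((hasContent_iff_isStage hμ).1 h).fuse hij

lemma pushStage_injective {μ : L → ℕ} (hμ : ∑ l, μ l = d) (hij : i ≠ j) :
    Function.Injective (pushStage (k := k) hμ hij (μ i)) := by
  rw [injective_iff_map_eq_zero]
  intro c hc
  have hc' := (mem_alt_stage hμ).1 c.2
  refine Subtype.ext (funext fun u => ?_)
  by_contra hu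
  have hno : ∀ {v : Fin d → L ⊕ Fin (μ i)}, IsStage μ i (μ i) v → ∀ x, v x ≠ inl i :=
    fun {v} hv x hx => by
    have h1 := hv.same
    have : 0 < wcount v (inl i) := Finset.card_pos.2 ⟨x, by simpa using hx⟩
    omega
  have hst := hc'.1 u hu
  have h1 : push k d (μ i) i j c.1 (fuse i j u) = 0 := congrFun (congrArg Subtype.val hc) _
  refine hu ((Finset.sum_eq_single u ?_ ?_).symm.trans ((push_apply c.1 _).symm.trans h1))
  · intro v hv hvu
    by_contra hv0
    have hst' := hc'.1 v hv0
    refine hvu (funext fun x => ?_)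
    have h2 : fuse i j v x = fuse i j u x := congrFun (Finset.mem_filter.1 hv).2 x
    by_cases hj : u x = inl j
    · rw [fuse_eq_inl_self.2 (Or.inr hj), fuse_eq_inl_self] at h2
      rw [hj]; exact h2.resolve_left (hno hst' x)
    · rcases h : u x with l | s
      · have hl : l ≠ j := fun e => hj (by rw [h, e])
        have hl' : l ≠ i := fun e => hno hst x (by rw [h, e])
        rw [(fuse_eq_inl_of_ne hl' hl).2 h, fuse_eq_inl_of_ne hl' hl] at h2
        exact h2
      · rw [fuse_eq_inr.2 h, fuse_eq_inr] at h2
        exact h2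
  · simp

end Fuse

/-! ### The complex of a divisible content -/

section FuseComplex

open Sum

variable {k : Type u} [Field k] {p : ℕ}

lemma two_ne_zero_of_three_le [CharP k p] (hp3 : 3 ≤ p) : (2 : k) ≠ 0 := fun h => by
  have h1 := (CharP.cast_eq_zero_iff k p 2).1 (by exact_mod_cast h)
  exact absurd (Nat.le_of_dvd two_pos h1) (by omega)

lemma choose_cast_ne_zero [CharP k p] (hp : p.Prime) (hp3 : 3 ≤ p) {t : ℕ} (ht : t ≤ p) :
    (((p + p - t).choose p : ℕ) : k) ≠ 0 := by
  rw [Ne, CharP.cast_eq_zero_iff k p]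
  have := Fact.mk hp
  have h1 : (p + p - t).choose p ≡ (p + p - t) / p [MOD p] := by
    have h2 := Choose.choose_modEq_choose_mod_mul_choose_div_nat (p := p) (n := p + p - t) (k := p)
    rwa [Nat.mod_self, Nat.choose_zero_right, one_mul, Nat.div_self hp.pos,
      Nat.choose_one_right] at h2
  rw [h1.dvd_iff dvd_rfl]
  have h3 : 1 ≤ (p + p - t) / p := (Nat.one_le_div_iff hp.pos).2 (by omega)
  have h4 : (p + p - t) / p < 3 := (Nat.div_lt_iff_lt_mul hp.pos).2 (by omega)
  exact fun h => absurd (Nat.le_of_dvd h3 h) (by omega)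

variable {L : Type} [DecidableEq L] [Fintype L] {μ : L → ℕ} {i j : L}

section Kernel

/-- The terms of the kernel of the map of complexes induced by `push`. -/
noncomputable abbrev FuseKer (k : Type u) [Field k] (hμ : ∑ l, μ l = 2 * p) (hij : i ≠ j) (t : ℕ) :
    Submodule (LambdaAlgebra k p (2 * p))
      (LQuot (k := k) (d := 2 * p) p (Stage k (2 * p) μ i t)) :=
  LinearMap.ker (LQuot.map (p := p) (pushStage (k := k) hμ hij t))

variable [CharP k p]

lemma exists_pushStage_section (hμ : ∑ l, μ l = 2 * p) (hij : i ≠ j) (hp : p.Prime) (hp3 : 3 ≤ p)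
    (hi : μ i = p) (hj : μ j = p) {t : ℕ} (ht : t ≤ p) :
    ∃ ψ : Stage k (2 * p) (fused i j μ) i t →ₗ[SymGroupAlgebra k (2 * p)] Stage k (2 * p) μ i t,
      ∀ x, pushStage hμ hij t (ψ x) = x := by
  refine ⟨pullStage μ i j t ∘ₗ scale (2 * p) _ (((p + p - t).choose p : ℕ) : k)⁻¹, fun x => ?_⟩
  have h1 := pushStage_pullStage (k := k) hμ hij (ht.trans_eq hi.symm)
    (scale (2 * p) _ (((p + p - t).choose p : ℕ) : k)⁻¹ x)
  rw [hi, hj] at h1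
  refine h1.trans ?_
  have h2 := choose_cast_ne_zero (k := k) hp hp3 ht
  exact (congrArg (fun a => scale (2 * p) _ a _) (inv_inv _).symm).trans
    (scale_scale_inv (inv_ne_zero h2) x)

lemma exists_map_pushStage_section (hμ : ∑ l, μ l = 2 * p) (hij : i ≠ j) (hp : p.Prime)
    (hp3 : 3 ≤ p) (hi : μ i = p) (hj : μ j = p) (t : ℕ) :
    ∃ ψ : LQuot (k := k) (d := 2 * p) p (Stage k (2 * p) (fused i j μ) i t)
        →ₗ[LambdaAlgebra k p (2 * p)] LQuot (k := k) (d := 2 * p) p (Stage k (2 * p) μ i t),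
      ∀ x, LQuot.map (pushStage hμ hij t) (ψ x) = x := by
  rcases le_or_gt t p with ht | ht
  · obtain ⟨ψ, hψ⟩ := exists_pushStage_section (k := k) hμ hij hp hp3 hi hj ht
    exact ⟨LQuot.map ψ, LQuot.map_map_apply hψ⟩
  · have := subsingleton_alt (k := k) (d := 2 * p) (p := p) (two_ne_zero_of_three_le hp3)
      (fused i j μ - Pi.single i t) ht
    exact ⟨0, fun x => Subsingleton.elim _ _⟩

lemma exists_homExact_fuseKer (hμ : ∑ l, μ l = 2 * p) (hij : i ≠ j) (hp : p.Prime)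
    (hp3 : 3 ≤ p) (hi : μ i = p) (hj : μ j = p) : ∃ δ, HomExact (A := LambdaAlgebra k p (2 * p))
      (TensorSpace k p (2 * p)) (fun t => FuseKer k hμ hij t) δ := by
  have h2 := two_ne_zero_of_three_le (k := k) hp3
  choose ψ hψ using exists_map_pushStage_section (k := k) hμ hij hp hp3 hi hj
  have H := homExact_stage (k := k) (p := p) h2 hμ (hi.symm ▸ hp.pos : 0 < μ i)
  have H' := homExact_stage (k := k) (p := p) (i := i) h2 ((sum_fused hij μ).trans hμ)
    (by rw [fused_self, hi]; have := hp.pos; omega)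
  exact ⟨_, H.ker H' (φ := fun t => LQuot.map (pushStage hμ hij t)) (fun t x => by
    obtain ⟨x, rfl⟩ := LQuot.mk_surjective x
    simp only [LQuot.map_mk, pushStage_stageMap]) ψ hψ⟩

lemma isRetract_fuseKer (hμ : ∑ l, μ l = 2 * p) (hij : i ≠ j) (hp : p.Prime)
    (hp3 : 3 ≤ p) (hi : μ i = p) (hj : μ j = p) (t : ℕ) :
    IsRetract (LambdaAlgebra k p (2 * p)) (FuseKer k hμ hij t)
      (LQuot (k := k) (d := 2 * p) p (Stage k (2 * p) μ i t)) := by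
  obtain ⟨ψ, hψ⟩ := exists_map_pushStage_section (k := k) hμ hij hp hp3 hi hj t
  exact isRetract_ker hψ

lemma subsingleton_fuseKer (hμ : ∑ l, μ l = 2 * p) (hij : i ≠ j) (hp : p.Prime)
    (hp3 : 3 ≤ p) (hi : μ i = p) (hj : μ j = p) {t : ℕ} (ht : p ≤ t) :
    Subsingleton (FuseKer k hμ hij t) := by
  rcases ht.eq_or_lt with ht | ht
  · obtain rfl : μ i = t := hi.trans ht
    obtain ⟨ψ, hψ⟩ := exists_pushStage_section (k := k) hμ hij hp hp3 hi hj hi.le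
    obtain ⟨e⟩ := LQuot.nonempty_ker_equiv (p := p) hψ
    have h1 : Subsingleton (LinearMap.ker (pushStage (k := k) hμ hij (μ i))) := by
      rw [LinearMap.ker_eq_bot.2 (pushStage_injective hμ hij)]
      infer_instance
    have h2 := LQuot.subsingleton_of_subsingleton (k := k) (d := 2 * p) (p := p)
      (V := LinearMap.ker (pushStage (k := k) hμ hij (μ i)))
    exact e.toEquiv.subsingleton
  · have := subsingleton_alt (k := k) (d := 2 * p) (p := p) (two_ne_zero_of_three_le hp3)
      (μ - Pi.single i t) ht
    exact Subtype.val_injective.subsingleton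

lemma sum_contentEquiv {d : ℕ} {α β : Type} [DecidableEq α] [Fintype α] [DecidableEq β]
    [Fintype β] (e : α ≃ β) {κ : α → ℕ} {κ' : β → ℕ} (hκ : ∀ a, κ' (e a) = κ a)
    (c : contentSpace k d κ) : ∑ v, (contentEquiv e hκ c).1 v = ∑ u, c.1 u := by
  obtain ⟨c, rfl⟩ := (contentEquiv e hκ).symm.surjective c
  rw [LinearEquiv.apply_symm_apply]
  refine (Fintype.sum_equiv ((Equiv.refl (Fin d)).arrowCongr e) _ _ fun u => ?_).symm
  show (if HasContent κ u then c.1 (e ∘ u) else 0) = c.1 (e ∘ u)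
  refine ite_eq_left_iff.2 fun hu => (not_not.1 fun h => hu fun a => ?_)
  rw [← wcount_injective_comp e.injective, mem_contentSpace.1 c.2 _ (Ne.symm h), hκ]

lemma sum_contentEquivAlt {d : ℕ} (ν : L → ℕ) (c : contentSpace k d ν) :
    ∑ u, (contentEquivAlt ν c).1 u = ∑ u, c.1 u :=
  sum_contentEquiv (Equiv.sumEmpty L (Fin 0)).symm (κ' := labelled ν 0) (fun _ => rfl) c

lemma exists_contentEquivStage {d : ℕ} (μ : L → ℕ) (i : L) :
    ∃ e : contentSpace k d μ ≃ₗ[SymGroupAlgebra k d] Stage k d μ i 0,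
      ∀ c, ∑ u, (e c).1 u = ∑ u, c.1 u := by
  unfold Stage
  rw [Pi.single_zero, tsub_zero]
  exact ⟨contentEquivAlt μ, sum_contentEquivAlt μ⟩

lemma pushStage_zero_eq_zero_iff (hμ : ∑ l, μ l = 2 * p) (hij : i ≠ j)
    (hi : μ i = p) (hj : μ j = p) (c : Stage k (2 * p) μ i 0) :
    pushStage hμ hij 0 c = 0 ↔ ∑ u, c.1 u = 0 := by
  have h1 : ∑ w, (pushStage hμ hij 0 c).1 w = ∑ u, c.1 u :=
    (Finset.sum_congr rfl fun w _ => push_apply c.1 w).trans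
      (Finset.sum_fiberwise Finset.univ (fuse i j) c.1)
  constructor
  · intro h
    rw [← h1, h]
    exact Finset.sum_eq_zero fun w _ => rfl
  · intro h
    have h2 := ((mem_alt_stage ((sum_fused hij μ).trans hμ)).1 (pushStage hμ hij 0 c).2).1
    have h3 : ∀ w, w ≠ (fun _ => inl i) → (pushStage hμ hij 0 c).1 w = 0 := fun w hw => by
      by_contra h0
      refine hw ?_
      have h4 := (h2 w h0).same
      rw [fused_self, hi, hj, add_zero, ← two_mul] at h4
      have h5 : (Finset.univ.filter fun x => w x = inl i) = Finset.univ :=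
        Finset.eq_univ_of_card _ (h4.trans (Fintype.card_fin _).symm)
      exact funext fun x => (Finset.filter_eq_self.1 h5) x (Finset.mem_univ x)
    refine Subtype.ext (funext fun w => ?_)
    by_cases hw : w = fun _ => inl i
    · rw [hw]
      exact (Finset.sum_eq_single _ (fun w _ => h3 w) (by simp)).symm.trans (h1.trans h)
    · exact h3 w hw

lemma nonempty_piece_equiv (hμ : ∑ l, μ l = 2 * p) (hij : i ≠ j) (hμp : ∀ l, p ∣ μ l)
    (hi : μ i = p) (hj : μ j = p) :
    Nonempty (Piece k p (2 * p) μ ≃ₗ[SymGroupAlgebra k (2 * p)]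
      LinearMap.ker (pushStage (k := k) hμ hij 0)) := by
  obtain ⟨e, he⟩ := exists_contentEquivStage (k := k) (d := 2 * p) μ i
  have h1 : ∀ c : Piece k p (2 * p) μ,
      pushStage hμ hij 0 (e ⟨c.1, (mem_piece.1 c.2).1⟩) = 0 := fun c => by
    rw [pushStage_zero_eq_zero_iff hμ hij hi hj, he]
    exact (mem_piece.1 c.2).2 hμp
  have h2 : ∀ x : LinearMap.ker (pushStage (k := k) hμ hij 0),
      (e.symm x.1).1 ∈ Piece k p (2 * p) μ := fun x => by
    refine mem_piece.2 ⟨(e.symm x.1).2, fun _ => ?_⟩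
    rw [← he, e.apply_symm_apply, ← pushStage_zero_eq_zero_iff hμ hij hi hj]
    exact x.2
  have h3 : ∀ c : Piece k p (2 * p) μ, (e.symm (e ⟨c.1, (mem_piece.1 c.2).1⟩)).1 = c.1 := fun c =>
    by rw [e.symm_apply_apply]
  exact ⟨LinearEquiv.ofLinearMap
    ((e.toLinearMap ∘ₗ Submodule.inclusion fun c hc => (mem_piece.1 hc).1).codRestrict _ h1)
    (((contentSpace k (2 * p) μ).subtype ∘ₗ e.symm.toLinearMap ∘ₗ
      (LinearMap.ker (pushStage (k := k) hμ hij 0)).subtype).codRestrict _ h2)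
    (LinearMap.ext fun x => Subtype.ext (e.apply_symm_apply x.1))
    (LinearMap.ext fun c => Subtype.ext (h3 c))⟩

lemma nonempty_fuseKer_zero_equiv (hμ : ∑ l, μ l = 2 * p) (hij : i ≠ j) (hp : p.Prime)
    (hp3 : 3 ≤ p) (hi : μ i = p) (hj : μ j = p) (hμp : ∀ l, p ∣ μ l) :
    Nonempty (FuseKer k hμ hij 0 ≃ₗ[LambdaAlgebra k p (2 * p)]
      LQuot (k := k) (d := 2 * p) p (Piece k p (2 * p) μ)) := by
  obtain ⟨ψ, hψ⟩ := exists_pushStage_section (k := k) hμ hij hp hp3 hi hj (Nat.zero_le p)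
  obtain ⟨e⟩ := LQuot.nonempty_ker_equiv (p := p) hψ
  obtain ⟨e'⟩ := nonempty_piece_equiv (k := k) hμ hij hμp hi hj
  exact ⟨e.trans (LQuot.congr (k := k) (d := 2 * p) (p := p)
    (V := LinearMap.ker (pushStage (k := k) hμ hij 0)) (V' := Piece k p (2 * p) μ) e'.symm)⟩

end Kernel

end FuseComplex

/-! ### The complement has a good resolution -/

section ReducedResolution

open Sum

variable {k : Type u} [Field k] {p : ℕ} [CharP k p] {α : Type} [Fintype α] [DecidableEq α]
  {Y : Type u} [AddCommGroup Y] [Module (LambdaAlgebra k p (2 * p)) Y]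

lemma relRes_alt (hp : p.Prime) (hp3 : 3 ≤ p)
    (hY : IsRetract (LambdaAlgebra k p (2 * p)) Y (TensorSpace k p (2 * p))) {ν : α → ℕ} {m : ℕ}
    (hm0 : 0 < m) (hmp : m < p) (hν : ∑ a, ν a + m = 2 * p) :
    RelRes (LambdaAlgebra k p (2 * p)) Y (LQuot (k := k) (d := 2 * p) p (Alt k (2 * p) ν m)) := by
  refine RelRes.of_isRetract (relRes_content hp hp3 hY (labelled ν m) ?_ ⟨inr ⟨0, hm0⟩, ?_⟩)
    (LQuot.isRetract (isRetract_alt_content ν (factorial_cast_ne_zero hp hmp)))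
  · rwa [sum_labelled]
  · exact hp.not_dvd_one

lemma eq_or_eq_of_dvd (hp0 : 0 < p) {n : ℕ} (hn : p ∣ n) (hn0 : n ≠ 0) (hn2 : n ≤ 2 * p) :
    n = p ∨ n = 2 * p := by
  obtain ⟨c, rfl⟩ := hn
  have h1 : c ≤ 2 := by nlinarith
  interval_cases c <;> omega

lemma apply_add_apply_le_sum {κ : α → ℕ} {i j : α} (hij : i ≠ j) : κ i + κ j ≤ ∑ a, κ a := by
  rw [← Finset.sum_pair hij]
  exact Finset.sum_le_sum_of_subset (Finset.subset_univ _)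

lemma exists_eq_prime_of_dvd (hp0 : 0 < p) {κ : α → ℕ} (hκ : ∑ a, κ a = 2 * p)
    (hκp : ∀ a, p ∣ κ a) : (∃ i, κ i = 2 * p) ∨ ∃ i j, i ≠ j ∧ κ i = p ∧ κ j = p := by
  obtain ⟨i, -, hi⟩ := Finset.exists_ne_zero_of_sum_ne_zero (hκ.trans_ne (by omega))
  have hle : ∀ a, κ a ≤ 2 * p := fun a =>
    hκ ▸ Finset.single_le_sum (fun _ _ => Nat.zero_le _) (Finset.mem_univ a)
  rcases eq_or_eq_of_dvd hp0 (hκp i) hi (hle i) with h | h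
  · have h1 : ∑ a ∈ Finset.univ.erase i, κ a ≠ 0 := by
      have := Finset.add_sum_erase Finset.univ κ (Finset.mem_univ i)
      omega
    obtain ⟨j, hj, hj0⟩ := Finset.exists_ne_zero_of_sum_ne_zero h1
    have hij : i ≠ j := (Finset.ne_of_mem_erase hj).symm
    refine Or.inr ⟨i, j, hij, h, ?_⟩
    rcases eq_or_eq_of_dvd hp0 (hκp j) hj0 (hle j) with h' | h'
    · exact h'
    · have := apply_add_apply_le_sum (κ := κ) hij
      omega
  · exact Or.inl ⟨i, h⟩

lemma subsingleton_piece {κ : α → ℕ} (hκp : ∀ a, p ∣ κ a) {d : ℕ} {i : α} (hi : κ i = d) :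
    Subsingleton (Piece k p d κ) := by
  have h1 : ∀ c : Piece k p d κ, c.1 = 0 := fun c => by
    obtain ⟨hc, hc'⟩ := mem_piece.1 c.2
    have h2 : ∀ u, u ≠ (fun _ => i) → c.1 u = 0 := fun u hu => by
      by_contra h0
      have h3 := mem_contentSpace.1 hc u h0 i
      rw [hi] at h3
      have h4 : (Finset.univ.filter fun x => u x = i) = Finset.univ :=
        Finset.eq_univ_of_card _ (h3.trans (Fintype.card_fin _).symm)
      exact hu (funext fun x => Finset.filter_eq_self.1 h4 x (Finset.mem_univ x))
    funext u
    by_cases hu : u = fun _ => i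
    · rw [hu]
      exact (Finset.sum_eq_single _ (fun u _ => h2 u) (by simp)).symm.trans (hc' hκp)
    · exact h2 u hu
  exact ⟨fun c c' => Subtype.ext ((h1 c).trans (h1 c').symm)⟩

lemma relRes_piece (hp : p.Prime) (hp3 : 3 ≤ p)
    (hY : IsRetract (LambdaAlgebra k p (2 * p)) Y (TensorSpace k p (2 * p))) {κ : α → ℕ}
    (hκ : ∑ a, κ a = 2 * p) : RelRes (LambdaAlgebra k p (2 * p)) Y
      (LQuot (k := k) (d := 2 * p) p (Piece k p (2 * p) κ)) := by
  by_cases hκp : ∀ a, p ∣ κ a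
  · rcases exists_eq_prime_of_dvd hp.pos hκ hκp with ⟨i, hi⟩ | ⟨i, j, hij, hi, hj⟩
    · have := subsingleton_piece (k := k) hκp hi
      have := LQuot.subsingleton_of_subsingleton (k := k) (d := 2 * p) (p := p)
        (V := Piece k p (2 * p) κ)
      exact .of_projective inferInstance
    · obtain ⟨δ, H⟩ := exists_homExact_fuseKer (k := k) hκ hij hp hp3 hi hj
      obtain ⟨e⟩ := nonempty_fuseKer_zero_equiv (k := k) hκ hij hp hp3 hi hj hκp
      refine ((H.of_isRetract hY).relRes fun t => ?_).of_isRetract (.of_equiv e.symm)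
      rcases lt_or_ge (t + 1) p with ht | ht
      · refine (relRes_alt hp hp3 hY t.succ_pos ht ?_).of_isRetract
          (isRetract_fuseKer (k := k) hκ hij hp hp3 hi hj (t + 1))
        rw [sum_sub_single (by omega), hκ]
      · have := subsingleton_fuseKer (k := k) hκ hij hp hp3 hi hj ht
        exact .of_projective inferInstance
  · rw [piece_eq_contentSpace (k := k) (d := 2 * p) (not_forall.1 hκp)]
    exact relRes_content hp hp3 hY κ hκ (not_forall.1 hκp)

lemma relRes_reduced (hp : p.Prime) (hp3 : 3 ≤ p)
    (hY : IsRetract (LambdaAlgebra k p (2 * p)) Y (TensorSpace k p (2 * p))) :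
    RelRes (LambdaAlgebra k p (2 * p)) Y
      (LQuot (k := k) (d := 2 * p) p (Reduced k p (2 * p) α)) := by
  obtain ⟨n, κ, hκ, h⟩ := isRetract_reduced (k := k) (p := p) (d := 2 * p) (α := α)
  exact (RelRes.pi n _ fun j => relRes_piece hp hp3 hY (hκ j)).of_isRetract h

end ReducedResolution

section AddMembership

open Sum

variable {k : Type u} [Field k] {p : ℕ} [CharP k p] {L : Type} [Fintype L] [DecidableEq L]

/-- The labels can be stored in the letters which do not occur. -/
lemma memAdd_alt (hp : p.Prime) {d : ℕ} {ν : L → ℕ} {m : ℕ} (hm0 : 0 < m) (hmp : m < p)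
    (hν : m ≤ (Finset.univ.filter fun l => ν l = 0).card) :
    MemAdd (LambdaAlgebra k p d) (LQuot (k := k) (d := d) p (Reduced k p d L))
      (LQuot (k := k) (d := d) p (Alt k d ν m)) := by
  have h0 : Fintype.card (Fin m) ≤ Fintype.card {l // ν l = 0} := by
    rwa [Fintype.card_fin, Fintype.card_subtype]
  obtain ⟨f⟩ := Function.Embedding.nonempty_of_card_le h0
  let g : L ⊕ Fin m → L := Sum.elim id fun x => (f x).1
  have hg : ∀ a b, labelled ν m a ≠ 0 → labelled ν m b ≠ 0 → g a = g b → a = b := by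
    rintro (a | a) (b | b) ha hb h
    · exact congrArg inl h
    · exact absurd ((congrArg ν h).trans (f b).2) ha
    · exact absurd ((congrArg ν h).symm.trans (f a).2) hb
    · exact congrArg inr (f.injective (Subtype.ext h))
  let h : L → L ⊕ Fin m := fun l =>
    if hl : ∃ a, labelled ν m a ≠ 0 ∧ g a = l then hl.choose else inl l
  have hgh : ∀ a, labelled ν m a ≠ 0 → h (g a) = a := fun a ha => by
    have hl : ∃ b, labelled ν m b ≠ 0 ∧ g b = g a := ⟨a, ha, rfl⟩
    show (if hl : ∃ b, labelled ν m b ≠ 0 ∧ g b = g a then hl.choose else inl (g a)) = a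
    rw [dif_pos hl]
    exact hg _ _ hl.choose_spec.1 ha hl.choose_spec.2
  let κ : L → ℕ := fun l => ∑ a with g a = l, labelled ν m a
  have hκ : ¬ p ∣ κ (g (inr ⟨0, hm0⟩)) := by
    have h1 : κ (g (inr ⟨0, hm0⟩)) = 1 := by
      refine (Finset.sum_eq_single (inr ⟨0, hm0⟩) (fun a ha hne => ?_) fun hne => ?_).trans rfl
      · by_contra h'
        exact hne (hg _ _ h' one_ne_zero (Finset.mem_filter.1 ha).2)
      · exact (hne (Finset.mem_filter.2 ⟨Finset.mem_univ _, rfl⟩)).elim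
    rw [h1]
    exact hp.not_dvd_one
  exact (memAdd_content ⟨_, hκ⟩).of_isRetract (LQuot.isRetract
    ((isRetract_alt_content ν (factorial_cast_ne_zero hp hmp)).trans
      (isRetract_content (fun _ => rfl) hgh)))

end AddMembership

/-! ### Coresolutions -/

section Coresolution

open Sum

variable {k : Type u} [Field k] {p : ℕ}

lemma RelCores.of_subsingleton {A : Type u} [Ring A] {Y X : Type u} [AddCommGroup Y] [Module A Y]
    [AddCommGroup X] [Module A X] [Subsingleton X] : RelCores A Y X :=
  .of_memAdd ((MemAdd.self A Y).of_isRetract .of_subsingleton)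

/-- The state of the induction in `relCores_alt_of`. -/
def coresRank {L : Type} (ι : Fin p → L) (κ : L → ℕ) (m : ℕ) : Lex (Fin p → ℕ) :=
  toLex fun r => if (r : ℕ) < m then κ (ι r.rev) + 1 else 0

section Induction

variable [CharP k p] {L : Type} [Fintype L] [DecidableEq L] {Y : Type u} [AddCommGroup Y]
  [Module (LambdaAlgebra k p (2 * p)) Y]

lemma coresRank_lt_of_lt {ι : Fin p → L} (hι : Function.Injective ι) {μ : L → ℕ} {m t : ℕ}
    (hmp : m + 1 ≤ p) (ht : t < m + 1) :
    coresRank ι (μ - Pi.single (ι (Fin.rev ⟨m, hmp⟩)) t) t <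
      coresRank ι (μ - Pi.single (ι (Fin.rev ⟨m, hmp⟩)) (m + 1)) (m + 1) := by
  refine ⟨⟨t, by omega⟩, fun j hj => ?_, ?_⟩
  · have hj' : (j : ℕ) < t := hj
    have h1 : ι j.rev ≠ ι (Fin.rev ⟨m, hmp⟩) := fun h => by
      have := congrArg Fin.val (Fin.rev_injective (hι h))
      simp only at this
      omega
    simp [coresRank, hj', h1, show (j : ℕ) ≤ m by omega]
  · simp [coresRank, Nat.le_of_lt_succ ht]

lemma coresRank_lt_of_gt {ι : Fin p → L} (hι : Function.Injective ι) {μ : L → ℕ} {m t : ℕ}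
    (hmp : m + 1 ≤ p) (ht : m + 1 < t) (htμ : t ≤ μ (ι (Fin.rev ⟨m, hmp⟩))) :
    coresRank ι (μ - Pi.single (ι (Fin.rev ⟨m, hmp⟩)) t) t <
      coresRank ι (μ - Pi.single (ι (Fin.rev ⟨m, hmp⟩)) (m + 1)) (m + 1) := by
  refine ⟨⟨m, hmp⟩, fun j hj => ?_, ?_⟩
  · have hj' : (j : ℕ) < m := hj
    have h1 : ι j.rev ≠ ι (Fin.rev ⟨m, hmp⟩) := fun h => by
      have := congrArg Fin.val (Fin.rev_injective (hι h))
      simp only at this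
      omega
    simp [coresRank, h1, hj'.trans ((Nat.lt_succ_self m).trans ht), hj'.le]
  · have h2 : m < t := (Nat.lt_succ_self m).trans ht
    simp only [coresRank, Pi.toLex_apply, h2, if_true, Nat.lt_succ_self, Pi.sub_apply,
      Pi.single_eq_same]
    omega

/-- The induction on the number of labels. -/
theorem relCores_alt_of (hp : p.Prime) (hp3 : 3 ≤ p)
    (hY : IsRetract (LambdaAlgebra k p (2 * p)) Y (TensorSpace k p (2 * p)))
    {ι : Fin p → L} (hι : Function.Injective ι)
    (base : ∀ κ : L → ℕ, ∑ a, κ a = 2 * p → (∀ a ∉ Set.range ι, κ a = 1) → (∃ a, ¬ p ∣ κ a) →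
      RelCores (LambdaAlgebra k p (2 * p)) Y
        (LQuot (k := k) (d := 2 * p) p (contentSpace k (2 * p) κ)))
    (special : ∀ μ : L → ℕ, ∑ a, μ a = 2 * p → (∀ a ∉ Set.range ι, μ a = 1) → (∀ a, p ∣ μ a) →
      ∀ i m, 0 < m → m < p → m ≤ μ i → RelCores (LambdaAlgebra k p (2 * p)) Y
        (LQuot (k := k) (d := 2 * p) p (Alt k (2 * p) (μ - Pi.single i m) m)))
    (κ : L → ℕ) (m : ℕ) (hκ : ∑ a, κ a + m = 2 * p) (h1 : ∀ a ∉ Set.range ι, κ a = 1)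
    (hg : ¬ p ∣ m ∨ ∃ a, ¬ p ∣ κ a) :
    RelCores (LambdaAlgebra k p (2 * p)) Y
      (LQuot (k := k) (d := 2 * p) p (Alt k (2 * p) κ m)) := by
  have h2 := two_ne_zero_of_three_le (k := k) hp3
  induction hr : coresRank ι κ m using WellFoundedLT.induction generalizing κ m with
  | _ r ih =>
  subst hr
  rcases m with - | m
  · exact (base κ hκ h1 (hg.resolve_left fun h => h (dvd_zero p))).of_equiv
      (LQuot.congr (k := k) (d := 2 * p) (p := p) (contentEquivAlt κ).symm)
  rcases lt_or_ge p (m + 1) with hmp | hmp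
  · have := subsingleton_alt (k := k) (d := 2 * p) (p := p) h2 κ hmp
    exact .of_subsingleton
  have hi : ι (Fin.rev ⟨m, hmp⟩) ∈ Set.range ι := ⟨_, rfl⟩
  obtain ⟨μ, rfl, hmμ⟩ : ∃ μ : L → ℕ, κ = μ - Pi.single (ι (Fin.rev ⟨m, hmp⟩)) (m + 1) ∧
      m + 1 ≤ μ (ι (Fin.rev ⟨m, hmp⟩)) :=
    ⟨κ + Pi.single (ι (Fin.rev ⟨m, hmp⟩)) (m + 1), by simp, by simp⟩
  have hlt := fun t => coresRank_lt_of_lt hι (μ := μ) (t := t) hmp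
  have hgt := fun t => coresRank_lt_of_gt hι (μ := μ) (t := t) hmp
  generalize ι (Fin.rev ⟨m, hmp⟩) = i at hi hmμ hlt hgt hκ h1 hg ih ⊢
  rw [sum_sub_single hmμ] at hκ
  have hμ1 : ∀ a ∉ Set.range ι, μ a = 1 := fun a ha => by
    have hai : a ≠ i := fun h => ha (h ▸ hi)
    simpa [hai] using h1 a ha
  by_cases hsp : ∀ a, p ∣ μ a
  · refine special μ hκ hμ1 hsp i (m + 1) m.succ_pos (lt_of_le_of_ne hmp fun h => ?_) hmμ
    rcases hg with hg | ⟨a, ha⟩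
    · exact hg h.symm.dvd
    · refine ha ?_
      by_cases hai : a = i
      · subst hai
        rw [Pi.sub_apply, Pi.single_eq_same]
        exact Nat.dvd_sub (hsp a) h.symm.dvd
      · simpa [hai] using hsp a
  refine ((homExact_stage (k := k) (p := p) h2 hκ (i := i)
    (m.succ_pos.trans_le hmμ)).of_isRetract hY).relCores (m + 1) fun t ht => ?_
  rcases lt_or_ge (μ i) t with htμ | htμ
  · have := subsingleton_alt_of_sum (k := k) (d := 2 * p) (ν := μ - Pi.single i t) (m := t) (by
      have h3 := sum_add_sum_eq_of_eqOn_compl {i} (f := (μ - Pi.single i t : L → ℕ)) (g := μ)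
        (fun a ha => by simp [show a ≠ i by simpa using ha])
      rw [Finset.sum_singleton, Finset.sum_singleton, Pi.sub_apply, Pi.single_eq_same] at h3
      omega)
    have := LQuot.subsingleton_of_subsingleton (k := k) (d := 2 * p) (p := p)
      (V := Stage k (2 * p) μ i t)
    exact .of_subsingleton
  · refine ih _ (ht.lt_or_gt.elim (hlt t) fun h => hgt t h htμ) _ t ?_ (fun a ha => ?_) ?_ rfl
    · rw [sum_sub_single htμ, hκ]
    · have hai : a ≠ i := fun h => ha (h ▸ hi)
      simpa [hai] using hμ1 a ha
    · obtain ⟨a, ha⟩ := not_forall.1 hsp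
      by_cases hpt : p ∣ t
      · refine Or.inr ⟨a, ?_⟩
        by_cases hai : a = i
        · subst hai
          rw [Pi.sub_apply, Pi.single_eq_same, Nat.dvd_sub_iff_left htμ hpt]
          exact ha
        · simpa [hai] using ha
      · exact Or.inl hpt

end Induction

end Coresolution

section Coresolution

open Sum

variable {k : Type u} [Field k] {p : ℕ} [CharP k p]

lemma le_card_zeros {ν : Fin p → ℕ} (s : Finset (Fin p)) {n : ℕ} (hn : n + s.card ≤ p)
    (h : ∀ a ∉ s, ν a = 0) : n ≤ (Finset.univ.filter fun a => ν a = 0).card := by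
  have h1 : sᶜ ⊆ Finset.univ.filter fun a => ν a = 0 := fun a ha =>
    Finset.mem_filter.2 ⟨Finset.mem_univ a, h a (Finset.mem_compl.1 ha)⟩
  have h2 := Finset.card_le_card h1
  rw [Finset.card_compl, Fintype.card_fin] at h2
  omega

lemma eq_zero_of_sum_le {α : Type} [Fintype α] [DecidableEq α] {κ : α → ℕ} (s : Finset α)
    (h : ∑ a, κ a ≤ ∑ a ∈ s, κ a) {a : α} (ha : a ∉ s) : κ a = 0 := by
  have h1 := Finset.sum_le_sum_of_subset (f := κ) (Finset.subset_univ (insert a s))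
  rw [Finset.sum_insert ha] at h1
  omega

lemma memAdd_fuseKer (hp : p.Prime) (hp3 : 3 ≤ p) {μ : Fin p → ℕ} (hμ : ∑ a, μ a = 2 * p)
    {i j : Fin p} (hij : i ≠ j) (hi : μ i = p) (hj : μ j = p) (hμp : ∀ a, p ∣ μ a)
    {t : ℕ} (ht : t + 2 ≤ p) :
    MemAdd (LambdaAlgebra k p (2 * p))
      (LQuot (k := k) (d := 2 * p) p (Reduced k p (2 * p) (Fin p))) (FuseKer k hμ hij t) := by
  rcases t with - | t
  · obtain ⟨e⟩ := nonempty_fuseKer_zero_equiv (k := k) hμ hij hp hp3 hi hj hμp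
    exact (MemAdd.self _ _).of_isRetract
      ((IsRetract.of_equiv e).trans (LQuot.isRetract (isRetract_piece μ)))
  · refine (memAdd_alt hp t.succ_pos (by omega) (le_card_zeros {i, j} ?_
      fun a ha => ?_)).of_isRetract
      (isRetract_fuseKer (k := k) hμ hij hp hp3 hi hj (t + 1))
    · rwa [Finset.card_pair hij]
    · rw [Pi.sub_apply, eq_zero_of_sum_le (κ := μ) {i, j} (by rw [Finset.sum_pair hij]; omega) ha,
        Nat.zero_sub]

lemma relCores_special (hp : p.Prime) (hp3 : 3 ≤ p)
    (hY : IsRetract (LambdaAlgebra k p (2 * p))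
      (LQuot (k := k) (d := 2 * p) p (Reduced k p (2 * p) (Fin p))) (TensorSpace k p (2 * p)))
    {μ : Fin p → ℕ} (hμ : ∑ a, μ a = 2 * p) (hμp : ∀ a, p ∣ μ a) {i : Fin p} {m : ℕ}
    (hm0 : 0 < m) (hmp : m < p) (hm : m ≤ μ i) :
    RelCores (LambdaAlgebra k p (2 * p))
      (LQuot (k := k) (d := 2 * p) p (Reduced k p (2 * p) (Fin p)))
      (LQuot (k := k) (d := 2 * p) p (Alt k (2 * p) (μ - Pi.single i m) m)) := by
  have hle : ∀ a, μ a ≤ 2 * p := fun a =>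
    hμ ▸ Finset.single_le_sum (fun _ _ => Nat.zero_le _) (Finset.mem_univ a)
  rcases eq_or_eq_of_dvd hp.pos (hμp i) (by omega) (hle i) with hi | hi
  swap
  · refine .of_memAdd (memAdd_alt hp hm0 hmp (le_card_zeros {i} (by simpa using hmp)
      fun a ha => ?_))
    rw [Pi.sub_apply, eq_zero_of_sum_le (κ := μ) {i} (by rw [Finset.sum_singleton]; omega) ha,
      Nat.zero_sub]
  obtain ⟨j, hij, hj⟩ : ∃ j, i ≠ j ∧ μ j = p := by
    rcases exists_eq_prime_of_dvd hp.pos hμ hμp with ⟨j, hj⟩ | ⟨j, l, hjl, hj, hl⟩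
    · have hij : i ≠ j := fun h => by subst h; omega
      have := apply_add_apply_le_sum (κ := μ) hij
      omega
    · by_cases hij : i = j
      · exact ⟨l, hij ▸ hjl, hl⟩
      · exact ⟨j, hij, hj⟩
  rcases lt_or_ge (m + 1) p with hm2 | hm2
  · refine .of_memAdd (memAdd_alt hp hm0 hmp (le_card_zeros {i, j} ?_ fun a ha => ?_))
    · rw [Finset.card_pair hij]; omega
    · rw [Pi.sub_apply, eq_zero_of_sum_le (κ := μ) {i, j} (by rw [Finset.sum_pair hij]; omega) ha,
        Nat.zero_sub]
  obtain ⟨δ, H⟩ := exists_homExact_fuseKer (k := k) hμ hij hp hp3 hi hj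
  have h1 := (H.of_isRetract hY).relCores m fun t ht => by
    rcases lt_or_ge t p with htp | htp
    · exact .of_memAdd (memAdd_fuseKer hp hp3 hμ hij hi hj hμp (by omega))
    · have := subsingleton_fuseKer (k := k) hμ hij hp hp3 hi hj htp
      exact .of_subsingleton
  obtain ⟨ψ, hψ⟩ := exists_map_pushStage_section (k := k) hμ hij hp hp3 hi hj m
  obtain ⟨e⟩ := nonempty_equiv_ker_prod hψ
  refine (h1.prod_memAdd (memAdd_alt hp hm0 hmp
    (le_card_zeros {i} (by simpa using hmp) fun a ha => ?_))).of_equiv e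
  rw [Finset.mem_singleton] at ha
  rw [Pi.sub_apply]
  by_cases haj : a = j
  · rw [haj, fused_right hij, Nat.zero_sub]
  · rw [fused_of_ne ha haj, eq_zero_of_sum_le (κ := μ) {i, j} (by rw [Finset.sum_pair hij]; omega)
      (by simp [ha, haj]), Nat.zero_sub]

lemma relCores_content_labelled (hp : p.Prime) (hp3 : 3 ≤ p)
    (hY : IsRetract (LambdaAlgebra k p (2 * p))
      (LQuot (k := k) (d := 2 * p) p (Reduced k p (2 * p) (Fin p))) (TensorSpace k p (2 * p)))
    (n : ℕ) {ν : Fin p → ℕ} (hν : ∑ a, ν a + (n + 1) = 2 * p) :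
    RelCores (LambdaAlgebra k p (2 * p))
      (LQuot (k := k) (d := 2 * p) p (Reduced k p (2 * p) (Fin p)))
      (LQuot (k := k) (d := 2 * p) p (contentSpace k (2 * p) (labelled ν (n + 1)))) := by
  induction n generalizing ν with
  | zero =>
    rw [← alt_eq_contentSpace (k := k) (d := 2 * p) ν le_rfl]
    exact relCores_alt_of hp hp3 hY (ι := id) Function.injective_id
      (fun κ _ _ hκ => .of_memAdd (memAdd_content hκ))
      (fun μ hμ _ hμp i m hm0 hmp hm => relCores_special hp hp3 hY hμ hμp hm0 hmp hm)
      ν 1 hν (fun a ha => absurd ⟨a, rfl⟩ ha) (Or.inl hp.not_dvd_one)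
  | succ n ih =>
    have h0 : ∀ x, (inr x : Fin p ⊕ Fin (n + 1)) ∉
        Set.range (inl : Fin p → Fin p ⊕ Fin (n + 1)) := by
      rintro x ⟨a, ha⟩
      exact inl_ne_inr ha
    have h1 := relCores_alt_of hp hp3 hY (ι := (inl : Fin p → Fin p ⊕ Fin (n + 1))) inl_injective
      (fun κ hκ hκ1 _ => by
        have h2 : κ = labelled (κ ∘ inl) (n + 1) := by
          funext a
          rcases a with a | a
          · rfl
          · exact hκ1 _ (h0 a)
        rw [h2]
        rw [h2, sum_labelled] at hκ
        exact ih hκ)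
      (fun μ _ hμ1 hμp => absurd (hμp (inr 0)) (by rw [hμ1 _ (h0 0)]; exact hp.not_dvd_one))
      (labelled ν (n + 1)) 1 (by rw [sum_labelled]; omega)
      (fun a ha => by
        rcases a with a | a
        · exact absurd ⟨a, rfl⟩ ha
        · rfl)
      (Or.inl hp.not_dvd_one)
    rw [alt_eq_contentSpace (k := k) (d := 2 * p) _ le_rfl] at h1
    exact h1.of_equiv (LQuot.congr (k := k) (d := 2 * p) (p := p) (contentEquiv
      ((Equiv.sumAssoc _ _ _).trans (Equiv.sumCongr (Equiv.refl _) finSumFinEquiv))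
      (by rintro ((a | a) | a) <;> rfl)).symm)

lemma relCores_self (hp : p.Prime) (hp3 : 3 ≤ p)
    (hY : IsRetract (LambdaAlgebra k p (2 * p))
      (LQuot (k := k) (d := 2 * p) p (Reduced k p (2 * p) (Fin p))) (TensorSpace k p (2 * p))) :
    RelCores (LambdaAlgebra k p (2 * p))
      (LQuot (k := k) (d := 2 * p) p (Reduced k p (2 * p) (Fin p)))
      (LambdaAlgebra k p (2 * p)) := by
  obtain ⟨n, hn⟩ : ∃ n, n + 1 = 2 * p := ⟨2 * p - 1, by omega⟩
  have h1 := relCores_content_labelled hp hp3 hY n (ν := 0) (by simpa using hn)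
  rw [hn] at h1
  obtain ⟨e⟩ := nonempty_groupAlgebra_equiv (k := k) (d := 2 * p)
    (κ := labelled (0 : Fin p → ℕ) (2 * p)) (u := inr)
    (by rintro (a | a) <;> simp [labelled]) (by
      rintro (a | a) <;> simp [wcount, labelled, Finset.filter_eq'])
  exact h1.of_equiv (LQuot.selfEquiv.trans (LQuot.congr (k := k) (d := 2 * p) (p := p) e))

end Coresolution

/-- Let `k` be an algebraically closed field of prime characteristic `p ≥ 3` and
`Λ = Λ_k(p, 2p)`. Then there are a positive integer `t` and a `Λ`-module `Y` with
`V^{⊗2p} ≅ k^t ⊕ Y` (`k` the trivial module), such that `Y` is a tilting `Λ`-module: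
`Ext^i_Λ(Y, Y) = 0` for all `i ≥ 1`, `Y` has finite projective dimension, and there is an
exact sequence `0 → Λ → Y_0 → ⋯ → Y_m → 0` with all `Y_j ∈ add Y`. -/
theorem tensorSpace_trivial_summand_tilting (k : Type u) [Field k] [IsAlgClosed k]
    (p : ℕ) (hp : p.Prime) [CharP k p] (hp3 : 3 ≤ p) [NeZero p] :
    ∃ (t : ℕ), 0 < t ∧
      ∃ (Y : Type u) (_ : AddCommGroup Y) (_ : Module (LambdaAlgebra k p (2 * p)) Y),
        Nonempty (TensorSpace k p (2 * p) ≃ₗ[LambdaAlgebra k p (2 * p)]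
          ((Fin t → TrivialModule k p (2 * p)) × Y)) ∧
        (∀ i : ℕ, 1 ≤ i → ExtIsZero k (LambdaAlgebra k p (2 * p)) Y Y i) ∧
        (∃ m : ℕ, PDimLE (LambdaAlgebra k p (2 * p)) m Y) ∧
        HasFiniteCoresolutionByAdd (LambdaAlgebra k p (2 * p)) Y
          (LambdaAlgebra k p (2 * p)) := by
  obtain ⟨t, ht, e⟩ := exists_tensorSpace_equiv (k := k) hp hp3
  have hY := isRetract_tensorSpace (k := k) hp hp3
  have h := relRes_reduced (α := Fin p) hp hp3 hY
  exact ⟨t, ht, LQuot (k := k) (d := 2 * p) p (Reduced k p (2 * p) (Fin p)), inferInstance,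
    inferInstance, e, fun i hi => h.extIsZero i hi, h.pdimLE,
    (relCores_self hp hp3 hY).hasFiniteCoresolutionByAdd⟩
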